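/- Existence of the Green function with pointwise bounds: there exists a nonnegative function g : Ω × Ω → [0, +∞] such that for every y ∈ Ω: (a) for every R > 0 and every q ∈ [1, n/(n−1)), the function g(·,y) belongs to the unweighted Sobolev space W^{1,q}(B(y,R)) (it and its distributional gradient are in L^q(B(y,R)) with respect to Lebesgue measure); (b) for every φ ∈ C_c^∞(Ω), ∫_Ω A(x) ∇_x g(x,y) · ∇φ(x) dx = φ(y); in particular g(·,y) is a solution of Lu = 0 in Ω ∖ {y}; (c) for every α ∈ C_c^∞(ℝⁿ) with α ≡ 1 in a neighborhood of y, the function (1−α) g(·,y) belongs to W and its trace vanishes σ-almost everywhere on Γ; (d) there is C > 0, depending only on n, d, C₀, C₁, such that 0 ≤ g(x,y) ≤ C |x−y|^{1−d} whenever 4|x−y| ≥ δ(y), and, if n ≥ 3, g(x,y) ≤ C |x−y|^{2−n} δ(y)^{n−d−1} whenever 0 < 2|x−y| ≤ δ(y); if n = 2, then for every ϵ > 0 there is C_ϵ > 0 (depending only on d, C₀, C₁, ϵ) with g(x,y) ≤ C_ϵ δ(y)^{n−d−1} (δ(y)/|x−y|)^ϵ whenever 0 < 2|x−y| ≤ δ(y).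 -/

import Mathlib

open MeasureTheory Metric Set Filter
open scoped ENNReal NNReal Topology

noncomputable section

/-- Euclidean space `ℝⁿ`. -/
abbrev Euc (n : ℕ) := EuclideanSpace ℝ (Fin n)

/-- `Γ ⊆ ℝⁿ` is `d`-Ahlfors regular with constant `C₀`. -/
def AhlforsRegular (n : ℕ) (d C₀ : ℝ) (Γ : Set (Euc n)) : Prop :=
  ∀ x ∈ Γ, ∀ r : ℝ, 0 < r →
    ENNReal.ofReal (C₀⁻¹ * r ^ d) ≤ μH[d] (Γ ∩ ball x r) ∧
      μH[d] (Γ ∩ ball x r) ≤ ENNReal.ofReal (C₀ * r ^ d)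

/-- The weight `w(x) = dist(x, Γ) ^ (d + 1 - n)`. -/
def weightW (n : ℕ) (d : ℝ) (Γ : Set (Euc n)) (x : Euc n) : ℝ :=
  infDist x Γ ^ (d + 1 - (n : ℝ))

/-- The measure `m` with density `w` with respect to Lebesgue measure. -/
def measW (n : ℕ) (d : ℝ) (Γ : Set (Euc n)) : Measure (Euc n) :=
  volume.withDensity fun x => ENNReal.ofReal (weightW n d Γ x)

/-- `v` is a distributional gradient of `u` on the open set `E`: for every smooth
compactly supported test function `φ` with support in `E`, `∫_E u ∇φ = -∫_E φ v`. -/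
def IsDistribGradOn {n : ℕ} (u : Euc n → ℝ) (v : Euc n → Euc n) (E : Set (Euc n)) : Prop :=
  ∀ φ : Euc n → ℝ, ContDiff ℝ (⊤ : ℕ∞) φ → HasCompactSupport φ → tsupport φ ⊆ E →
    ∫ x in E, u x • gradient φ x = -∫ x in E, φ x • v x

/-- The averages of `u` over small balls centered at `x` converge to `t`. -/
def HasTraceAt {n : ℕ} (u : Euc n → ℝ) (x : Euc n) (t : ℝ) : Prop :=
  Tendsto (fun ρ : ℝ => ⨍ y in ball x ρ, u y) (𝓝[>] (0 : ℝ)) (𝓝 t)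

/-- `u` belongs to the weighted Sobolev space `W = Ẇ^{1,2}_w(Ω)`, `Ω = Γᶜ`, with
distributional gradient `v` on `Ω` lying in `L²(Ω, m)`. -/
structure MemW (n : ℕ) (d : ℝ) (Γ : Set (Euc n)) (u : Euc n → ℝ) (v : Euc n → Euc n) :
    Prop where
  locInt : LocallyIntegrableOn u Γᶜ volume
  gradLocInt : LocallyIntegrableOn v Γᶜ volume
  isGrad : IsDistribGradOn u v Γᶜ
  l2 : ∫⁻ x in Γᶜ, ENNReal.ofReal (‖v x‖ ^ 2) ∂(measW n d Γ) < ⊤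

/-- `u` belongs to the local space `W_r(E)`: `u ∈ L¹_loc(E)` and `φ u` (extended by `0`)
belongs to `W` for every smooth compactly supported `φ` with support in `E`. -/
def MemWrOn (n : ℕ) (d : ℝ) (Γ : Set (Euc n)) (E : Set (Euc n)) (u : Euc n → ℝ) : Prop :=
  LocallyIntegrableOn u E volume ∧
    ∀ φ : Euc n → ℝ, ContDiff ℝ (⊤ : ℕ∞) φ → HasCompactSupport φ → tsupport φ ⊆ E →
      ∃ vφ : Euc n → Euc n, MemW n d Γ (fun x => φ x * u x) vφ

/-- Degenerate ellipticity and boundedness conditions for the matrix `A`. -/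
def EllipticOn (n : ℕ) (d : ℝ) (Γ : Set (Euc n)) (A : Euc n → Euc n →L[ℝ] Euc n)
    (C₁ : ℝ) : Prop :=
  ∀ x, x ∉ Γ →
    (∀ ξ ζ : Euc n, |∑ i, A x ξ i * ζ i| ≤ C₁ * weightW n d Γ x * ‖ξ‖ * ‖ζ‖) ∧
      ∀ ξ : Euc n, C₁⁻¹ * weightW n d Γ x * ‖ξ‖ ^ 2 ≤ ∑ i, A x ξ i * ξ i

/-- `u`, with gradient `v`, is a weak subsolution of `- div A ∇u = 0` on `U ⊆ Ω = Γᶜ`. -/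
def SubsolOn {n : ℕ} (Γ : Set (Euc n)) (A : Euc n → Euc n →L[ℝ] Euc n)
    (v : Euc n → Euc n) (U : Set (Euc n)) : Prop :=
  ∀ φ : Euc n → ℝ, ContDiff ℝ (⊤ : ℕ∞) φ → HasCompactSupport φ → tsupport φ ⊆ U →
    (∀ x, 0 ≤ φ x) → ∫ x in Γᶜ, ∑ i, A x (v x) i * gradient φ x i ≤ 0

/-- `u`, with gradient `v`, is a weak supersolution of `- div A ∇u = 0` on `U ⊆ Ω = Γᶜ`. -/
def SupersolOn {n : ℕ} (Γ : Set (Euc n)) (A : Euc n → Euc n →L[ℝ] Euc n)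
    (v : Euc n → Euc n) (U : Set (Euc n)) : Prop :=
  ∀ φ : Euc n → ℝ, ContDiff ℝ (⊤ : ℕ∞) φ → HasCompactSupport φ → tsupport φ ⊆ U →
    (∀ x, 0 ≤ φ x) → 0 ≤ ∫ x in Γᶜ, ∑ i, A x (v x) i * gradient φ x i

/-- `u`, with gradient `v`, is a weak solution of `- div A ∇u = 0` on `U ⊆ Ω = Γᶜ`. -/
def SolOn {n : ℕ} (Γ : Set (Euc n)) (A : Euc n → Euc n →L[ℝ] Euc n)
    (v : Euc n → Euc n) (U : Set (Euc n)) : Prop :=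
  ∀ φ : Euc n → ℝ, ContDiff ℝ (⊤ : ℕ∞) φ → HasCompactSupport φ → tsupport φ ⊆ U →
    ∫ x in Γᶜ, ∑ i, A x (v x) i * gradient φ x i = 0

noncomputable section
lemma cs_sq {n : ℕ} {h : Euc n → ℝ} (hc : HasCompactSupport h) :
    HasCompactSupport fun x => h x ^ 2 := hc.comp_left (g := fun t : ℝ => t ^ 2) (by simp)
lemma cont_rpow_mul {n : ℕ} {F : Type*} [NormedAddCommGroup F] [NormedSpace ℝ F]
    {g : Euc n → F} (hg : Continuous g) {z : Euc n} (hz : z ∉ tsupport g) (s : ℝ) :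
    Continuous (fun x => ‖x - z‖ ^ s • g x) := by
  rw [continuous_iff_continuousAt]
  intro x
  by_cases hx : x = z
  · have h0 : g =ᶠ[𝓝 x] 0 := by
      rw [hx]; exact notMem_tsupport_iff_eventuallyEq.1 hz
    have : (fun x => ‖x - z‖ ^ s • g x) =ᶠ[𝓝 x] fun _ => 0 := by
      filter_upwards [h0] with t ht
      simp [ht]
    exact this.continuousAt
  · have : ‖x - z‖ ≠ 0 := by simpa [sub_eq_zero] using hx
    refine ContinuousAt.smul ?_ hg.continuousAt
    exact ContinuousAt.rpow_const (by fun_prop) (Or.inl this)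
lemma hasFDerivAt_rpow_mul {n : ℕ} {u : Euc n → ℝ} (hu : ContDiff ℝ 1 u) {z : Euc n}
    (hz : z ∉ tsupport u) (s : ℝ) (x : Euc n) :
    HasFDerivAt (fun x => ‖x - z‖ ^ s * u x)
      (‖x - z‖ ^ s • fderiv ℝ u x + (s * ‖x - z‖ ^ (s - 2) * u x) • innerSL ℝ (x - z)) x := by
  by_cases hx : x = z
  · subst hx
    have h0 : u =ᶠ[𝓝 x] 0 := notMem_tsupport_iff_eventuallyEq.1 hz
    have h1 : (fun t => ‖t - x‖ ^ s * u t) =ᶠ[𝓝 x] fun _ => 0 := by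
      filter_upwards [h0] with t ht
      simp [ht]
    have h2 : fderiv ℝ u x = 0 := by rw [h0.fderiv_eq]; simp
    have h3 : u x = 0 := h0.self_of_nhds
    rw [h2, h3]
    simpa using (hasFDerivAt_const (0 : ℝ) x).congr_of_eventuallyEq h1
  · have hn : ‖x - z‖ ≠ 0 := by simpa [sub_eq_zero] using hx
    have hpos : 0 < ‖x - z‖ := lt_of_le_of_ne (norm_nonneg _) hn.symm
    have h1 : HasFDerivAt (fun x => ‖x - z‖ ^ 2) _ x :=
      ((hasFDerivAt_id x).sub_const z).norm_sq
    have h2 := h1.rpow_const (p := s / 2) (Or.inl (by positivity))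
    have h3 := h2.mul (hu.differentiable one_ne_zero x).hasFDerivAt
    have e : ∀ t : Euc n, ∀ a : ℝ, (‖t - z‖ ^ 2) ^ a = ‖t - z‖ ^ (2 * a) := by
      intro t a
      rw [Real.rpow_mul (norm_nonneg _)]; norm_cast
    have h4 : (fun x => ‖x - z‖ ^ s * u x) = fun x => (‖x - z‖ ^ 2) ^ (s / 2) * u x := by
      funext t; rw [e]; congr 2; ring
    rw [h4]
    refine h3.congr_fderiv ?_
    ext v
    simp only [e, id, add_apply, smul_apply, smul_eq_mul,
      innerSL_apply_apply, ContinuousLinearMap.comp_apply, ContinuousLinearMap.id_apply]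
    rw [show 2 * (s / 2) = s by ring, show 2 * (s / 2 - 1) = s - 2 by ring]
    simp
    ring
lemma contDiff_rpow_mul {n : ℕ} {u : Euc n → ℝ} (hu : ContDiff ℝ 1 u) {z : Euc n}
    (hz : z ∉ tsupport u) (s : ℝ) : ContDiff ℝ 1 (fun x => ‖x - z‖ ^ s * u x) := by
  rw [contDiff_iff_contDiffAt]
  intro x
  by_cases hx : x = z
  · have h0 : u =ᶠ[𝓝 x] 0 := by
      rw [hx]; exact notMem_tsupport_iff_eventuallyEq.1 hz
    have h1 : (fun t => ‖t - z‖ ^ s * u t) =ᶠ[𝓝 x] fun _ => 0 := by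
      filter_upwards [h0] with t ht
      simp [ht]
    exact contDiffAt_const.congr_of_eventuallyEq h1
  · have hn : x - z ≠ 0 := by simpa [sub_eq_zero] using hx
    exact (((contDiffAt_id.sub contDiffAt_const).norm ℝ hn).rpow_const_of_ne
      (by simpa using hn)).mul hu.contDiffAt
lemma tsupport_rpow_mul {n : ℕ} {u : Euc n → ℝ} {z : Euc n} (s : ℝ) :
    tsupport (fun x => ‖x - z‖ ^ s * u x) ⊆ tsupport u :=
  closure_mono (Function.support_mul_subset_right _ _)
lemma cs_rpow_mul {n : ℕ} {u : Euc n → ℝ} (hc : HasCompactSupport u) {z : Euc n} (s : ℝ) :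
    HasCompactSupport (fun x => ‖x - z‖ ^ s * u x) := hc.mul_left
lemma norm_fderiv_rpow_mul_le {n : ℕ} {u : Euc n → ℝ} (hu : ContDiff ℝ 1 u) {z : Euc n}
    (hz : z ∉ tsupport u) (s : ℝ) (x : Euc n) :
    ‖fderiv ℝ (fun x => ‖x - z‖ ^ s * u x) x‖ ≤
      ‖x - z‖ ^ s * ‖fderiv ℝ u x‖ + |s| * (‖x - z‖ ^ (s - 1) * |u x|) := by
  rw [(hasFDerivAt_rpow_mul hu hz s x).fderiv]
  refine (norm_add_le _ _).trans (add_le_add ?_ ?_)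
  · rw [norm_smul, Real.norm_of_nonneg (Real.rpow_nonneg (norm_nonneg _) _)]
  · rw [norm_smul, innerSL_apply_norm, norm_mul, norm_mul, Real.norm_eq_abs, Real.norm_eq_abs,
      Real.norm_eq_abs, abs_of_nonneg (Real.rpow_nonneg (norm_nonneg _) _)]
    by_cases hx : x = z
    · subst hx
      have : u x = 0 := image_eq_zero_of_notMem_tsupport hz
      simp [this]
    · have hpos : 0 < ‖x - z‖ := by simpa [sub_eq_zero] using hx
      have : ‖x - z‖ ^ (s - 1) = ‖x - z‖ ^ (s - 2) * ‖x - z‖ := by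
        rw [← Real.rpow_add_one hpos.ne']; congr 1; ring
      rw [this]
      apply le_of_eq; ring
lemma integral_div_zero {n : ℕ} {h : Euc n → ℝ} (hh : ContDiff ℝ 1 h) (hc : HasCompactSupport h)
    (z : Euc n) :
    ∫ x, ((n : ℝ) * h x ^ 2 + 2 * (h x * fderiv ℝ h x (x - z))) = 0 := by
  have hd : ∀ x, DifferentiableAt ℝ h x := hh.differentiable one_ne_zero
  have hch : Continuous h := hh.continuous
  have hcf : Continuous (fderiv ℝ h) := hh.continuous_fderiv one_ne_zero
  have hsq : ∀ x, HasFDerivAt (fun x => h x ^ 2) ((2 * h x) • fderiv ℝ h x) x := by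
    intro x
    have := (hd x).hasFDerivAt.pow 2
    simpa using this
  have hf2 : ∀ x, fderiv ℝ (fun x => h x ^ 2) x = (2 * h x) • fderiv ℝ h x := fun x => (hsq x).fderiv
  have hc2 : HasCompactSupport (fun x => h x ^ 2) := cs_sq hc
  have hg : ∀ i : Fin n, ∀ x, HasFDerivAt (fun x : Euc n => (x - z) i)
      (EuclideanSpace.proj i : Euc n →L[ℝ] ℝ) x := by
    intro i x
    have := ((EuclideanSpace.proj i : Euc n →L[ℝ] ℝ).hasFDerivAt (x := x)).sub_const (z i)
    simpa using this
  have key : ∀ i : Fin n, ∫ x, (h x ^ 2 + 2 * (h x * (fderiv ℝ h x (EuclideanSpace.single i 1)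
      * (x - z) i))) = 0 := by
    intro i
    have i1 : Integrable (fun x => h x ^ 2) := by
      exact (by fun_prop : Continuous fun x => h x ^ 2).integrable_of_hasCompactSupport hc2
    have i2 : Integrable (fun x => 2 * (h x * (fderiv ℝ h x (EuclideanSpace.single i 1)
      * (x - z) i))) := by
      refine Continuous.integrable_of_hasCompactSupport ?_ (hc.mul_right).mul_left
      have : Continuous fun x : Euc n => (x - z) i := by
        exact (EuclideanSpace.proj i : Euc n →L[ℝ] ℝ).continuous.comp (continuous_id.sub continuous_const)
      fun_prop
    have := integral_mul_fderiv_eq_neg_fderiv_mul_of_integrable (μ := (volume : Measure (Euc n)))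
      (f := fun x => h x ^ 2) (g := fun x : Euc n => (x - z) i) (v := EuclideanSpace.single i 1)
      (by
        refine i2.congr (ae_of_all _ fun x => ?_)
        simp only [hf2, smul_apply, smul_eq_mul]; ring)
      (by
        refine i1.congr (ae_of_all _ fun x => ?_)
        simp only [(hg i x).fderiv]; simp)
      (by
        refine Continuous.integrable_of_hasCompactSupport ?_ hc2.mul_right
        have : Continuous fun x : Euc n => (x - z) i := by
          exact (EuclideanSpace.proj i : Euc n →L[ℝ] ℝ).continuous.comp (continuous_id.sub continuous_const)
        fun_prop)
      (fun x _ => (hsq x).differentiableAt) (fun x _ => (hg i x).differentiableAt)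
    rw [integral_add i1 i2]
    have e1 : ∫ x, h x ^ 2 * (fderiv ℝ (fun x : Euc n => (x - z) i) x) (EuclideanSpace.single i 1)
        = ∫ x, h x ^ 2 := by
      congr 1; funext x; rw [(hg i x).fderiv]; simp
    have e2 : ∫ x, (fderiv ℝ (fun x => h x ^ 2) x) (EuclideanSpace.single i 1) * (x - z) i
        = ∫ x, 2 * (h x * (fderiv ℝ h x (EuclideanSpace.single i 1) * (x - z) i)) := by
      congr 1; funext x; simp only [hf2, smul_apply, smul_eq_mul]; ring
    rw [e1, e2] at this
    linarith
  have hint : ∀ i : Fin n, Integrable (fun x => (h x ^ 2 + 2 * (h x *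
      (fderiv ℝ h x (EuclideanSpace.single i 1) * (x - z) i)))) := by
    intro i
    have hcc : Continuous fun x : Euc n => (x - z) i :=
      (EuclideanSpace.proj i : Euc n →L[ℝ] ℝ).continuous.comp (continuous_id.sub continuous_const)
    refine Continuous.integrable_of_hasCompactSupport (by fun_prop) ?_
    exact hc2.add (hc.mul_right).mul_left
  have hsum := Finset.sum_eq_zero (fun i (_ : i ∈ Finset.univ) => key i)
  rw [← integral_finsetSum _ (fun i _ => hint i)] at hsum
  rw [← hsum]
  congr 1; funext x
  rw [Finset.sum_add_distrib, ← Finset.mul_sum, ← Finset.mul_sum]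
  congr 1
  · simp
  · congr 2
    conv_lhs => rw [← (EuclideanSpace.basisFun (Fin n) ℝ).sum_repr (x - z)]
    rw [map_sum]
    refine Finset.sum_congr rfl fun i _ => ?_
    simp [mul_comm]
lemma hardy_pt {n : ℕ} {u : Euc n → ℝ} (hu : ContDiff ℝ 1 u) (hc : HasCompactSupport u)
    {z : Euc n} (hz : z ∉ tsupport u) :
    ∫⁻ x, ENNReal.ofReal (‖x - z‖ ^ (-(n : ℝ) - 1) * u x ^ 2) ≤
      4 * ∫⁻ x, ENNReal.ofReal (‖x - z‖ ^ (1 - (n : ℝ)) * ‖fderiv ℝ u x‖ ^ 2) := by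
  set s : ℝ := -((n : ℝ) + 1) / 2 with hs
  set h : Euc n → ℝ := fun x => ‖x - z‖ ^ s * u x with hh
  have hC : ContDiff ℝ 1 h := contDiff_rpow_mul hu hz s
  have hcs : HasCompactSupport h := cs_rpow_mul hc s
  have hcf : Continuous (fderiv ℝ u) := hu.continuous_fderiv one_ne_zero
  have hzf : z ∉ tsupport (fderiv ℝ u) := fun hh => hz (tsupport_fderiv_subset ℝ hh)
  have h0 := integral_div_zero hC hcs z
  have eq1 : ∀ x, ‖x - z‖ ^ (-(n : ℝ) - 1) * u x ^ 2 = h x ^ 2 := by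
    intro x
    simp only [hh, mul_pow]
    rw [← Real.rpow_natCast (‖x - z‖ ^ s) 2, ← Real.rpow_mul (norm_nonneg _)]
    congr 2; rw [hs]; push_cast; ring
  have cJ : Continuous fun x => ‖x - z‖ ^ (1 - (n : ℝ)) * ‖fderiv ℝ u x‖ ^ 2 := by
    have h2 : z ∉ tsupport (fun x => ‖fderiv ℝ u x‖ ^ 2) := fun hh => hzf (by
      refine closure_mono ?_ hh
      intro x hx
      simpa using hx)
    simpa using cont_rpow_mul (by fun_prop : Continuous fun x => ‖fderiv ℝ u x‖ ^ 2) h2 (1 - (n : ℝ))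
  have iJ : Integrable fun x => ‖x - z‖ ^ (1 - (n : ℝ)) * ‖fderiv ℝ u x‖ ^ 2 := by
    refine cJ.integrable_of_hasCompactSupport ?_
    have : HasCompactSupport fun x => ‖fderiv ℝ u x‖ ^ 2 := cs_sq (hc.fderiv ℝ).norm
    exact this.mul_left
  have iI : Integrable fun x => h x ^ 2 := by
    refine (hC.continuous.pow 2).integrable_of_hasCompactSupport (cs_sq hcs)
  have iD : Integrable fun x => ((n : ℝ) * h x ^ 2 + 2 * (h x * fderiv ℝ h x (x - z))) := by
    have := hC.continuous
    have := hC.continuous_fderiv one_ne_zero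
    refine Continuous.integrable_of_hasCompactSupport (by fun_prop) ?_
    refine HasCompactSupport.add ?_ (hcs.mul_right).mul_left
    exact HasCompactSupport.mul_left (cs_sq hcs)
  have pw : ∀ x, (1/2 : ℝ) * h x ^ 2 - 2 * (‖x - z‖ ^ (1 - (n : ℝ)) * ‖fderiv ℝ u x‖ ^ 2)
      + ((n : ℝ) * h x ^ 2 + 2 * (h x * fderiv ℝ h x (x - z))) ≤ 0 := by
    intro x
    by_cases hx : x = z
    · subst hx
      have h1 : u x = 0 := image_eq_zero_of_notMem_tsupport hz
      have h2 : fderiv ℝ u x = 0 := image_eq_zero_of_notMem_tsupport hzf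
      simp [hh, h1, h2]
    · have hpos : 0 < ‖x - z‖ := by simpa [sub_eq_zero] using hx
      have e : fderiv ℝ h x (x - z) = ‖x - z‖ ^ s * fderiv ℝ u x (x - z) + s * h x := by
        rw [(hasFDerivAt_rpow_mul hu hz s x).fderiv]
        simp only [add_apply, smul_apply, smul_eq_mul,
          innerSL_apply_apply, real_inner_self_eq_norm_sq, hh]
        have : ‖x - z‖ ^ s = ‖x - z‖ ^ (s - 2) * ‖x - z‖ ^ 2 := by
          rw [← Real.rpow_natCast, ← Real.rpow_add hpos]; congr 1; push_cast; ring
        rw [this]; ring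
      rw [e]
      have b1 : |fderiv ℝ u x (x - z)| ≤ ‖fderiv ℝ u x‖ * ‖x - z‖ := (fderiv ℝ u x).le_opNorm _
      set a := h x
      set b := ‖x - z‖ ^ s * fderiv ℝ u x (x - z)
      have b2 : b ^ 2 ≤ ‖x - z‖ ^ (1 - (n : ℝ)) * ‖fderiv ℝ u x‖ ^ 2 := by
        have e1 : ‖x - z‖ ^ (1 - (n : ℝ)) = (‖x - z‖ ^ s) ^ 2 * ‖x - z‖ ^ 2 := by
          rw [← Real.rpow_natCast, ← Real.rpow_mul (norm_nonneg _), ← Real.rpow_natCast,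
            ← Real.rpow_add hpos]
          congr 1; rw [hs]; push_cast; ring
        rw [e1]
        have : (fderiv ℝ u x (x - z)) ^ 2 ≤ (‖fderiv ℝ u x‖ * ‖x - z‖) ^ 2 := by
          rw [← sq_abs]; gcongr
        calc b ^ 2 = (‖x - z‖ ^ s) ^ 2 * (fderiv ℝ u x (x - z)) ^ 2 := by simp only [b]; ring
          _ ≤ (‖x - z‖ ^ s) ^ 2 * (‖fderiv ℝ u x‖ * ‖x - z‖) ^ 2 := by gcongr
          _ = _ := by ring
      have hs2 : 2 * s = -(n : ℝ) - 1 := by rw [hs]; ring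
      have : (n : ℝ) * a ^ 2 + 2 * (a * (b + s * a)) = - a ^ 2 + 2 * a * b := by
        linear_combination a ^ 2 * hs2
      rw [this]
      nlinarith [sq_nonneg (a - 2 * b)]
  have tot := integral_nonpos (μ := volume) (f := fun x => (1/2 : ℝ) * h x ^ 2 - 2 * (‖x - z‖ ^ (1 - (n : ℝ)) * ‖fderiv ℝ u x‖ ^ 2)
      + ((n : ℝ) * h x ^ 2 + 2 * (h x * fderiv ℝ h x (x - z)))) pw
  have i3 : Integrable (fun x => (1/2 : ℝ) * h x ^ 2 - 2 * (‖x - z‖ ^ (1 - (n : ℝ)) *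
      ‖fderiv ℝ u x‖ ^ 2)) := (iI.const_mul _).sub (iJ.const_mul _)
  rw [integral_add i3 iD, h0,
    integral_sub (iI.const_mul _) (iJ.const_mul _), integral_const_mul, integral_const_mul] at tot
  simp only [eq1]
  rw [← ofReal_integral_eq_lintegral_ofReal iI (ae_of_all _ fun x => sq_nonneg _),
    ← ofReal_integral_eq_lintegral_ofReal iJ (ae_of_all _ fun x => by positivity),
    show (4 : ℝ≥0∞) = ENNReal.ofReal 4 by norm_num, ← ENNReal.ofReal_mul (by norm_num)]
  exact ENNReal.ofReal_le_ofReal (by linarith)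
end
noncomputable section
lemma sq_l2 {α F : Type*} [MeasurableSpace α] [NormedAddCommGroup F] (f : α → F) (μ : Measure α) :
    eLpNorm f 2 μ ^ 2 = ∫⁻ x, ‖f x‖ₑ ^ 2 ∂μ := by
  have := eLpNorm_nnreal_pow_eq_lintegral (f := f) (μ := μ) (p := 2) (by norm_num)
  simpa using this
lemma cs_lint {α : Type*} [MeasurableSpace α] (μ : Measure α) {a b : α → ℝ≥0∞}
    (ha : AEMeasurable a μ) (hb : AEMeasurable b μ) :
    (∫⁻ x, a x * b x ∂μ) ^ 2 ≤ (∫⁻ x, a x ^ 2 ∂μ) * ∫⁻ x, b x ^ 2 ∂μ := by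
  have h := ENNReal.lintegral_mul_le_Lp_mul_Lq μ Real.HolderConjugate.two_two ha hb
  have h2 := pow_le_pow_left' h 2
  refine h2.trans (le_of_eq ?_)
  rw [mul_pow, ← ENNReal.rpow_natCast, ← ENNReal.rpow_mul, ← ENNReal.rpow_natCast, ← ENNReal.rpow_mul]
  norm_num
lemma holder_set {α : Type*} [MeasurableSpace α] (μ : Measure α) {G : α → ℝ≥0∞}
    (hG : AEMeasurable G μ) {t : ℝ} (ht : 0 < t) (ht1 : t < 1) (S : Set α) :
    ∫⁻ x in S, G x ^ t ∂μ ≤ (∫⁻ x, G x ∂μ) ^ t * μ S ^ (1 - t) := by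
  have hpq : (1 / t).HolderConjugate (1 / (1 - t)) := by
    rw [Real.holderConjugate_iff]
    refine ⟨by rw [lt_div_iff₀ ht]; linarith, by simp⟩
  have h := ENNReal.lintegral_mul_le_Lp_mul_Lq (μ.restrict S) hpq (f := fun x => G x ^ t)
    (g := fun _ => 1) (hG.restrict.pow_const t) aemeasurable_const
  simp only [Pi.mul_apply, mul_one, ENNReal.one_rpow, lintegral_one, Measure.restrict_apply_univ,
    one_div_one_div, ← ENNReal.rpow_mul] at h
  refine h.trans ?_
  simp only [mul_one_div_cancel ht.ne', ENNReal.rpow_one]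
  gcongr
  exact Measure.restrict_le_self
lemma add_sq_le_enn (a b : ℝ≥0∞) : (a + b) ^ 2 ≤ 2 * a ^ 2 + 2 * b ^ 2 := by
  by_cases ha : a = ⊤
  · simp [ha]
  by_cases hb : b = ⊤
  · simp [hb]
  lift a to ℝ≥0 using ha
  lift b to ℝ≥0 using hb
  have : (a + b) ^ 2 ≤ 2 * a ^ 2 + 2 * b ^ 2 := by
    rw [← NNReal.coe_le_coe]; push_cast
    nlinarith [sq_nonneg ((a : ℝ) - b)]
  exact_mod_cast this
def Jz {n : ℕ} (u : Euc n → ℝ) (z : Euc n) : ℝ≥0∞ :=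
  ∫⁻ x, ENNReal.ofReal (‖x - z‖ ^ (1 - (n : ℝ)) * ‖fderiv ℝ u x‖ ^ 2)
lemma enorm_sq_real (a : ℝ) : ‖a‖ₑ ^ 2 = ENNReal.ofReal (a ^ 2) := by
  rw [Real.enorm_eq_ofReal_abs, ← ENNReal.ofReal_pow (abs_nonneg _), sq_abs]
lemma f_grad {n : ℕ} {u : Euc n → ℝ} (hu : ContDiff ℝ 1 u) (hc : HasCompactSupport u)
    {z : Euc n} (hz : z ∉ tsupport u) :
    ∫⁻ x, ‖fderiv ℝ (fun x => ‖x - z‖ ^ ((1 - (n : ℝ)) / 2) * u x) x‖ₑ ^ 2 ≤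
      ENNReal.ofReal (2 + 2 * ((n : ℝ) - 1) ^ 2) * Jz u z := by
  have hH := hardy_pt hu hc hz
  set s : ℝ := (1 - (n : ℝ)) / 2 with hs
  have pw : ∀ x, ‖fderiv ℝ (fun x => ‖x - z‖ ^ s * u x) x‖ₑ ^ 2 ≤
      ENNReal.ofReal 2 * ENNReal.ofReal (‖x - z‖ ^ (1 - (n : ℝ)) * ‖fderiv ℝ u x‖ ^ 2) +
      ENNReal.ofReal (2 * s ^ 2) * ENNReal.ofReal (‖x - z‖ ^ (-(n : ℝ) - 1) * u x ^ 2) := by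
    intro x
    rw [← enorm_norm, enorm_sq_real, ← ENNReal.ofReal_mul (by norm_num), ← ENNReal.ofReal_mul (by positivity),
      ← ENNReal.ofReal_add (by positivity) (by positivity)]
    apply ENNReal.ofReal_le_ofReal
    have h1 := norm_fderiv_rpow_mul_le hu hz s x
    have e1 : ‖x - z‖ ^ (1 - (n : ℝ)) = (‖x - z‖ ^ s) ^ 2 := by
      rw [← Real.rpow_natCast, ← Real.rpow_mul (norm_nonneg _)]
      congr 1; rw [hs]; push_cast; ring
    have e2 : ‖x - z‖ ^ (-(n : ℝ) - 1) = (‖x - z‖ ^ (s - 1)) ^ 2 := by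
      rw [← Real.rpow_natCast, ← Real.rpow_mul (norm_nonneg _)]
      congr 1; rw [hs]; push_cast; ring
    rw [e1, e2]
    have h2 := pow_le_pow_left₀ (norm_nonneg _) h1 2
    have := sq_abs s
    have := sq_abs (u x)
    refine h2.trans ?_
    have := add_sq_le (a := ‖x - z‖ ^ s * ‖fderiv ℝ u x‖) (b := |s| * (‖x - z‖ ^ (s - 1) * |u x|))
    refine this.trans (le_of_eq ?_)
    rw [mul_pow, mul_pow, mul_pow, sq_abs, sq_abs]; ring
  refine (lintegral_mono pw).trans ?_
  have hcf : Continuous (fderiv ℝ u) := hu.continuous_fderiv one_ne_zero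
  have hcu := hu.continuous
  rw [lintegral_add_left (by fun_prop), lintegral_const_mul' _ _ ENNReal.ofReal_ne_top,
    lintegral_const_mul' _ _ ENNReal.ofReal_ne_top]
  refine (add_le_add_right (mul_le_mul_right hH _) _).trans (le_of_eq ?_)
  rw [← Jz, ← mul_assoc, ← add_mul, show (4 : ℝ≥0∞) = ENNReal.ofReal 4 by norm_num,
    ← ENNReal.ofReal_mul (by positivity), ← ENNReal.ofReal_add (by norm_num) (by positivity)]
  congr 2; rw [hs]; ring
lemma f_sq {n : ℕ} (u : Euc n → ℝ) (z x : Euc n) :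
    ENNReal.ofReal (‖x - z‖ ^ (1 - (n : ℝ)) * u x ^ 2) =
      ‖‖x - z‖ ^ ((1 - (n : ℝ)) / 2) * u x‖ₑ ^ 2 := by
  rw [enorm_sq_real, mul_pow, ← Real.rpow_natCast (‖x - z‖ ^ _), ← Real.rpow_mul (norm_nonneg _)]
  congr 3; push_cast; ring
lemma fk3 {n : ℕ} (hn : 3 ≤ n) : ∃ K : ℝ≥0, ∀ (u : Euc n → ℝ) (z : Euc n) (S : Set (Euc n)),
    ContDiff ℝ 1 u → HasCompactSupport u → z ∉ tsupport u →
    ∫⁻ x in S, ENNReal.ofReal (‖x - z‖ ^ (1 - (n : ℝ)) * u x ^ 2) ≤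
      K * volume S ^ (2 / (n : ℝ)) * Jz u z := by
  have hn0 : (0 : ℝ) < n := by positivity
  have hn3 : (3 : ℝ) ≤ n := by exact_mod_cast hn
  set c : ℝ≥0 := SNormLESNormFDerivOfEqConst ℝ (volume : Measure (Euc n)) 2
  refine ⟨c ^ 2 * (2 + 2 * ((n : ℝ) - 1) ^ 2).toNNReal, fun u z S hu hc hz => ?_⟩
  set s : ℝ := (1 - (n : ℝ)) / 2 with hs
  set f : Euc n → ℝ := fun x => ‖x - z‖ ^ s * u x with hf
  have hfC : ContDiff ℝ 1 f := contDiff_rpow_mul hu hz s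
  have hfc : HasCompactSupport f := cs_rpow_mul hc s
  set p : ℝ≥0 := (2 * n / (n - 2) : ℝ).toNNReal with hp
  have hpv : (p : ℝ) = 2 * n / (n - 2) := Real.coe_toNNReal _ (by
    apply div_nonneg <;> linarith)
  have hp0 : (p : ℝ) ≠ 0 := by
    rw [hpv]; apply div_ne_zero <;> linarith
  have hsob := eLpNorm_le_eLpNorm_fderiv_of_eq (volume : Measure (Euc n)) hfC hfc (p := 2) (p' := p)
    (by norm_num) (by simp; omega) (by
      rw [hpv]; simp only [finrank_euclideanSpace, Fintype.card_fin]
      have : (n : ℝ) - 2 ≠ 0 := by linarith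
      push_cast
      field_simp)
  have hf2 := f_grad hu hc hz
  have h1 : (∫⁻ x, ‖f x‖ₑ ^ (p : ℝ)) ^ (2 / (p : ℝ)) ≤
      (c : ℝ≥0∞) ^ 2 * ∫⁻ x, ‖fderiv ℝ f x‖ₑ ^ 2 := by
    have h2 := pow_le_pow_left' hsob 2
    rw [mul_pow, show ((2 : ℝ≥0) : ℝ≥0∞) = 2 by simp, sq_l2] at h2
    refine le_trans (le_of_eq ?_) h2
    rw [eLpNorm_nnreal_eq_lintegral (by exact_mod_cast hp0), ← ENNReal.rpow_natCast,
      ← ENNReal.rpow_mul]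
    congr 1; push_cast; ring
  have hh := holder_set volume (G := fun x => ‖f x‖ₑ ^ (p : ℝ)) (t := 2 / (p : ℝ))
    (by have := hfC.continuous; fun_prop) (by positivity)
    (by rw [hpv, div_lt_one (by apply div_pos <;> linarith), lt_div_iff₀ (by linarith)]; linarith) S
  have e : 1 - 2 / (p : ℝ) = 2 / n := by
    rw [hpv]; have : (n : ℝ) - 2 ≠ 0 := by linarith
    field_simp; ring
  rw [e] at hh
  calc _ = ∫⁻ x in S, (‖f x‖ₑ ^ (p : ℝ)) ^ (2 / (p : ℝ)) := by
        congr 1; funext x; rw [f_sq, ← ENNReal.rpow_mul, mul_div_cancel₀ _ hp0, ENNReal.rpow_two]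
    _ ≤ _ := hh
    _ ≤ ((c : ℝ≥0∞) ^ 2 * (ENNReal.ofReal (2 + 2 * ((n : ℝ) - 1) ^ 2) * Jz u z)) *
        volume S ^ (2 / (n : ℝ)) := by
      gcongr
      exact h1.trans (by gcongr)
    _ = _ := by
      push_cast; rw [ENNReal.ofReal]; ring
lemma xq_bound (k : ℕ) : ∃ K : ℝ≥0, ∀ (u : Euc 2 → ℝ) (z : Euc 2),
    ContDiff ℝ 1 u → HasCompactSupport u → z ∉ tsupport u →
    ∫⁻ x, ‖‖x - z‖ ^ (-1 : ℝ) * (‖x - z‖ ^ ((1 - (2 : ℕ) : ℝ) / 2) * u x) ^ (k + 1)‖ₑ ^ 2 ≤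
      K * Jz u z ^ (k + 1) := by
  set c : ℝ≥0 := eLpNormLESNormFDerivOneConst (volume : Measure (Euc 2)) 2
  have h1 : ∀ (u : Euc 2 → ℝ) (z : Euc 2), ContDiff ℝ 1 u → HasCompactSupport u → z ∉ tsupport u →
      ∫⁻ x, ‖‖x - z‖ ^ (-1 : ℝ) * (‖x - z‖ ^ ((1 - (2 : ℕ) : ℝ) / 2) * u x)‖ₑ ^ 2 ≤ 4 * Jz u z := by
    intro u z hu hc hz
    refine le_trans (lintegral_mono fun x => le_of_eq ?_) (hardy_pt hu hc hz)
    rw [enorm_sq_real]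
    by_cases hx : x = z
    · subst hx
      have h1 : u x = 0 := image_eq_zero_of_notMem_tsupport hz
      simp [h1]
    · have hpos : 0 < ‖x - z‖ := by simpa [sub_eq_zero] using hx
      congr 1
      rw [← mul_assoc, ← Real.rpow_add hpos, mul_pow, ← Real.rpow_natCast (‖x - z‖ ^ _),
        ← Real.rpow_mul (norm_nonneg _)]
      congr 2; push_cast; norm_num
  induction k with
  | zero => exact ⟨4, fun u z hu hc hz => by simpa using h1 u z hu hc hz⟩
  | succ k ih =>
    obtain ⟨K, hK⟩ := ih
    refine ⟨c ^ 2 * K * (2 * (k + 2) ^ 2 * 4 + 8), fun u z hu hc hz => ?_⟩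
    have hX := hK u z hu hc hz
    have hf2 := f_grad hu hc hz
    have h1' := h1 u z hu hc hz
    set s : ℝ := (1 - (2 : ℕ) : ℝ) / 2 with hs
    set f : Euc 2 → ℝ := fun x => ‖x - z‖ ^ s * u x with hf
    have hfC : ContDiff ℝ 1 f := contDiff_rpow_mul hu hz s
    have hfc : HasCompactSupport f := cs_rpow_mul hc s
    have hfz : z ∉ tsupport f := fun h => hz (tsupport_rpow_mul s h)
    have hpC : ContDiff ℝ 1 (fun x => f x ^ (k + 2)) := hfC.pow _
    have hpc : HasCompactSupport (fun x => f x ^ (k + 2)) :=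
      hfc.comp_left (g := fun t : ℝ => t ^ (k + 2)) (by simp)
    have hpz : z ∉ tsupport (fun x => f x ^ (k + 2)) := fun h => hfz (by
      refine closure_mono ?_ h
      intro x hx hx2
      apply hx
      simp only [hx2]; simp)
    have hsob := eLpNorm_le_eLpNorm_fderiv_one (volume : Measure (Euc 2))
      (contDiff_rpow_mul hpC hpz (-1)) (cs_rpow_mul hpc (-1)) (p := 2) (by
        simp only [finrank_euclideanSpace, Fintype.card_fin]
        have := NNReal.HolderConjugate.two_two
        exact_mod_cast this)
    have h2 := pow_le_pow_left' hsob 2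
    rw [mul_pow, show ((2 : ℝ≥0) : ℝ≥0∞) = 2 by simp, sq_l2, eLpNorm_one_eq_lintegral_enorm] at h2
    have pw : ∀ x, ‖fderiv ℝ (fun x => ‖x - z‖ ^ (-1 : ℝ) * f x ^ (k + 2)) x‖ₑ ≤
        ‖‖x - z‖ ^ (-1 : ℝ) * f x ^ (k + 1)‖ₑ * ((k + 2 : ℝ≥0) * ‖fderiv ℝ f x‖ₑ +
          ‖‖x - z‖ ^ (-1 : ℝ) * f x‖ₑ) := by
      intro x
      have := norm_fderiv_rpow_mul_le hpC hpz (-1) x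
      have e1 : fderiv ℝ (fun x => f x ^ (k + 2)) x = ((k + 2 : ℝ) * f x ^ (k + 1)) • fderiv ℝ f x := by
        have := ((hfC.differentiable one_ne_zero x).hasFDerivAt.pow (k + 2)).fderiv
        simpa [mul_comm] using this
      rw [e1] at this
      have e2 : ‖x - z‖ ^ (-1 - 1 : ℝ) * |f x ^ (k + 2)| =
          ‖x - z‖ ^ (-1 : ℝ) * |f x ^ (k + 1)| * (‖x - z‖ ^ (-1 : ℝ) * |f x|) := by
        by_cases hx : x = z
        · subst hx
          have : f x = 0 := image_eq_zero_of_notMem_tsupport hfz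
          simp [this]
        · have hpos : 0 < ‖x - z‖ := by simpa [sub_eq_zero] using hx
          rw [sub_eq_add_neg (-1 : ℝ), Real.rpow_add hpos, pow_succ (f x), abs_mul]; ring
      rw [e2, norm_smul] at this
      have h3 : ‖fderiv ℝ (fun x => ‖x - z‖ ^ (-1 : ℝ) * f x ^ (k + 2)) x‖ ≤
        ‖‖x - z‖ ^ (-1 : ℝ) * f x ^ (k + 1)‖ * ((k + 2 : ℝ) * ‖fderiv ℝ f x‖ +
          ‖‖x - z‖ ^ (-1 : ℝ) * f x‖) := by
        refine this.trans (le_of_eq ?_)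
        have hk : |((k : ℝ) + 2)| = k + 2 := abs_of_nonneg (by positivity)
        have hr : |‖x - z‖ ^ (-1 : ℝ)| = ‖x - z‖ ^ (-1 : ℝ) :=
          abs_of_nonneg (Real.rpow_nonneg (norm_nonneg _) _)
        simp only [norm_mul, Real.norm_eq_abs, hk, hr, abs_neg, abs_one]; ring
      have h4 := ENNReal.ofReal_le_ofReal h3
      rw [ENNReal.ofReal_mul (norm_nonneg _), ENNReal.ofReal_add (by positivity) (norm_nonneg _),
        ENNReal.ofReal_mul (by positivity)] at h4
      simp only [ofReal_norm] at h4
      refine h4.trans (le_of_eq ?_)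
      congr 3
      rw [ENNReal.ofReal, Real.toNNReal_of_nonneg (by positivity)]; rfl
    have c1 : Continuous fun x => ‖x - z‖ ^ (-1 : ℝ) * f x ^ (k + 1) := by
      have : z ∉ tsupport (fun x => f x ^ (k + 1)) := fun h => hfz (by
        refine closure_mono ?_ h
        intro x hx hx2
        apply hx
        simp only [hx2]; simp)
      exact cont_rpow_mul (hfC.continuous.pow _) this (-1)
    have c2 : Continuous fun x => ‖x - z‖ ^ (-1 : ℝ) * f x := cont_rpow_mul hfC.continuous hfz (-1)
    have c3 : Continuous (fderiv ℝ f) := hfC.continuous_fderiv one_ne_zero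
    have m1 := c1.measurable.enorm
    have m2 := c2.measurable.enorm
    have m3 := c3.measurable.enorm
    have h5 := (pow_le_pow_left' (lintegral_mono pw) 2).trans
      (cs_lint volume m1.aemeasurable ((m3.const_mul _).add m2).aemeasurable)
    have h6 : ∫⁻ x, ((k + 2 : ℝ≥0) * ‖fderiv ℝ f x‖ₑ + ‖‖x - z‖ ^ (-1 : ℝ) * f x‖ₑ) ^ 2 ≤
        (2 * (k + 2 : ℝ≥0) ^ 2 * 4 + 8 : ℝ≥0) * Jz u z := by
      refine (lintegral_mono fun x => add_sq_le_enn _ _).trans ?_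
      rw [lintegral_add_left (((m3.const_mul _).pow_const 2).const_mul _)]
      simp only [mul_pow, ← mul_assoc]
      rw [lintegral_const_mul' _ _ (by finiteness), lintegral_const_mul' _ _ (by finiteness)]
      have e4 : ENNReal.ofReal (2 + 2 * (((2 : ℕ) : ℝ) - 1) ^ 2) = 4 := by norm_num
      rw [e4] at hf2
      refine (add_le_add (mul_le_mul_right hf2 _) (mul_le_mul_right h1' _)).trans (le_of_eq ?_)
      push_cast; ring
    refine (h2.trans (mul_le_mul_right (h5.trans (mul_le_mul' hX h6)) _)).trans (le_of_eq ?_)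
    simp only [c]; push_cast; ring
lemma fk2 (q : ℕ) (hq : 2 ≤ q) : ∃ K : ℝ≥0, ∀ (u : Euc 2 → ℝ) (z : Euc 2) (S : Set (Euc 2)) (R : ℝ),
    ContDiff ℝ 1 u → HasCompactSupport u → z ∉ tsupport u → 0 < R → MeasurableSet S → S ⊆ ball z R →
    ∫⁻ x in S, ENNReal.ofReal (‖x - z‖ ^ (1 - (2 : ℕ) : ℝ) * u x ^ 2) ≤
      K * ENNReal.ofReal (R ^ (2 / (q : ℝ))) * volume S ^ (1 - 1 / (q : ℝ)) * Jz u z := by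
  obtain ⟨K, hK⟩ := xq_bound (q - 1)
  refine ⟨K ^ (1 / (q : ℝ)), fun u z S R hu hc hz hR hSm hS => ?_⟩
  have h1 := hK u z hu hc hz
  rw [Nat.sub_add_cancel (by omega)] at h1
  have hq0 : (0 : ℝ) < q := by positivity
  have hq1 : (1 : ℝ) < q := by exact_mod_cast hq
  have hfC := contDiff_rpow_mul hu hz ((1 - (2 : ℕ) : ℝ) / 2)
  have hme : Measurable fun x : Euc 2 => ‖x - z‖ ^ (-1 : ℝ) := by
    exact (measurable_id.sub_const z).norm.pow_const _
  have hh := holder_set volume (t := 1 / (q : ℝ)) (G := fun x : Euc 2 => ‖‖x - z‖ ^ (-1 : ℝ) *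
    (‖x - z‖ ^ ((1 - (2 : ℕ) : ℝ) / 2) * u x) ^ q‖ₑ ^ 2)
    ((hme.mul (hfC.continuous.measurable.pow_const q)).enorm.pow_const 2).aemeasurable (by positivity) (by rw [div_lt_one hq0]; exact hq1) S
  have pw : ∀ x ∈ S, ENNReal.ofReal (‖x - z‖ ^ (1 - (2 : ℕ) : ℝ) * u x ^ 2) ≤
      ENNReal.ofReal (R ^ (2 / (q : ℝ))) * (‖‖x - z‖ ^ (-1 : ℝ) *
    (‖x - z‖ ^ ((1 - (2 : ℕ) : ℝ) / 2) * u x) ^ q‖ₑ ^ 2) ^ (1 / (q : ℝ)) := by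
    intro x hx
    rw [f_sq]
    set a := ‖x - z‖ ^ ((1 - (2 : ℕ) : ℝ) / 2) * u x with ha
    by_cases hxz : x = z
    · subst hxz
      have h1 : u x = 0 := image_eq_zero_of_notMem_tsupport hz
      simp [ha, h1]
    have hpos : 0 < ‖x - z‖ := by simpa [sub_eq_zero] using hxz
    have hlt : ‖x - z‖ ≤ R := by have := hS hx; rw [mem_ball, dist_eq_norm] at this; exact this.le
    rw [enorm_sq_real, enorm_sq_real, ENNReal.ofReal_rpow_of_nonneg (by positivity) (by positivity),
      ← ENNReal.ofReal_mul (by positivity)]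
    apply ENNReal.ofReal_le_ofReal
    have e : ((‖x - z‖ ^ (-1 : ℝ) * a ^ q) ^ 2) ^ (1 / (q : ℝ)) = ‖x - z‖ ^ (-(2 / (q : ℝ))) * a ^ 2 := by
      rw [mul_pow, Real.mul_rpow (by positivity) (by positivity), ← Real.rpow_natCast (‖x - z‖ ^ _),
        ← Real.rpow_mul hpos.le, ← Real.rpow_mul hpos.le, ← pow_mul, mul_comm q 2, pow_mul,
        ← Real.rpow_natCast (a ^ 2) q, ← Real.rpow_mul (sq_nonneg a), mul_one_div_cancel hq0.ne',
        Real.rpow_one]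
      congr 2; push_cast; ring
    rw [e, ← mul_assoc, Real.rpow_neg hpos.le, ← div_eq_mul_inv]
    have : 1 ≤ R ^ (2 / (q : ℝ)) / ‖x - z‖ ^ (2 / (q : ℝ)) := by
      rw [one_le_div (by positivity)]; gcongr
    nlinarith [sq_nonneg a]
  have h2 := setLIntegral_mono_ae' hSm (μ := volume) (ae_of_all _ pw)
  rw [lintegral_const_mul' _ _ (by finiteness)] at h2
  calc _ ≤ _ := h2
    _ ≤ ENNReal.ofReal (R ^ (2 / (q : ℝ))) * ((K * Jz u z ^ q) ^ (1 / (q : ℝ)) * volume S ^ (1 - 1 / (q : ℝ))) := by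
      refine mul_le_mul_right (hh.trans ?_) _
      gcongr
    _ = _ := by
      rw [ENNReal.mul_rpow_of_nonneg _ _ (by positivity), ← ENNReal.rpow_natCast, ← ENNReal.rpow_mul,
        mul_one_div_cancel hq0.ne', ENNReal.rpow_one, ENNReal.coe_rpow_of_nonneg _ (by positivity)]
      ring
def Adm (n : ℕ) (θ : ℝ) : Prop :=
  (3 ≤ n ∧ θ = 2 / n) ∨ (n = 2 ∧ ∃ q : ℕ, 2 ≤ q ∧ θ = 1 - 1 / q)
lemma Adm.pos {n : ℕ} {θ : ℝ} (h : Adm n θ) : 0 < θ := by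
  rcases h with ⟨hn, rfl⟩ | ⟨rfl, q, hq, rfl⟩
  · positivity
  · have : (2 : ℝ) ≤ q := by exact_mod_cast hq
    rw [sub_pos, div_lt_one (by linarith)]; linarith
lemma Adm.lt {n : ℕ} {θ : ℝ} (h : Adm n θ) : θ < 1 := by
  rcases h with ⟨hn, rfl⟩ | ⟨rfl, q, hq, rfl⟩
  · have : (3 : ℝ) ≤ n := by exact_mod_cast hn
    rw [div_lt_one (by linarith)]; linarith
  · have : (2 : ℝ) ≤ q := by exact_mod_cast hq
    have : 0 < 1 / (q : ℝ) := by positivity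
    linarith
lemma Adm.le {n : ℕ} {θ : ℝ} (h : Adm n θ) : n * θ ≤ 2 := by
  rcases h with ⟨hn, rfl⟩ | ⟨rfl, q, hq, rfl⟩
  · have : (3 : ℝ) ≤ n := by exact_mod_cast hn
    rw [mul_div_cancel₀]; linarith
  · have : 0 ≤ 1 / (q : ℝ) := by positivity
    push_cast; linarith
lemma fk_pt {n : ℕ} {θ : ℝ} (h : Adm n θ) : ∃ K : ℝ≥0, ∀ (u : Euc n → ℝ) (z : Euc n)
    (S : Set (Euc n)) (R : ℝ), ContDiff ℝ 1 u → HasCompactSupport u → z ∉ tsupport u → 0 < R →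
    MeasurableSet S → S ⊆ ball z R →
    ∫⁻ x in S, ENNReal.ofReal (‖x - z‖ ^ (1 - (n : ℝ)) * u x ^ 2) ≤
      K * ENNReal.ofReal (R ^ (2 - n * θ)) * volume S ^ θ * Jz u z := by
  rcases h with ⟨hn, rfl⟩ | ⟨rfl, q, hq, rfl⟩
  · obtain ⟨K, hK⟩ := fk3 hn
    refine ⟨K, fun u z S R hu hc hz hR hSm hS => (hK u z S hu hc hz).trans (le_of_eq ?_)⟩
    have : (n : ℝ) ≠ 0 := by positivity
    rw [mul_div_cancel₀ _ this]; simp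
  · obtain ⟨K, hK⟩ := fk2 q hq
    refine ⟨K, fun u z S R hu hc hz hR hSm hS => (hK u z S R hu hc hz hR hSm hS).trans (le_of_eq ?_)⟩
    congr 5
    push_cast; ring
end
noncomputable section
structure Cx (n : ℕ) (d C₀ : ℝ) (Γ : Set (Euc n)) : Prop where
  hn : 2 ≤ n
  hd0 : 0 < d
  hdn : d < (n : ℝ) - 1
  hC₀ : 1 ≤ C₀
  ne : Γ.Nonempty
  cl : IsClosed Γ
  ar : AhlforsRegular n d C₀ Γ
namespace Cx
variable {n : ℕ} {d C₀ : ℝ} {Γ : Set (Euc n)}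
lemma dpos (h : Cx n d C₀ Γ) {x : Euc n} (hx : x ∉ Γ) : 0 < infDist x Γ :=
  (h.cl.notMem_iff_infDist_pos h.ne).1 hx
lemma dle (_ : Cx n d C₀ Γ) {x z : Euc n} (hz : z ∈ Γ) : infDist x Γ ≤ ‖x - z‖ := by
  rw [← dist_eq_norm]; exact infDist_le_dist_of_mem hz
lemma sig_ball (h : Cx n d C₀ Γ) (x : Euc n) {r : ℝ} (hr : 0 < r) :
    (μH[d].restrict Γ) (ball x r) ≤ ENNReal.ofReal (C₀ * (2 * r) ^ d) := by
  rw [Measure.restrict_apply measurableSet_ball, inter_comm]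
  rcases (Γ ∩ ball x r).eq_empty_or_nonempty with h0 | ⟨z, hz⟩
  · simp [h0]
  · refine le_trans (measure_mono ?_) (h.ar z hz.1 (2 * r) (by positivity)).2
    refine inter_subset_inter_right _ (ball_subset_ball' ?_)
    have := hz.2
    rw [mem_ball'] at this
    linarith
lemma locfin (h : Cx n d C₀ Γ) : IsLocallyFiniteMeasure ((μH[d] : Measure (Euc n)).restrict Γ) :=
  ⟨fun x => ⟨ball x 1, ball_mem_nhds x one_pos,
    (h.sig_ball x one_pos).trans_lt ENNReal.ofReal_lt_top⟩⟩
lemma ker_upper (h : Cx n d C₀ Γ) {x : Euc n} (hx : x ∉ Γ) :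
    ∫⁻ z, ENNReal.ofReal (‖x - z‖ ^ (1 - (n : ℝ))) ∂(μH[d].restrict Γ) ≤
      ENNReal.ofReal (C₀ * 4 ^ d * (1 - 2 ^ (d + 1 - n))⁻¹ * weightW n d Γ x) := by
  have hδ := h.dpos hx
  have hC := h.hC₀
  have hdn := h.hdn
  set δ := infDist x Γ with hδd
  have hr1 : (2 : ℝ) ^ (d + 1 - n) < 1 := Real.rpow_lt_one_of_one_lt_of_neg (by norm_num) (by linarith)
  have hr0 : (0 : ℝ) < 2 ^ (d + 1 - n) := by positivity
  have pw : ∀ᵐ z ∂((μH[d] : Measure (Euc n)).restrict Γ), ENNReal.ofReal (‖x - z‖ ^ (1 - (n : ℝ))) ≤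
      ∑' k : ℕ, (ball x (2 ^ (k + 1) * δ)).indicator
        (fun _ => ENNReal.ofReal ((2 ^ k * δ) ^ (1 - (n : ℝ)))) z := by
    refine (ae_restrict_iff' h.cl.measurableSet).2 (ae_of_all _ fun z hz => ?_)
    have h1 := h.dle (x := x) hz
    obtain ⟨k, hk1, hk2⟩ := exists_nat_pow_near (x := ‖x - z‖ / δ) (y := (2 : ℝ))
      (by rw [one_le_div hδ]; exact h1) (by norm_num)
    rw [le_div_iff₀ hδ] at hk1
    rw [div_lt_iff₀ hδ] at hk2
    refine le_trans ?_ (ENNReal.le_tsum k)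
    rw [indicator_of_mem (by rw [mem_ball', dist_eq_norm]; exact hk2)]
    apply ENNReal.ofReal_le_ofReal
    exact Real.rpow_le_rpow_of_nonpos (by positivity) hk1 (by linarith [h.hd0])
  refine (lintegral_mono_ae pw).trans ?_
  rw [lintegral_tsum (fun k => (measurable_const.indicator measurableSet_ball).aemeasurable)]
  have tm : ∀ k : ℕ, ∫⁻ z, (ball x (2 ^ (k + 1) * δ)).indicator
        (fun _ => ENNReal.ofReal ((2 ^ k * δ) ^ (1 - (n : ℝ)))) z ∂(μH[d].restrict Γ) ≤
      ENNReal.ofReal (C₀ * 4 ^ d * weightW n d Γ x) * ENNReal.ofReal (2 ^ (d + 1 - n)) ^ k := by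
    intro k
    rw [lintegral_indicator_const measurableSet_ball]
    refine (mul_le_mul_right (h.sig_ball x (by positivity)) _).trans (le_of_eq ?_)
    rw [← ENNReal.ofReal_pow hr0.le, ← ENNReal.ofReal_mul (by positivity),
      ← ENNReal.ofReal_mul (by unfold weightW; positivity)]
    congr 1
    have e1 : (2 * (2 ^ (k + 1) * δ)) = 4 * (2 ^ k * δ) := by ring
    have e2 : ((2 : ℝ) ^ (d + 1 - n)) ^ k = (2 ^ k) ^ (d + 1 - n) := by
      rw [← Real.rpow_natCast, ← Real.rpow_mul (by norm_num), mul_comm, Real.rpow_mul (by norm_num),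
        Real.rpow_natCast]
    have e3 : (2 ^ k * δ) ^ (1 - (n : ℝ)) * (2 ^ k * δ) ^ d = (2 ^ k * δ) ^ (d + 1 - n) := by
      rw [← Real.rpow_add (by positivity)]; congr 1; ring
    rw [Real.mul_rpow (x := 2 ^ k) (z := d + 1 - n) (by positivity) hδ.le] at e3
    rw [e1, Real.mul_rpow (x := 4) (by norm_num) (by positivity), e2, weightW, ← hδd]
    linear_combination C₀ * 4 ^ d * e3
  refine (ENNReal.tsum_le_tsum tm).trans ?_
  rw [ENNReal.tsum_mul_left, ENNReal.tsum_geometric, ← ENNReal.ofReal_one,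
    ← ENNReal.ofReal_sub _ hr0.le, ← ENNReal.ofReal_inv_of_pos (by linarith),
    ← ENNReal.ofReal_mul (by unfold weightW; positivity)]
  apply le_of_eq; congr 1; ring
lemma ker_lower (h : Cx n d C₀ Γ) {x : Euc n} (hx : x ∉ Γ) {p : ℝ} (hp : p ≤ 0) :
    ENNReal.ofReal (C₀⁻¹ * 2 ^ p * infDist x Γ ^ (p + d)) ≤
    ∫⁻ z in ball x (2 * infDist x Γ), ENNReal.ofReal (‖x - z‖ ^ p) ∂(μH[d].restrict Γ) := by
  have hδ := h.dpos hx
  have hC := h.hC₀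
  set δ := infDist x Γ with hδd
  obtain ⟨z₀, hz₀, hd⟩ := h.cl.exists_infDist_eq_dist h.ne x
  have hsub : ball z₀ δ ⊆ ball x (2 * δ) := ball_subset_ball' (by rw [dist_comm, ← hd]; linarith)
  have hlow := (h.ar z₀ hz₀ δ hδ).1
  calc _ = ENNReal.ofReal ((2 * δ) ^ p) * ENNReal.ofReal (C₀⁻¹ * δ ^ d) := by
        rw [← ENNReal.ofReal_mul (by positivity)]; congr 1
        rw [Real.mul_rpow (by norm_num) hδ.le, Real.rpow_add hδ]; ring
    _ ≤ ENNReal.ofReal ((2 * δ) ^ p) * (μH[d].restrict Γ) (ball x (2 * δ)) := by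
        refine mul_le_mul_right (hlow.trans ?_) _
        rw [Measure.restrict_apply measurableSet_ball, inter_comm]
        exact measure_mono (inter_subset_inter_left _ hsub)
    _ = ∫⁻ z in ball x (2 * δ), ENNReal.ofReal ((2 * δ) ^ p) ∂(μH[d].restrict Γ) := by simp
    _ ≤ _ := by
        rw [Measure.restrict_restrict measurableSet_ball]
        refine setLIntegral_mono_ae' (measurableSet_ball.inter h.cl.measurableSet) (ae_of_all _ fun z hz => ?_)
        apply ENNReal.ofReal_le_ofReal
        have h1 := h.dle (x := x) hz.2
        have h2 := hz.1
        rw [mem_ball', dist_eq_norm] at h2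
        exact Real.rpow_le_rpow_of_nonpos (by linarith) h2.le hp
lemma meas_w : Measurable (weightW n d Γ) := (measurable_infDist).pow_const _
lemma lint_m (f : Euc n → ℝ≥0∞) :
    ∫⁻ x, f x ∂(measW n d Γ) = ∫⁻ x, ENNReal.ofReal (weightW n d Γ x) * f x := by
  rw [measW, lintegral_withDensity_eq_lintegral_mul_non_measurable _ meas_w.ennreal_ofReal
    (ae_of_all _ fun x => ENNReal.ofReal_lt_top)]
  rfl
lemma avg_J (h : Cx n d C₀ Γ) {u : Euc n → ℝ} (hu : ContDiff ℝ 1 u) (hs : tsupport u ⊆ Γᶜ) :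
    ∫⁻ z, Jz u z ∂(μH[d].restrict Γ) ≤ ENNReal.ofReal (C₀ * 4 ^ d * (1 - 2 ^ (d + 1 - n))⁻¹) *
      ∫⁻ x, ‖fderiv ℝ u x‖ₑ ^ 2 ∂(measW n d Γ) := by
  have := h.locfin
  have hcf := (hu.continuous_fderiv one_ne_zero).measurable
  have hC := h.hC₀
  have hr1 : (2 : ℝ) ^ (d + 1 - n) < 1 :=
    Real.rpow_lt_one_of_one_lt_of_neg (by norm_num) (by linarith [h.hdn])
  unfold Jz
  rw [lintegral_lintegral_swap, lint_m, ← lintegral_const_mul' _ _ ENNReal.ofReal_ne_top]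
  · refine lintegral_mono fun x => ?_
    by_cases hx : x ∈ Γ
    · have : fderiv ℝ u x = 0 := image_eq_zero_of_notMem_tsupport
        fun hh => hs (tsupport_fderiv_subset ℝ hh) hx
      simp [this]
    · have e : ∀ z, ENNReal.ofReal (‖x - z‖ ^ (1 - (n : ℝ)) * ‖fderiv ℝ u x‖ ^ 2) =
          ENNReal.ofReal (‖x - z‖ ^ (1 - (n : ℝ))) * ‖fderiv ℝ u x‖ₑ ^ 2 := by
        intro z
        rw [ENNReal.ofReal_mul (by positivity), ENNReal.ofReal_pow (norm_nonneg _), ofReal_norm]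
      simp only [e]
      rw [lintegral_mul_const' _ _ (by finiteness)]
      refine (mul_le_mul_left (h.ker_upper hx) _).trans (le_of_eq ?_)
      rw [ENNReal.ofReal_mul (by have : 0 < 1 - (2 : ℝ) ^ (d + 1 - n) := by linarith
                                 positivity)]
      ring
  · exact ((((measurable_snd.sub measurable_fst).norm.pow_const _).mul
      ((hcf.comp measurable_snd).norm.pow_const 2)).ennreal_ofReal).aemeasurable
lemma avg_low (h : Cx n d C₀ Γ) {u : Euc n → ℝ} (hu : ContDiff ℝ 1 u) (hs : tsupport u ⊆ Γᶜ)
    {p : ℝ} (hp : p ≤ 0) {S : Set (Euc n)} (hS : MeasurableSet S) {Z : Set (Euc n)}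
    (hZ : ∀ x ∈ S, ball x (2 * infDist x Γ) ⊆ Z) :
    ∫⁻ x in S, ENNReal.ofReal (C₀⁻¹ * 2 ^ p * infDist x Γ ^ (p + d)) * ‖u x‖ₑ ^ 2 ≤
    ∫⁻ z in Z, (∫⁻ x in S, ENNReal.ofReal (‖x - z‖ ^ p * u x ^ 2)) ∂(μH[d].restrict Γ) := by
  have := h.locfin
  have hcf := hu.continuous.measurable
  rw [lintegral_lintegral_swap]
  · refine setLIntegral_mono_ae' hS (ae_of_all _ fun x hxS => ?_)
    by_cases hx : x ∈ Γ
    · have : u x = 0 := image_eq_zero_of_notMem_tsupport fun hh => hs hh hx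
      simp [this]
    · have e : ∀ z, ENNReal.ofReal (‖x - z‖ ^ p * u x ^ 2) =
          ENNReal.ofReal (‖x - z‖ ^ p) * ‖u x‖ₑ ^ 2 := by
        intro z
        rw [ENNReal.ofReal_mul (by positivity), enorm_sq_real]
      simp only [e]
      rw [lintegral_mul_const' _ _ (by finiteness)]
      exact mul_le_mul_left ((h.ker_lower hx hp).trans (lintegral_mono_set (hZ x hxS))) _
  · exact ((((measurable_snd.sub measurable_fst).norm.pow_const _).mul
      ((hcf.comp measurable_snd).pow_const 2)).ennreal_ofReal).aemeasurable
end Cx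
lemma hardy_m (n : ℕ) (d C₀ : ℝ) : ∃ C : ℝ≥0, ∀ Γ, Cx n d C₀ Γ → ∀ u : Euc n → ℝ,
    ContDiff ℝ 1 u → HasCompactSupport u → tsupport u ⊆ Γᶜ →
    ∫⁻ x, ‖u x / infDist x Γ‖ₑ ^ 2 ∂(measW n d Γ) ≤
      C * ∫⁻ x, ‖fderiv ℝ u x‖ₑ ^ 2 ∂(measW n d Γ) := by
  refine ⟨(C₀ * 2 ^ (n + 1 : ℝ)).toNNReal * 4 * (C₀ * 4 ^ d * (1 - 2 ^ (d + 1 - n))⁻¹).toNNReal,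
    fun Γ h u hu hc hs => ?_⟩
  have hC := h.hC₀
  have h1 := h.avg_low hu hs (p := -(n : ℝ) - 1) (by have := h.hn; linarith) MeasurableSet.univ
    (Z := univ) (by simp)
  have h2 := h.avg_J hu hs
  simp only [Measure.restrict_univ] at h1
  have h3 : ∫⁻ z, (∫⁻ x, ENNReal.ofReal (‖x - z‖ ^ (-(n : ℝ) - 1) * u x ^ 2)) ∂(μH[d].restrict Γ) ≤
      4 * ∫⁻ z, Jz u z ∂(μH[d].restrict Γ) := by
    rw [← lintegral_const_mul' _ _ (by finiteness)]
    exact lintegral_mono_ae ((ae_restrict_iff' h.cl.measurableSet).2 (ae_of_all _ fun z hz =>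
      hardy_pt hu hc fun hh => hs hh hz))
  have h4 : ∫⁻ x, ‖u x / infDist x Γ‖ₑ ^ 2 ∂(measW n d Γ) ≤
      ENNReal.ofReal (C₀ * 2 ^ (n + 1 : ℝ)) *
      ∫⁻ x, ENNReal.ofReal (C₀⁻¹ * 2 ^ (-(n : ℝ) - 1) * infDist x Γ ^ (-(n : ℝ) - 1 + d)) * ‖u x‖ₑ ^ 2 := by
    rw [Cx.lint_m, ← lintegral_const_mul' _ _ (by finiteness)]
    refine lintegral_mono fun x => ?_
    by_cases hx : x ∈ Γ
    · have : u x = 0 := image_eq_zero_of_notMem_tsupport fun hh => hs hh hx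
      simp [this]
    · have hδ := h.dpos hx
      rw [enorm_sq_real, enorm_sq_real, ← ENNReal.ofReal_mul (by unfold weightW; positivity),
        ← ENNReal.ofReal_mul (by positivity), ← ENNReal.ofReal_mul (by positivity)]
      apply le_of_eq; congr 1
      have e1 : (2 : ℝ) ^ (n + 1 : ℝ) * 2 ^ (-(n : ℝ) - 1) = 1 := by
        rw [← Real.rpow_add (by norm_num)]; simp
      have e2 : C₀ * C₀⁻¹ = 1 := mul_inv_cancel₀ (by positivity)
      have e3 : infDist x Γ ^ (-(n : ℝ) - 1 + d) = infDist x Γ ^ (d + 1 - (n : ℝ)) / infDist x Γ ^ 2 := by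
        rw [← Real.rpow_natCast, ← Real.rpow_sub hδ]; congr 1; push_cast; ring
      rw [e3, weightW, div_pow]
      linear_combination (-(infDist x Γ ^ (d + 1 - (n : ℝ)) * (u x ^ 2 / infDist x Γ ^ 2))) *
        (e1 + ((2 : ℝ) ^ (n + 1 : ℝ) * 2 ^ (-(n : ℝ) - 1)) * e2)
  refine (h4.trans (mul_le_mul_right (h1.trans (h3.trans (mul_le_mul_right h2 _))) _)).trans
    (le_of_eq ?_)
  push_cast
  simp only [ENNReal.ofReal]
  ring
lemma fk_m {n : ℕ} (d C₀ : ℝ) {θ : ℝ} (hθ : Adm n θ) : ∃ K : ℝ≥0, ∀ Γ, Cx n d C₀ Γ → ∀ u : Euc n → ℝ,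
    ContDiff ℝ 1 u → HasCompactSupport u → tsupport u ⊆ Γᶜ → ∀ (y : Euc n) (R : ℝ), 0 < R →
    ∀ S, MeasurableSet S → S ⊆ ball y R →
    ∫⁻ x in S, ‖u x‖ₑ ^ 2 ∂(measW n d Γ) ≤
      K * ENNReal.ofReal ((R + infDist y Γ) ^ (2 - n * θ)) * volume S ^ θ *
        ∫⁻ x, ‖fderiv ℝ u x‖ₑ ^ 2 ∂(measW n d Γ) := by
  obtain ⟨K, hK⟩ := fk_pt hθ
  have hle := hθ.le
  refine ⟨(C₀ * 2 ^ (n - 1 : ℝ)).toNNReal * (K * ((4 : ℝ) ^ (2 - n * θ : ℝ)).toNNReal *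
    (C₀ * 4 ^ d * (1 - 2 ^ (d + 1 - n))⁻¹).toNNReal), fun Γ h u hu hc hs y R hR S hS hSR => ?_⟩
  have hC := h.hC₀
  have hδy : 0 ≤ infDist y Γ := infDist_nonneg
  set Z := ball y (R + 2 * (R + infDist y Γ))
  have h1 := h.avg_low hu hs (p := 1 - (n : ℝ)) (by linarith [h.hd0, h.hdn]) hS
    (Z := Z) (by
      intro x hx
      have h1 := hSR hx
      rw [mem_ball] at h1
      have h2 := infDist_le_infDist_add_dist (s := Γ) (x := x) (y := y)
      exact ball_subset_ball' (by linarith))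
  have h2 := h.avg_J hu hs
  have h3 : ∫⁻ z in Z, (∫⁻ x in S, ENNReal.ofReal (‖x - z‖ ^ (1 - (n : ℝ)) * u x ^ 2)) ∂(μH[d].restrict Γ) ≤
      (K * ENNReal.ofReal ((4 * (R + infDist y Γ)) ^ (2 - n * θ)) * volume S ^ θ) *
        ∫⁻ z, Jz u z ∂(μH[d].restrict Γ) := by
    have hfin : volume S ≠ ⊤ := ((measure_mono hSR).trans_lt measure_ball_lt_top).ne
    have := ENNReal.rpow_ne_top_of_nonneg hθ.pos.le hfin
    rw [← lintegral_const_mul' _ _ (by finiteness)]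
    refine le_trans ?_ (lintegral_mono' (Measure.restrict_le_self (s := Z)) le_rfl)
    rw [Measure.restrict_restrict measurableSet_ball]
    refine setLIntegral_mono_ae' (measurableSet_ball.inter h.cl.measurableSet) (ae_of_all _ fun z hz => ?_)
    refine hK u z S _ hu hc (fun hh => hs hh hz.2) (by positivity) hS (hSR.trans (ball_subset_ball' ?_))
    have := hz.1
    rw [mem_ball'] at this
    linarith
  have h4 : ∫⁻ x in S, ‖u x‖ₑ ^ 2 ∂(measW n d Γ) ≤
      ENNReal.ofReal (C₀ * 2 ^ (n - 1 : ℝ)) *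
      ∫⁻ x in S, ENNReal.ofReal (C₀⁻¹ * 2 ^ (1 - (n : ℝ)) * infDist x Γ ^ (1 - (n : ℝ) + d)) * ‖u x‖ₑ ^ 2 := by
    rw [← lintegral_indicator hS, ← lintegral_indicator hS,
      Cx.lint_m, ← lintegral_const_mul' _ _ (by finiteness)]
    refine lintegral_mono fun x => ?_
    by_cases hxS : x ∈ S
    · simp only [indicator_of_mem hxS]
      rw [enorm_sq_real, ← ENNReal.ofReal_mul (by unfold weightW; positivity [infDist_nonneg (x := x) (s := Γ)]),
        ← ENNReal.ofReal_mul (by positivity [infDist_nonneg (x := x) (s := Γ)]), ← ENNReal.ofReal_mul (by positivity)]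
      apply le_of_eq; congr 1
      have e1 : (2 : ℝ) ^ (n - 1 : ℝ) * 2 ^ (1 - (n : ℝ)) = 1 := by
        rw [← Real.rpow_add (by norm_num)]; simp
      have e2 : C₀ * C₀⁻¹ = 1 := mul_inv_cancel₀ (by positivity)
      rw [show 1 - (n : ℝ) + d = d + 1 - n by ring, weightW]
      linear_combination (-(infDist x Γ ^ (d + 1 - (n : ℝ)) * (u x ^ 2))) *
        (e1 + ((2 : ℝ) ^ (n - 1 : ℝ) * 2 ^ (1 - (n : ℝ))) * e2)
    · simp [hxS]
  refine (h4.trans (mul_le_mul_right (h1.trans (h3.trans (mul_le_mul_right h2 _))) _)).trans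
    (le_of_eq ?_)
  rw [Real.mul_rpow (by norm_num) (by positivity), ENNReal.ofReal_mul (p := (4 : ℝ) ^ _) (by positivity)]
  push_cast
  simp only [ENNReal.ofReal]
  ring
end
noncomputable section
structure IsTest {n : ℕ} (Γ : Set (Euc n)) (φ : Euc n → ℝ) : Prop where
  cd : ContDiff ℝ 1 φ
  cs : HasCompactSupport φ
  sup : tsupport φ ⊆ Γᶜ
lemma norm_grad {n : ℕ} (φ : Euc n → ℝ) (x : Euc n) : ‖gradient φ x‖ = ‖fderiv ℝ φ x‖ := by
  rw [gradient, LinearIsometryEquiv.norm_map]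
lemma enorm_grad {n : ℕ} (φ : Euc n → ℝ) (x : Euc n) : ‖gradient φ x‖ₑ = ‖fderiv ℝ φ x‖ₑ := by
  rw [← ofReal_norm, norm_grad, ofReal_norm]
lemma grad_cont {n : ℕ} {φ : Euc n → ℝ} (h : ContDiff ℝ 1 φ) : Continuous (gradient φ) :=
  (LinearIsometryEquiv.continuous _).comp (h.continuous_fderiv one_ne_zero)
lemma grad_tsupport {n : ℕ} (φ : Euc n → ℝ) : tsupport (gradient φ) ⊆ tsupport φ := by
  refine subset_trans (closure_mono ?_) (tsupport_fderiv_subset ℝ (f := φ))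
  intro x hx hx2
  exact hx (by rw [← norm_eq_zero, norm_grad, hx2, norm_zero])
lemma grad_mul {n : ℕ} {f g : Euc n → ℝ} {x : Euc n} (hf : DifferentiableAt ℝ f x)
    (hg : DifferentiableAt ℝ g x) :
    gradient (fun x => f x * g x) x = f x • gradient g x + g x • gradient f x := by
  simp only [gradient, fderiv_fun_mul hf hg, map_add, map_smul]
lemma grad_comp {n : ℕ} {f : Euc n → ℝ} {G : ℝ → ℝ} {G' : ℝ} {x : Euc n}
    (hf : DifferentiableAt ℝ f x) (hG : HasDerivAt G G' (f x)) :
    gradient (fun x => G (f x)) x = G' • gradient f x := by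
  have := (hG.comp_hasFDerivAt x hf.hasFDerivAt).fderiv
  simp only [gradient]
  rw [show (fun x => G (f x)) = G ∘ f from rfl, this, map_smul]
section
variable {n : ℕ} {d C₀ : ℝ} {Γ : Set (Euc n)}
lemma Cx.wpos (h : Cx n d C₀ Γ) {x : Euc n} (hx : x ∉ Γ) : 0 < weightW n d Γ x :=
  Real.rpow_pos_of_pos (h.dpos hx) _
lemma m_ac : measW n d Γ ≪ volume := withDensity_absolutelyContinuous _ _
lemma Cx.m_notMem (h : Cx n d C₀ Γ) : ∀ᵐ x ∂(measW n d Γ), x ∉ Γ := by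
  rw [ae_iff, measW, withDensity_apply _ (by simpa using h.cl.measurableSet)]
  simp only [not_not, ofPred_mem_eq]
  rw [setLIntegral_congr_fun (g := fun _ => 0) h.cl.measurableSet]
  · simp
  · intro x hx
    simp only [weightW, infDist_zero_of_mem hx, ENNReal.ofReal_eq_zero]
    rw [Real.zero_rpow (by linarith [h.hdn])]
lemma Cx.ac_m (h : Cx n d C₀ Γ) {p : Euc n → Prop} (hp : ∀ᵐ x ∂(measW n d Γ), p x) :
    ∀ᵐ x, x ∉ Γ → p x := by
  rw [measW, ae_withDensity_iff Cx.meas_w.ennreal_ofReal] at hp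
  filter_upwards [hp] with x hx hxΓ
  exact hx (by simpa using h.wpos hxΓ)
lemma Cx.int_m (f : Euc n → ℝ) : ∫ x, f x ∂(measW n d Γ) = ∫ x, weightW n d Γ x * f x := by
  rw [measW, integral_withDensity_eq_integral_toReal_smul Cx.meas_w.ennreal_ofReal
    (ae_of_all _ fun x => ENNReal.ofReal_lt_top)]
  congr 1; funext x
  rw [ENNReal.toReal_ofReal (show 0 ≤ weightW n d Γ x from Real.rpow_nonneg infDist_nonneg _), smul_eq_mul]
lemma Cx.m_compact (h : Cx n d C₀ Γ) {K : Set (Euc n)} (hK : IsCompact K) (hs : K ⊆ Γᶜ) :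
    measW n d Γ K < ⊤ := by
  have hc : ContinuousOn (weightW n d Γ) K := fun x hx =>
    ((continuous_infDist_pt Γ).continuousAt.rpow_const (Or.inl (h.dpos (hs hx)).ne')).continuousWithinAt
  obtain ⟨C, hC⟩ := (hK.bddAbove_image hc)
  rw [measW, withDensity_apply _ hK.measurableSet]
  calc _ ≤ ∫⁻ x in K, ENNReal.ofReal C := by
        refine setLIntegral_mono_ae' hK.measurableSet (ae_of_all _ fun x hx => ?_)
        exact ENNReal.ofReal_le_ofReal (hC (mem_image_of_mem _ hx))
    _ = ENNReal.ofReal C * volume K := by simp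
    _ < ⊤ := ENNReal.mul_lt_top (by finiteness) hK.measure_lt_top
lemma Cx.memLp_cc (h : Cx n d C₀ Γ) {F : Type*} [NormedAddCommGroup F] {f : Euc n → F}
    (hf : Continuous f) (hc : HasCompactSupport f) (hs : tsupport f ⊆ Γᶜ) :
    MemLp f 2 (measW n d Γ) := by
  have hfm : AEStronglyMeasurable f (measW n d Γ) :=
    (hf.stronglyMeasurable_of_hasCompactSupport hc).aestronglyMeasurable
  obtain ⟨C, hC⟩ := hf.bounded_above_of_compact_support hc
  have e : (tsupport f).indicator f = f := indicator_eq_self.2 (subset_tsupport f)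
  rw [← e, memLp_indicator_iff_restrict (isClosed_tsupport f).measurableSet]
  have : IsFiniteMeasure ((measW n d Γ).restrict (tsupport f)) :=
    ⟨by simpa using h.m_compact hc hs⟩
  exact MemLp.of_bound hfm.restrict C (ae_of_all _ hC)
lemma memLp_of_lint {F : Type*} [NormedAddCommGroup F] {μ : Measure (Euc n)} {f : Euc n → F}
    (hm : AEStronglyMeasurable f μ) (hf : ∫⁻ x, ‖f x‖ₑ ^ 2 ∂μ < ⊤) : MemLp f 2 μ := by
  refine ⟨hm, ?_⟩
  rw [← sq_l2] at hf
  by_contra hh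
  rw [not_lt_top_iff] at hh
  simp [hh] at hf
lemma MemLp.lint {F : Type*} [NormedAddCommGroup F] {μ : Measure (Euc n)} {f : Euc n → F}
    (hf : MemLp f 2 μ) : ∫⁻ x, ‖f x‖ₑ ^ 2 ∂μ < ⊤ := by
  rw [← sq_l2]; exact ENNReal.pow_lt_top hf.2
lemma IsTest.grad (h : Cx n d C₀ Γ) {φ : Euc n → ℝ} (hφ : IsTest Γ φ) :
    MemLp (gradient φ) 2 (measW n d Γ) := by
  refine h.memLp_cc (grad_cont hφ.cd) ?_ ((grad_tsupport φ).trans hφ.sup)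
  exact hφ.cs.mono' ((subset_tsupport _).trans (grad_tsupport φ))
lemma meas_div {u : Euc n → ℝ} {μ : Measure (Euc n)} (hu : AEStronglyMeasurable u μ) :
    AEStronglyMeasurable (fun x => u x / infDist x Γ) μ := by
  refine (AEMeasurable.div hu.aemeasurable ?_).aestronglyMeasurable
  exact measurable_infDist.aemeasurable
lemma IsTest.div (h : Cx n d C₀ Γ) {φ : Euc n → ℝ} (hφ : IsTest Γ φ) :
    MemLp (fun x => φ x / infDist x Γ) 2 (measW n d Γ) := by
  obtain ⟨C, hC⟩ := hardy_m n d C₀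
  refine memLp_of_lint (meas_div hφ.cd.continuous.aestronglyMeasurable) ?_
  refine (hC Γ h φ hφ.cd hφ.cs hφ.sup).trans_lt (ENNReal.mul_lt_top (by finiteness) ?_)
  simpa only [enorm_grad] using MemLp.lint (hφ.grad h)
end
def InH (n : ℕ) (d : ℝ) (Γ : Set (Euc n)) (u : Euc n → ℝ) (v : Euc n → Euc n) : Prop :=
  MemLp (fun x => u x / infDist x Γ) 2 (measW n d Γ) ∧ MemLp v 2 (measW n d Γ) ∧
  ∀ ε : ℝ≥0∞, 0 < ε → ∃ φ, IsTest Γ φ ∧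
    eLpNorm (fun x => (φ x - u x) / infDist x Γ) 2 (measW n d Γ) ≤ ε ∧
    eLpNorm (fun x => gradient φ x - v x) 2 (measW n d Γ) ≤ ε
namespace InH
variable {n : ℕ} {d C₀ : ℝ} {Γ : Set (Euc n)} {u : Euc n → ℝ} {v : Euc n → Euc n}
lemma of_test (h : Cx n d C₀ Γ) {φ : Euc n → ℝ} (hφ : IsTest Γ φ) : InH n d Γ φ (gradient φ) :=
  ⟨hφ.div h, hφ.grad h, fun ε _ => ⟨φ, hφ, by simp, by simp⟩⟩
lemma meas (h : Cx n d C₀ Γ) (hu : InH n d Γ u v) : AEStronglyMeasurable u (measW n d Γ) := by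
  have : AEStronglyMeasurable (fun x => infDist x Γ * (u x / infDist x Γ)) (measW n d Γ) :=
    (continuous_infDist_pt Γ).aestronglyMeasurable.mul hu.1.1
  refine this.congr ?_
  filter_upwards [h.m_notMem] with x hx
  have := (h.dpos hx).ne'
  field_simp
lemma lim (hu : MemLp (fun x => u x / infDist x Γ) 2 (measW n d Γ)) (hv : MemLp v 2 (measW n d Γ))
    (hl : ∀ ε : ℝ≥0∞, 0 < ε → ∃ u' v', InH n d Γ u' v' ∧
      eLpNorm (fun x => (u' x - u x) / infDist x Γ) 2 (measW n d Γ) ≤ ε ∧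
      eLpNorm (fun x => v' x - v x) 2 (measW n d Γ) ≤ ε) : InH n d Γ u v := by
  refine ⟨hu, hv, fun ε hε => ?_⟩
  have hε2 := ENNReal.half_pos hε.ne'
  obtain ⟨u', v', hi, h1, h2⟩ := hl (ε / 2) hε2
  obtain ⟨φ, hφ, h3, h4⟩ := hi.2.2 (ε / 2) hε2
  have hφm := hφ.cd.continuous.aestronglyMeasurable (μ := measW n d Γ)
  refine ⟨φ, hφ, ?_, ?_⟩
  · have e : (fun x => (φ x - u x) / infDist x Γ) = (fun x => (φ x - u' x) / infDist x Γ) +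
        fun x => (u' x - u x) / infDist x Γ := by
      funext x; simp only [Pi.add_apply]; ring
    rw [e, ← ENNReal.add_halves ε]
    refine (eLpNorm_add_le ?_ ?_ (by norm_num)).trans (add_le_add h3 h1)
    · have := (meas_div hφm (Γ := Γ)).sub hi.1.1
      refine this.congr (ae_of_all _ fun x => ?_)
      simp only [Pi.sub_apply]; ring
    · refine (hi.1.1.sub hu.1).congr (ae_of_all _ fun x => ?_)
      simp only [Pi.sub_apply]; ring
  · have e : (fun x => gradient φ x - v x) = (fun x => gradient φ x - v' x) +
        fun x => v' x - v x := by
      funext x; simp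
    rw [e, ← ENNReal.add_halves ε]
    refine (eLpNorm_add_le ?_ ?_ (by norm_num)).trans (add_le_add h4 h2)
    · exact (grad_cont hφ.cd).aestronglyMeasurable.sub hi.2.1.1
    · exact hi.2.1.1.sub hv.1
lemma congr (hi : InH n d Γ u v) {u' : Euc n → ℝ} {v' : Euc n → Euc n}
    (hu : u =ᵐ[measW n d Γ] u') (hv : v =ᵐ[measW n d Γ] v') : InH n d Γ u' v' := by
  have hu2 : (fun x => u x / infDist x Γ) =ᵐ[measW n d Γ] fun x => u' x / infDist x Γ := by
    filter_upwards [hu] with x hx; rw [hx]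
  refine lim (hi.1.ae_eq hu2) (hi.2.1.ae_eq hv) fun ε hε => ⟨u, v, hi, ?_, ?_⟩
  · rw [eLpNorm_congr_ae (g := 0), eLpNorm_zero]; · exact zero_le
    filter_upwards [hu] with x hx; simp [hx]
  · rw [eLpNorm_congr_ae (g := 0), eLpNorm_zero]; · exact zero_le
    filter_upwards [hv] with x hx; simp [hx]
lemma seq (h : Cx n d C₀ Γ) (hi : InH n d Γ u v) : ∃ φ : ℕ → Euc n → ℝ, (∀ k, IsTest Γ (φ k)) ∧
    Tendsto (fun k => eLpNorm (fun x => (φ k x - u x) / infDist x Γ) 2 (measW n d Γ)) atTop (𝓝 0) ∧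
    Tendsto (fun k => eLpNorm (fun x => gradient (φ k) x - v x) 2 (measW n d Γ)) atTop (𝓝 0) ∧
    ∀ᵐ x ∂(measW n d Γ), Tendsto (fun k => φ k x) atTop (𝓝 (u x)) := by
  have hpos : ∀ k : ℕ, (0 : ℝ≥0∞) < ((k : ℝ≥0∞) + 1)⁻¹ := fun k => by
    simp
  have ht : Tendsto (fun k : ℕ => ((k : ℝ≥0∞) + 1)⁻¹) atTop (𝓝 0) := by
    have := (ENNReal.tendsto_inv_nat_nhds_zero).comp (tendsto_add_atTop_nat 1)
    simpa [Function.comp_def] using this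
  choose φ hφ h1 h2 using fun k : ℕ => hi.2.2 _ (hpos k)
  have t1 := tendsto_of_tendsto_of_tendsto_of_le_of_le tendsto_const_nhds ht (fun _ => zero_le) h1
  have t2 := tendsto_of_tendsto_of_tendsto_of_le_of_le tendsto_const_nhds ht (fun _ => zero_le) h2
  have tm : TendstoInMeasure (measW n d Γ) (fun k x => φ k x / infDist x Γ) atTop
      (fun x => u x / infDist x Γ) := by
    refine tendstoInMeasure_of_tendsto_eLpNorm (p := 2) (by norm_num)
      (fun k => ((hφ k).div h).1) hi.1.1 (t1.congr fun k => ?_)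
    congr 1; funext x; simp [sub_div]
  obtain ⟨ns, hns, hae⟩ := tm.exists_seq_tendsto_ae
  refine ⟨fun k => φ (ns k), fun k => hφ _, t1.comp hns.tendsto_atTop, t2.comp hns.tendsto_atTop, ?_⟩
  filter_upwards [hae, h.m_notMem] with x hx hxΓ
  have hd := (h.dpos hxΓ).ne'
  have := hx.mul_const (infDist x Γ)
  simpa [div_mul_cancel₀ _ hd] using this
lemma mul (h : Cx n d C₀ Γ) (hi : InH n d Γ u v) {η : Euc n → ℝ} (hη : ContDiff ℝ 1 η) {L : ℝ}
    (h1 : ∀ x, |η x| ≤ L) (h2 : ∀ x, ‖gradient η x‖ * infDist x Γ ≤ L) :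
    InH n d Γ (fun x => η x * u x) (fun x => η x • v x + u x • gradient η x) := by
  have hL : 0 ≤ L := (abs_nonneg _).trans (h1 0)
  have hηm := hη.continuous.aestronglyMeasurable (μ := measW n d Γ)
  have hgm := (grad_cont hη).aestronglyMeasurable (μ := measW n d Γ)
  have hum := hi.meas h
  have key : ∀ᵐ x ∂(measW n d Γ), ∀ t : ℝ, ‖t • gradient η x‖ ≤ L * ‖t / infDist x Γ‖ := by
    filter_upwards [h.m_notMem] with x hx t
    have hd := h.dpos hx
    rw [norm_smul, norm_div, Real.norm_of_nonneg hd.le, mul_div_assoc', le_div_iff₀ hd]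
    nlinarith [h2 x, norm_nonneg t]
  refine lim ?_ ?_ fun ε hε => ?_
  · refine hi.1.of_le_mul (c := L) (meas_div (hηm.mul hum)) (ae_of_all _ fun x => ?_)
    rw [mul_div_assoc, norm_mul]; gcongr; exact h1 x
  · refine MemLp.add ?_ ?_
    · refine hi.2.1.of_le_mul (c := L) (hηm.smul hi.2.1.1) (ae_of_all _ fun x => ?_)
      rw [norm_smul]; gcongr; exact h1 x
    · refine hi.1.of_le_mul (c := L) (hum.smul hgm) ?_
      filter_upwards [key] with x hx; exact hx _
  · have hLe : ENNReal.ofReal (2 * L + 1) ≠ ⊤ := by finiteness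
    have hε' : 0 < ε / ENNReal.ofReal (2 * L + 1) := ENNReal.div_pos hε.ne' hLe
    obtain ⟨φ, hφ, a1, a2⟩ := hi.2.2 _ hε'
    have hφm := hφ.cd.continuous.aestronglyMeasurable (μ := measW n d Γ)
    have hte : IsTest Γ (fun x => η x * φ x) :=
      ⟨hη.mul hφ.cd, hφ.cs.mul_left, (closure_mono (Function.support_mul_subset_right _ _)).trans hφ.sup⟩
    have hfin : ENNReal.ofReal (2 * L + 1) * (ε / ENNReal.ofReal (2 * L + 1)) = ε :=
      ENNReal.mul_div_cancel (by simp; positivity) hLe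
    refine ⟨_, _, of_test h hte, ?_, ?_⟩
    · refine (eLpNorm_le_mul_eLpNorm_of_ae_le_mul (c := L)
        (g := fun x => (φ x - u x) / infDist x Γ) (ae_of_all _ fun x => ?_) 2).trans ?_
      · rw [← mul_sub, mul_div_assoc, norm_mul]; gcongr; exact h1 x
      · refine (mul_le_mul' (ENNReal.ofReal_le_ofReal (by linarith)) a1).trans hfin.le
    · have e : (fun x => gradient (fun x => η x * φ x) x - (η x • v x + u x • gradient η x)) =
          (fun x => η x • (gradient φ x - v x)) + fun x => (φ x - u x) • gradient η x := by
        funext x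
        rw [grad_mul (hη.differentiable one_ne_zero x) (hφ.cd.differentiable one_ne_zero x)]
        simp only [Pi.add_apply, smul_sub, sub_smul]; abel
      rw [e]
      refine (eLpNorm_add_le (hηm.smul ((grad_cont hφ.cd).aestronglyMeasurable.sub hi.2.1.1))
        ((hφm.sub hum).smul hgm) (by norm_num)).trans ?_
      have b1 := (eLpNorm_le_mul_eLpNorm_of_ae_le_mul (c := L) (f := fun x => η x • (gradient φ x - v x))
        (g := fun x => gradient φ x - v x) (μ := measW n d Γ) (ae_of_all _ fun x => by
          rw [norm_smul]; gcongr; exact h1 x) 2)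
      have b2 := (eLpNorm_le_mul_eLpNorm_of_ae_le_mul (c := L) (f := fun x => (φ x - u x) • gradient η x)
        (g := fun x => (φ x - u x) / infDist x Γ) (μ := measW n d Γ) (by
          filter_upwards [key] with x hx; exact hx _) 2)
      refine (add_le_add (b1.trans (mul_le_mul_right a2 _)) (b2.trans (mul_le_mul_right a1 _))).trans ?_
      rw [← add_mul, ← ENNReal.ofReal_add hL hL]
      exact (mul_le_mul_left (ENNReal.ofReal_le_ofReal (by linarith)) _).trans hfin.le
end InH
end
noncomputable section
lemma tendsto_l2 {α F : Type*} [MeasurableSpace α] [NormedAddCommGroup F] {μ : Measure α}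
    {f : ℕ → α → F} {g : α → F} (hf : ∀ k, AEStronglyMeasurable (f k) μ) (hg : AEStronglyMeasurable g μ)
    (hgt : eLpNorm g 2 μ ≠ ⊤)
    (h : Tendsto (fun k => eLpNorm (fun x => f k x - g x) 2 μ) atTop (𝓝 0)) :
    Tendsto (fun k => ∫⁻ x, ‖f k x‖ₑ ^ 2 ∂μ) atTop (𝓝 (∫⁻ x, ‖g x‖ₑ ^ 2 ∂μ)) := by
  simp only [← sq_l2]
  refine ENNReal.Tendsto.pow ?_
  have a1 : ∀ k, eLpNorm (f k) 2 μ ≤ eLpNorm g 2 μ + eLpNorm (fun x => f k x - g x) 2 μ := fun k => by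
    have := eLpNorm_add_le hg ((hf k).sub hg) (p := 2) (by norm_num)
    rwa [add_sub_cancel] at this
  have a2 : ∀ k, eLpNorm g 2 μ - eLpNorm (fun x => f k x - g x) 2 μ ≤ eLpNorm (f k) 2 μ := fun k => by
    rw [tsub_le_iff_right]
    have := eLpNorm_sub_le (hf k) ((hf k).sub hg) (p := 2) (by norm_num)
    rwa [sub_sub_cancel] at this
  have t1 := ENNReal.Tendsto.sub (tendsto_const_nhds (x := eLpNorm g 2 μ)) h (Or.inl hgt)
  have t2 := (tendsto_const_nhds (x := eLpNorm g 2 μ)).add h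
  rw [tsub_zero] at t1
  rw [add_zero] at t2
  exact tendsto_of_tendsto_of_tendsto_of_le_of_le t1 t2 a2 a1
namespace InH
variable {n : ℕ} {d C₀ : ℝ} {Γ : Set (Euc n)} {u : Euc n → ℝ} {v : Euc n → Euc n}
lemma le_of_test (h : Cx n d C₀ Γ) (hi : InH n d Γ u v) {c : Euc n → ℝ≥0∞} (hc : Measurable c)
    {K : ℝ≥0∞} (hK : K ≠ ⊤) (ht : ∀ φ, IsTest Γ φ → ∫⁻ x, c x * ‖φ x‖ₑ ^ 2 ∂(measW n d Γ) ≤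
      K * ∫⁻ x, ‖fderiv ℝ φ x‖ₑ ^ 2 ∂(measW n d Γ)) :
    ∫⁻ x, c x * ‖u x‖ₑ ^ 2 ∂(measW n d Γ) ≤ K * ∫⁻ x, ‖v x‖ₑ ^ 2 ∂(measW n d Γ) := by
  obtain ⟨φ, hφ, -, h2, h3⟩ := hi.seq h
  have t := tendsto_l2 (fun k => (grad_cont (hφ k).cd).aestronglyMeasurable) hi.2.1.1 hi.2.1.2.ne h2
  have t' := ENNReal.Tendsto.const_mul t (a := K) (Or.inr hK)
  calc _ ≤ ∫⁻ x, liminf (fun k => c x * ‖φ k x‖ₑ ^ 2) atTop ∂(measW n d Γ) := by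
        refine lintegral_mono_ae ?_
        filter_upwards [h3] with x hx
        by_cases hcx : c x = ⊤
        · by_cases hu : u x = 0
          · simp [hu]
          refine le_of_eq ?_
          have : ∀ᶠ k in atTop, c x * ‖φ k x‖ₑ ^ 2 = c x * ‖u x‖ₑ ^ 2 := by
            filter_upwards [hx.eventually_ne hu] with k hk
            rw [hcx, ENNReal.top_mul (by simpa using hk), ENNReal.top_mul (by simpa using hu)]
          exact ((tendsto_const_nhds.congr' (EventuallyEq.symm this)).liminf_eq).symm
        · refine (Tendsto.liminf_eq ?_).ge
          exact ENNReal.Tendsto.const_mul (ENNReal.Tendsto.pow hx.enorm) (Or.inr hcx)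
    _ ≤ liminf (fun k => ∫⁻ x, c x * ‖φ k x‖ₑ ^ 2 ∂(measW n d Γ)) atTop :=
        lintegral_liminf_le fun k => hc.mul ((hφ k).cd.continuous.measurable.enorm.pow_const 2)
    _ ≤ liminf (fun k => K * ∫⁻ x, ‖gradient (φ k) x‖ₑ ^ 2 ∂(measW n d Γ)) atTop := by
        refine liminf_le_liminf (Eventually.of_forall fun k => ?_)
        simpa only [enorm_grad] using ht _ (hφ k)
    _ = _ := t'.liminf_eq
lemma comp (h : Cx n d C₀ Γ) (hi : InH n d Γ u v) {G G' : ℝ → ℝ} {L : ℝ}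
    (hG : ∀ s, HasDerivAt G (G' s) s) (hG' : Continuous G') (hL : ∀ s, |G' s| ≤ L) (h0 : G 0 = 0) :
    InH n d Γ (fun x => G (u x)) (fun x => G' (u x) • v x) := by
  have hL0 : 0 ≤ L := (abs_nonneg _).trans (hL 0)
  have hGc : Continuous G := continuous_iff_continuousAt.2 fun s => (hG s).continuousAt
  have hlip : ∀ a b, ‖G a - G b‖ ≤ L * ‖a - b‖ := fun a b =>
    convex_univ.norm_image_sub_le_of_norm_hasDerivWithin_le (fun x _ => (hG x).hasDerivWithinAt)
      (fun x _ => hL x) (mem_univ b) (mem_univ a)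
  have hG1 : ContDiff ℝ 1 G := by
    rw [contDiff_one_iff_deriv]
    exact ⟨fun s => (hG s).differentiableAt, by rwa [funext fun s => (hG s).deriv]⟩
  have hum := hi.meas h
  have hG'm : AEStronglyMeasurable (fun x => G' (u x)) (measW n d Γ) := hG'.comp_aestronglyMeasurable hum
  refine lim ?_ ?_ ?_
  · refine hi.1.of_le_mul (c := L) (meas_div (hGc.comp_aestronglyMeasurable hum)) (ae_of_all _ fun x => ?_)
    have := hlip (u x) 0
    rw [h0, sub_zero, sub_zero] at this
    rw [norm_div, norm_div, ← mul_div_assoc]; gcongr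
  · refine hi.2.1.of_le_mul (c := L) (hG'm.smul hi.2.1.1) (ae_of_all _ fun x => ?_)
    rw [norm_smul]; gcongr; exact hL _
  obtain ⟨φ, hφ, h1, h2, h3⟩ := hi.seq h
  have hte : ∀ k, IsTest Γ (fun x => G (φ k x)) := fun k =>
    ⟨hG1.comp (hφ k).cd, (hφ k).cs.comp_left h0, (closure_mono (by
      intro x hx hx2; exact hx (by simp only []; rw [hx2, h0]))).trans (hφ k).sup⟩
  have e1 : Tendsto (fun k => eLpNorm (fun x => (G (φ k x) - G (u x)) / infDist x Γ) 2 (measW n d Γ))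
      atTop (𝓝 0) := by
    have := ENNReal.Tendsto.const_mul h1 (a := ENNReal.ofReal L) (Or.inr (by finiteness))
    rw [mul_zero] at this
    refine tendsto_of_tendsto_of_tendsto_of_le_of_le tendsto_const_nhds this (fun _ => zero_le)
      fun k => eLpNorm_le_mul_eLpNorm_of_ae_le_mul (ae_of_all _ fun x => ?_) 2
    rw [norm_div, norm_div, ← mul_div_assoc]; gcongr; exact hlip _ _
  have hGk : ∀ k, AEStronglyMeasurable (fun x => G' (φ k x)) (measW n d Γ) := fun k =>
    (hG'.comp (hφ k).cd.continuous).aestronglyMeasurable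
  have e2 : Tendsto (fun k => eLpNorm (fun x => (G' (φ k x) - G' (u x)) • v x) 2 (measW n d Γ))
      atTop (𝓝 0) := by
    have hT : Tendsto (fun k => ∫⁻ x, ‖(G' (φ k x) - G' (u x)) • v x‖ₑ ^ 2 ∂(measW n d Γ)) atTop
        (𝓝 (∫⁻ x, 0 ∂(measW n d Γ))) := by
      refine tendsto_lintegral_of_dominated_convergence'
        (fun x => ENNReal.ofReal (2 * L) ^ 2 * ‖v x‖ₑ ^ 2)
        (fun k => (((hGk k).sub hG'm).smul hi.2.1.1).enorm.pow_const 2)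
        (fun k => ae_of_all _ fun x => ?_) ?_ ?_
      · simp only []
        rw [← mul_pow, enorm_smul]
        gcongr
        rw [← ofReal_norm]
        refine ENNReal.ofReal_le_ofReal ((norm_sub_le _ _).trans ?_)
        have a := hL (φ k x); have b := hL (u x)
        simp only [Real.norm_eq_abs]; linarith
      · rw [lintegral_const_mul' _ _ (by finiteness)]
        exact ENNReal.mul_ne_top (by finiteness) (MemLp.lint hi.2.1).ne
      · filter_upwards [h3] with x hx
        have := (((hG'.tendsto (u x)).comp hx).sub_const (G' (u x))).smul_const (v x)
        simp only [sub_self, zero_smul] at this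
        simpa using ENNReal.Tendsto.pow (n := 2) this.enorm
    simp only [lintegral_zero, ← sq_l2] at hT
    have := (ENNReal.continuous_rpow_const (y := (1/2 : ℝ))).tendsto 0 |>.comp hT
    rw [ENNReal.zero_rpow_of_pos (by norm_num)] at this
    refine this.congr fun k => ?_
    simp only [Function.comp]
    rw [← ENNReal.rpow_natCast, ← ENNReal.rpow_mul]; norm_num
  have e3 : Tendsto (fun k => eLpNorm (fun x => gradient (fun x => G (φ k x)) x - G' (u x) • v x) 2
      (measW n d Γ)) atTop (𝓝 0) := by
    have := (ENNReal.Tendsto.const_mul h2 (a := ENNReal.ofReal L) (Or.inr (by finiteness))).add e2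
    rw [mul_zero, zero_add] at this
    refine tendsto_of_tendsto_of_tendsto_of_le_of_le tendsto_const_nhds this (fun _ => zero_le)
      fun k => ?_
    have e : (fun x => gradient (fun x => G (φ k x)) x - G' (u x) • v x) =
        (fun x => G' (φ k x) • (gradient (φ k) x - v x)) + fun x => (G' (φ k x) - G' (u x)) • v x := by
      funext x
      rw [grad_comp ((hφ k).cd.differentiable one_ne_zero x) (hG _)]
      simp only [Pi.add_apply, smul_sub, sub_smul]; abel
    rw [e]
    refine (eLpNorm_add_le ((hGk k).smul ((grad_cont (hφ k).cd).aestronglyMeasurable.sub hi.2.1.1))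
      (((hGk k).sub hG'm).smul hi.2.1.1) (by norm_num)).trans (add_le_add ?_ le_rfl)
    refine eLpNorm_le_mul_eLpNorm_of_ae_le_mul (ae_of_all _ fun x => ?_) 2
    change ‖G' (φ k x) • (gradient (φ k) x - v x)‖ ≤ _
    rw [norm_smul]; gcongr; exact hL _
  intro ε hε
  obtain ⟨k, k1, k2⟩ := ((e1.eventually (ge_mem_nhds hε)).and (e3.eventually (ge_mem_nhds hε))).exists
  exact ⟨_, _, of_test h (hte k), k1, k2⟩
end InH
theorem hardy_H (n : ℕ) (d C₀ : ℝ) : ∃ C : ℝ≥0, ∀ Γ, Cx n d C₀ Γ → ∀ u v, InH n d Γ u v →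
    ∫⁻ x, ‖u x / infDist x Γ‖ₑ ^ 2 ∂(measW n d Γ) ≤ C * ∫⁻ x, ‖v x‖ₑ ^ 2 ∂(measW n d Γ) := by
  obtain ⟨C, hC⟩ := hardy_m n d C₀
  refine ⟨C, fun Γ h u v hi => ?_⟩
  have e : ∀ (f : Euc n → ℝ) x, ‖f x / infDist x Γ‖ₑ ^ 2 = ‖(infDist x Γ)⁻¹‖ₑ ^ 2 * ‖f x‖ₑ ^ 2 := by
    intro f x
    rw [div_eq_inv_mul, enorm_mul, mul_pow]
  simp only [e]
  refine hi.le_of_test h (measurable_infDist.inv.enorm.pow_const 2) (by finiteness) fun φ hφ => ?_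
  simpa only [e, Pi.inv_apply] using hC Γ h φ hφ.cd hφ.cs hφ.sup
theorem fk_H {n : ℕ} (d C₀ : ℝ) {θ : ℝ} (hθ : Adm n θ) : ∃ K : ℝ≥0, ∀ Γ, Cx n d C₀ Γ → ∀ u v,
    InH n d Γ u v → ∀ y R, 0 < R → ∀ S, MeasurableSet S → S ⊆ ball y R →
    ∫⁻ x in S, ‖u x‖ₑ ^ 2 ∂(measW n d Γ) ≤ K * ENNReal.ofReal ((R + infDist y Γ) ^ (2 - n * θ)) *
      volume S ^ θ * ∫⁻ x, ‖v x‖ₑ ^ 2 ∂(measW n d Γ) := by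
  obtain ⟨K, hK⟩ := fk_m d C₀ hθ
  refine ⟨K, fun Γ h u v hi y R hR S hS hSB => ?_⟩
  have e : ∀ (f : Euc n → ℝ), ∫⁻ x in S, ‖f x‖ₑ ^ 2 ∂(measW n d Γ) =
      ∫⁻ x, S.indicator (fun _ => 1) x * ‖f x‖ₑ ^ 2 ∂(measW n d Γ) := by
    intro f
    rw [← lintegral_indicator hS]
    congr 1; funext x
    by_cases hx : x ∈ S <;> simp [hx]
  have hv : volume S ≠ ⊤ := ((measure_mono hSB).trans_lt measure_ball_lt_top).ne
  rw [e]
  refine hi.le_of_test h (measurable_const.indicator hS) ?_ fun φ hφ => ?_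
  · have := hθ.pos
    exact ENNReal.mul_ne_top (by finiteness) (ENNReal.rpow_ne_top_of_nonneg this.le hv)
  · rw [← e]
    exact hK Γ h φ hφ.cd hφ.cs hφ.sup y R hR S hS hSB
end
noncomputable section
structure El (n : ℕ) (d : ℝ) (Γ : Set (Euc n)) (T : Euc n → Euc n →L[ℝ] Euc n) (C₁ : ℝ) : Prop where
  one : 1 ≤ C₁
  meas : AEStronglyMeasurable T (measW n d Γ)
  bd : ∀ x, ‖T x‖ ≤ C₁
  lo : ∀ x, x ∉ Γ → ∀ ξ, C₁⁻¹ * ‖ξ‖ ^ 2 ≤ inner ℝ (T x ξ) ξ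
abbrev XX (n : ℕ) (d : ℝ) (Γ : Set (Euc n)) :=
  WithLp 2 (Lp ℝ 2 (measW n d Γ) × Lp (Euc n) 2 (measW n d Γ))
lemma lp_sq {α F : Type*} [MeasurableSpace α] [NormedAddCommGroup F] {μ : Measure α} (f : Lp F 2 μ) :
    ENNReal.ofReal (‖f‖ ^ 2) = ∫⁻ x, ‖f x‖ₑ ^ 2 ∂μ := by
  rw [← sq_l2, ENNReal.ofReal_pow (norm_nonneg _), ofReal_norm, Lp.enorm_def]
section
variable {n : ℕ} {d C₀ C₁ : ℝ} {Γ : Set (Euc n)} {T : Euc n → Euc n →L[ℝ] Euc n}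
lemma IsTest.add {φ ψ : Euc n → ℝ} (h1 : IsTest Γ φ) (h2 : IsTest Γ ψ) :
    IsTest Γ (fun x => φ x + ψ x) :=
  ⟨h1.cd.add h2.cd, h1.cs.add h2.cs, (tsupport_add φ ψ).trans (union_subset h1.sup h2.sup)⟩
lemma IsTest.smul {φ : Euc n → ℝ} (h1 : IsTest Γ φ) (c : ℝ) : IsTest Γ (fun x => c * φ x) :=
  ⟨contDiff_const.mul h1.cd, h1.cs.mul_left,
    (closure_mono (Function.support_mul_subset_right _ _)).trans h1.sup⟩
variable (n d Γ) in
def H0 : Submodule ℝ (XX n d Γ) where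
  carrier := {x | ∃ φ, IsTest Γ φ ∧ x.fst =ᵐ[measW n d Γ] (fun t => φ t / infDist t Γ) ∧
    x.snd =ᵐ[measW n d Γ] gradient φ}
  add_mem' := by
    rintro x y ⟨φ, hφ, a1, a2⟩ ⟨ψ, hψ, b1, b2⟩
    refine ⟨_, hφ.add hψ, ?_, ?_⟩
    · rw [WithLp.add_fst]
      filter_upwards [Lp.coeFn_add x.fst y.fst, a1, b1] with t h1 h2 h3
      rw [h1, Pi.add_apply, h2, h3, add_div]
    · rw [WithLp.add_snd]
      filter_upwards [Lp.coeFn_add x.snd y.snd, a2, b2] with t h1 h2 h3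
      rw [h1, Pi.add_apply, h2, h3, gradient, gradient, gradient,
        fderiv_fun_add (hφ.cd.differentiable one_ne_zero t) (hψ.cd.differentiable one_ne_zero t), map_add]
  zero_mem' := by
    refine ⟨fun _ => 0, ⟨contDiff_const, HasCompactSupport.zero, ?_⟩, ?_, ?_⟩
    · rw [tsupport_eq_empty_iff.2 (show (fun _ : Euc n => (0:ℝ)) = 0 from rfl)]; exact empty_subset _
    · rw [WithLp.zero_fst]
      filter_upwards [Lp.coeFn_zero ℝ 2 (measW n d Γ)] with t h1
      rw [h1]; simp
    · rw [WithLp.zero_snd]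
      filter_upwards [Lp.coeFn_zero (Euc n) 2 (measW n d Γ)] with t h1
      rw [h1]; simp [gradient]
  smul_mem' := by
    rintro c x ⟨φ, hφ, a1, a2⟩
    refine ⟨_, hφ.smul c, ?_, ?_⟩
    · rw [WithLp.smul_fst]
      filter_upwards [Lp.coeFn_smul c x.fst, a1] with t h1 h2
      rw [h1, Pi.smul_apply, h2, smul_eq_mul, mul_div_assoc]
    · rw [WithLp.smul_snd]
      filter_upwards [Lp.coeFn_smul c x.snd, a2] with t h1 h2
      rw [h1, Pi.smul_apply, h2, gradient, gradient,
        fderiv_const_mul (hφ.cd.differentiable one_ne_zero t), map_smul]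
variable (n d Γ) in
def HH : Submodule ℝ (XX n d Γ) := (H0 n d Γ).topologicalClosure
lemma elp_sub {F : Type*} [NormedAddCommGroup F] {μ : Measure (Euc n)} (f g : Lp F 2 μ) {f' g' : Euc n → F}
    (hf : f =ᵐ[μ] f') (hg : g =ᵐ[μ] g') : ‖f - g‖ₑ = eLpNorm (fun x => f' x - g' x) 2 μ := by
  rw [Lp.enorm_def]
  refine eLpNorm_congr_ae ?_
  filter_upwards [Lp.coeFn_sub f g, hf, hg] with x h1 h2 h3
  rw [h1, Pi.sub_apply, h2, h3]
lemma mem_HH (h : Cx n d C₀ Γ) {x : XX n d Γ} {u : Euc n → ℝ} {v : Euc n → Euc n}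
    (h1 : x.fst =ᵐ[measW n d Γ] fun t => u t / infDist t Γ) (h2 : x.snd =ᵐ[measW n d Γ] v) :
    x ∈ HH n d Γ ↔ InH n d Γ u v := by
  have m1 := (Lp.memLp x.fst).ae_eq h1
  have m2 := (Lp.memLp x.snd).ae_eq h2
  constructor
  · intro hx
    refine ⟨m1, m2, fun ε hε => ?_⟩
    rw [HH, ← SetLike.mem_coe, Submodule.topologicalClosure_coe, EMetric.mem_closure_iff] at hx
    obtain ⟨y, ⟨φ, hφ, a1, a2⟩, hy⟩ := hx ε hε
    have hxy : ‖y - x‖ₑ ≤ ε := by rw [edist_comm, edist_eq_enorm_sub] at hy; exact hy.le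
    refine ⟨φ, hφ, ?_, ?_⟩
    · have := (WithLp.enorm_fst_le _ (y - x)).trans hxy
      rw [WithLp.sub_fst, elp_sub _ _ a1 h1] at this
      simpa only [sub_div] using this
    · have := (WithLp.enorm_snd_le _ (y - x)).trans hxy
      rwa [WithLp.sub_snd, elp_sub _ _ a2 h2] at this
  · intro hi
    rw [HH, ← SetLike.mem_coe, Submodule.topologicalClosure_coe, EMetric.mem_closure_iff]
    intro ε hε
    obtain ⟨ε', he0, he1⟩ := exists_between hε
    obtain ⟨φ, hφ, b1, b2⟩ := hi.2.2 (ε' / 2) (ENNReal.half_pos he0.ne')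
    let y : XX n d Γ := WithLp.toLp 2 ((hφ.div h).toLp, (hφ.grad h).toLp)
    have a1 : y.fst =ᵐ[measW n d Γ] fun t => φ t / infDist t Γ := (hφ.div h).coeFn_toLp
    have a2 : y.snd =ᵐ[measW n d Γ] gradient φ := (hφ.grad h).coeFn_toLp
    refine ⟨y, ⟨φ, hφ, a1, a2⟩, lt_of_le_of_lt ?_ he1⟩
    rw [edist_comm, edist_eq_enorm_sub]
    have c1 : ‖(y - x).fst‖ₑ ≤ ε' / 2 := by
      rw [WithLp.sub_fst, elp_sub _ _ a1 h1]
      simpa only [sub_div] using b1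
    have c2 : ‖(y - x).snd‖ₑ ≤ ε' / 2 := by
      rw [WithLp.sub_snd, elp_sub _ _ a2 h2]; exact b2
    refine le_trans ?_ ((add_le_add c1 c2).trans (ENNReal.add_halves ε').le)
    rw [← ofReal_norm, ← ofReal_norm, ← ofReal_norm, ← ENNReal.ofReal_add (norm_nonneg _) (norm_nonneg _)]
    refine ENNReal.ofReal_le_ofReal ?_
    have := WithLp.prod_norm_sq_eq_of_L2 (y - x)
    nlinarith [norm_nonneg (y - x), norm_nonneg (y-x).fst, norm_nonneg (y-x).snd]
lemma HH.inH (h : Cx n d C₀ Γ) {x : XX n d Γ} (hx : x ∈ HH n d Γ) :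
    InH n d Γ (fun t => x.fst t * infDist t Γ) x.snd := by
  refine (mem_HH h ?_ EventuallyEq.rfl).1 hx
  filter_upwards [h.m_notMem] with t ht
  rw [mul_div_cancel_right₀ _ (h.dpos ht).ne']
lemma El.memLp (hT : El n d Γ T C₁) : MemLp T ⊤ (measW n d Γ) :=
  memLp_top_of_bound hT.meas C₁ (ae_of_all _ hT.bd)
def El.op (hT : El n d Γ T C₁) : Lp (Euc n) 2 (measW n d Γ) →L[ℝ] Lp (Euc n) 2 (measW n d Γ) :=
  (ContinuousLinearMap.id ℝ (Euc n →L[ℝ] Euc n)).holderL (measW n d Γ) ⊤ 2 2 hT.memLp.toLp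
lemma El.op_ae (hT : El n d Γ T C₁) (f : Lp (Euc n) 2 (measW n d Γ)) :
    hT.op f =ᵐ[measW n d Γ] fun x => T x (f x) := by
  have := (ContinuousLinearMap.id ℝ (Euc n →L[ℝ] Euc n)).coeFn_holder (r := 2) hT.memLp.toLp f
  filter_upwards [this, hT.memLp.coeFn_toLp] with x h1 h2
  refine Eq.trans h1 ?_
  rw [h2]; rfl
lemma El.inner_op (hT : El n d Γ T C₁) (f g : Lp (Euc n) 2 (measW n d Γ)) :
    inner ℝ (hT.op f) g = ∫ x, inner ℝ (T x (f x)) (g x) ∂(measW n d Γ) := by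
  rw [L2.inner_def]
  refine integral_congr_ae ?_
  filter_upwards [hT.op_ae f] with x hx
  rw [hx]
lemma inner_int {F : Type*} [NormedAddCommGroup F] [InnerProductSpace ℝ F] {μ : Measure (Euc n)}
    {f g : Euc n → F} (hf : MemLp f 2 μ) (hg : MemLp g 2 μ) :
    Integrable (fun x => (inner ℝ (f x) (g x) : ℝ)) μ := by
  refine (L2.integrable_inner (𝕜 := ℝ) hf.toLp hg.toLp).congr ?_
  filter_upwards [hf.coeFn_toLp, hg.coeFn_toLp] with x h1 h2
  rw [h1, h2]
lemma El.memLp_T (hT : El n d Γ T C₁) {v : Euc n → Euc n} (hv : MemLp v 2 (measW n d Γ)) :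
    MemLp (fun x => T x (v x)) 2 (measW n d Γ) := by
  refine (Lp.memLp (hT.op hv.toLp)).ae_eq ?_
  filter_upwards [hT.op_ae hv.toLp, hv.coeFn_toLp] with x h1 h2
  rw [h1, h2]
lemma El.coer (h : Cx n d C₀ Γ) (hT : El n d Γ T C₁) (f : Lp (Euc n) 2 (measW n d Γ)) :
    C₁⁻¹ * ‖f‖ ^ 2 ≤ inner ℝ (hT.op f) f := by
  rw [hT.inner_op, ← real_inner_self_eq_norm_sq, L2.inner_def, ← integral_const_mul]
  refine integral_mono_ae ((L2.integrable_inner f f).const_mul _)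
    (inner_int (hT.memLp_T (Lp.memLp f)) (Lp.memLp f)) ?_
  filter_upwards [h.m_notMem] with x hx
  rw [real_inner_self_eq_norm_sq]
  exact hT.lo x hx _
theorem lax (h : Cx n d C₀ Γ) (hT : El n d Γ T C₁) {F : Euc n → ℝ} (hF : MemLp F 2 (measW n d Γ)) :
    ∃ u v, InH n d Γ u v ∧ ∀ φ ψ, InH n d Γ φ ψ →
      ∫ x, inner ℝ (T x (v x)) (ψ x) ∂(measW n d Γ) = ∫ x, F x * (φ x / infDist x Γ) ∂(measW n d Γ) := by
  have : CompleteSpace (HH n d Γ) := (H0 n d Γ).isClosed_topologicalClosure.completeSpace_coe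
  let B : HH n d Γ →L[ℝ] HH n d Γ →L[ℝ] ℝ := LinearMap.mkContinuous₂
    (LinearMap.mk₂ ℝ (fun x y => inner ℝ (hT.op x.1.snd) y.1.snd)
      (by intros; simp [inner_add_left]) (by intros; simp [inner_smul_left])
      (by intros; simp [inner_add_right]) (by intros; simp [inner_smul_right])) ‖hT.op‖ (by
        intro x y
        refine (norm_inner_le_norm (𝕜 := ℝ) (hT.op x.1.snd) y.1.snd).trans ?_
        gcongr
        · exact (hT.op.le_opNorm _).trans (by gcongr; exact WithLp.norm_snd_le _ x.1)
        · exact WithLp.norm_snd_le _ y.1)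
  have hB : ∀ x y, B x y = inner ℝ (hT.op x.1.snd) y.1.snd := fun x y => rfl
  have hcoer : IsCoercive B := by
    obtain ⟨C, hC⟩ := hardy_H n d C₀
    have hC1 : 0 < C₁ := lt_of_lt_of_le one_pos hT.one
    refine ⟨C₁⁻¹ * ((C : ℝ) + 1)⁻¹, by positivity, fun x => ?_⟩
    rw [hB]
    refine le_trans ?_ (hT.coer h _)
    rw [mul_assoc, mul_assoc]
    gcongr
    rw [inv_mul_le_iff₀ (by positivity)]
    have e := WithLp.prod_norm_sq_eq_of_L2 x.1
    have e2 := hC Γ h _ _ (HH.inH h x.2)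
    rw [← lp_sq, lintegral_congr_ae (g := fun t => ‖x.1.fst t‖ₑ ^ 2), ← lp_sq, ← ENNReal.ofReal_coe_nnreal,
      ← ENNReal.ofReal_mul (by positivity), ENNReal.ofReal_le_ofReal_iff (by positivity)] at e2
    · have : ‖x‖ = ‖x.1‖ := rfl
      rw [this]; nlinarith
    · filter_upwards [h.m_notMem] with t ht
      rw [mul_div_cancel_right₀ _ (h.dpos ht).ne']
  let ℓ : HH n d Γ →L[ℝ] ℝ := (innerSL ℝ hF.toLp) ∘L (WithLp.fstL 2 ℝ _ _) ∘L (HH n d Γ).subtypeL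
  let z := (InnerProductSpace.toDual ℝ (HH n d Γ)).symm ℓ
  let x := hcoer.continuousLinearEquivOfBilin.symm z
  refine ⟨_, _, HH.inH h x.2, fun φ ψ hφ => ?_⟩
  let y : XX n d Γ := WithLp.toLp 2 (hφ.1.toLp, hφ.2.1.toLp)
  have a1 : y.fst =ᵐ[measW n d Γ] fun t => φ t / infDist t Γ := hφ.1.coeFn_toLp
  have a2 : y.snd =ᵐ[measW n d Γ] ψ := hφ.2.1.coeFn_toLp
  have hy : y ∈ HH n d Γ := (mem_HH h a1 a2).2 hφ
  have k1 : B x ⟨y, hy⟩ = ℓ ⟨y, hy⟩ := by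
    rw [← hcoer.continuousLinearEquivOfBilin_apply]
    simp only [x, z, ContinuousLinearEquiv.apply_symm_apply]
    rw [InnerProductSpace.toDual_symm_apply]
  rw [hB, hT.inner_op] at k1
  have k2 : ℓ ⟨y, hy⟩ = inner ℝ hF.toLp y.fst := rfl
  rw [k2, L2.inner_def] at k1
  calc _ = _ := integral_congr_ae (by filter_upwards [a2] with t ht; rw [← ht])
    _ = _ := k1
    _ = _ := integral_congr_ae (by
      filter_upwards [a1, hF.coeFn_toLp] with t ht ht2
      rw [ht, ht2]; simp [mul_comm])
end
end
noncomputable section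
def pf (s : ℝ) : ℝ := (max s 0) ^ 2 / (1 + max s 0)
def p1 (s : ℝ) : ℝ := 1 - 1 / (1 + max s 0) ^ 2
def p2 (s : ℝ) : ℝ := p1 s ^ 2 + pf s * (2 / (1 + max s 0) ^ 3)
lemma pmax_pos (s : ℝ) : 0 < 1 + max s 0 := by positivity
lemma pf_cont : Continuous pf := by
  unfold pf; exact ((continuous_id.max continuous_const).pow 2).div
    (continuous_const.add (continuous_id.max continuous_const)) fun s => (pmax_pos s).ne'
lemma p1_cont : Continuous p1 := by
  unfold p1; exact continuous_const.sub (continuous_const.div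
    ((continuous_const.add (continuous_id.max continuous_const)).pow 2)
    fun s => (pow_pos (pmax_pos s) 2).ne')
lemma p2_cont : Continuous p2 := by
  unfold p2; exact (p1_cont.pow 2).add (pf_cont.mul (continuous_const.div
    ((continuous_const.add (continuous_id.max continuous_const)).pow 3)
    fun s => (pow_pos (pmax_pos s) 3).ne'))
lemma pf_neg {s : ℝ} (hs : s ≤ 0) : pf s = 0 := by simp [pf, max_eq_right hs]
lemma p1_neg {s : ℝ} (hs : s ≤ 0) : p1 s = 0 := by simp [p1, max_eq_right hs]
lemma p2_neg {s : ℝ} (hs : s ≤ 0) : p2 s = 0 := by simp [p2, p1_neg hs, pf_neg hs]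
lemma p1_nonneg (s : ℝ) : 0 ≤ p1 s := by
  unfold p1
  rw [sub_nonneg, div_le_one (pow_pos (pmax_pos s) 2)]
  nlinarith [le_max_right s 0]
lemma p1_le (s : ℝ) : p1 s ≤ 1 := by
  unfold p1
  have : 0 ≤ 1 / (1 + max s 0) ^ 2 := by positivity
  linarith
lemma pf_nonneg (s : ℝ) : 0 ≤ pf s := by unfold pf; positivity
lemma pf_le (s : ℝ) : pf s ≤ max s 0 := by
  unfold pf
  rw [div_le_iff₀ (pmax_pos s)]
  nlinarith [le_max_right s 0]
lemma p1_abs (s : ℝ) : |p1 s| ≤ 1 := by rw [abs_of_nonneg (p1_nonneg s)]; exact p1_le s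
lemma p2_ge (s : ℝ) : p1 s ^ 2 ≤ p2 s := by
  have := pf_nonneg s
  unfold p2
  have : 0 ≤ pf s * (2 / (1 + max s 0) ^ 3) := by positivity
  linarith
lemma p2_le (s : ℝ) : |p2 s| ≤ 3 := by
  rw [abs_of_nonneg ((sq_nonneg _).trans (p2_ge s))]
  have h1 : p1 s ^ 2 ≤ 1 := by nlinarith [p1_nonneg s, p1_le s]
  have h2 : pf s * (2 / (1 + max s 0) ^ 3) ≤ 2 := by
    have h0 := le_max_right s 0
    have := pf_le s
    rw [mul_div_assoc', div_le_iff₀ (pow_pos (pmax_pos s) 3)]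
    nlinarith [pow_nonneg h0 2, pow_nonneg h0 3]
  unfold p2; linarith
lemma pf_deriv (s : ℝ) : HasDerivAt pf (p1 s) s := by
  have key : ∀ s ≠ 0, HasDerivAt pf (p1 s) s := by
    intro s hs
    rcases lt_or_gt_of_ne hs with h | h
    · rw [p1_neg h.le]
      refine (hasDerivAt_const s (0 : ℝ)).congr_of_eventuallyEq ?_
      filter_upwards [Iio_mem_nhds h] with t ht using pf_neg (le_of_lt ht)
    · have : HasDerivAt (fun t : ℝ => t ^ 2 / (1 + t)) (p1 s) s := by
        have := ((hasDerivAt_id' s).pow 2).div ((hasDerivAt_id' s).const_add 1) (by positivity)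
        refine this.congr_deriv ?_
        rw [p1, max_eq_left h.le]; simp only [Pi.pow_apply]; field_simp; push_cast; ring
      refine this.congr_of_eventuallyEq ?_
      filter_upwards [Ioi_mem_nhds h] with t ht
      rw [pf, max_eq_left (le_of_lt ht)]
  rcases eq_or_ne s 0 with rfl | h
  · exact hasDerivAt_of_hasDerivAt_of_ne key pf_cont.continuousAt p1_cont.continuousAt
  · exact key s h
lemma pp_deriv (s : ℝ) : HasDerivAt (fun s => pf s * p1 s) (p2 s) s := by
  have key : ∀ s ≠ 0, HasDerivAt (fun s => pf s * p1 s) (p2 s) s := by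
    intro s hs
    rcases lt_or_gt_of_ne hs with h | h
    · rw [p2_neg h.le]
      refine (hasDerivAt_const s (0 : ℝ)).congr_of_eventuallyEq ?_
      filter_upwards [Iio_mem_nhds h] with t ht
      rw [pf_neg (le_of_lt ht), zero_mul]
    · have h1 : HasDerivAt (fun t : ℝ => 1 - 1 / (1 + t) ^ 2) (2 / (1 + s) ^ 3) s := by
        have := ((hasDerivAt_const s (1:ℝ)).div (((hasDerivAt_id' s).const_add 1).pow 2)
          (by simp only [Pi.pow_apply]; positivity)).const_sub 1
        refine this.congr_deriv ?_
        simp only [Pi.pow_apply]; field_simp; push_cast; ring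
      have h2 : HasDerivAt p1 (2 / (1 + s) ^ 3) s := by
        refine h1.congr_of_eventuallyEq ?_
        filter_upwards [Ioi_mem_nhds h] with t ht
        rw [p1, max_eq_left (le_of_lt ht)]
      refine ((pf_deriv s).mul h2).congr_deriv ?_
      rw [p2, max_eq_left h.le]; ring
  rcases eq_or_ne s 0 with rfl | h
  · exact hasDerivAt_of_hasDerivAt_of_ne key (pf_cont.mul p1_cont).continuousAt p2_cont.continuousAt
  · exact key s h
lemma pf_tendsto (x : ℝ) : Tendsto (fun k : ℕ => ((k : ℝ) + 1)⁻¹ * pf (x / ((k : ℝ) + 1)⁻¹)) atTop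
    (𝓝 (max x 0)) := by
  rcases le_or_gt x 0 with h | h
  · rw [max_eq_right h]
    refine tendsto_const_nhds.congr fun k => ?_
    rw [pf_neg (div_nonpos_of_nonpos_of_nonneg h (by positivity)), mul_zero]
  · rw [max_eq_left h.le]
    have e : ∀ k : ℕ, ((k : ℝ) + 1)⁻¹ * pf (x / ((k : ℝ) + 1)⁻¹) = x ^ 2 / (1 / ((k : ℝ) + 1) + x) := by
      intro k
      have : 0 ≤ x / ((k : ℝ) + 1)⁻¹ := by positivity
      rw [pf, max_eq_left this]; field_simp
    simp only [e]
    have := (tendsto_const_nhds (x := x ^ 2)).div (tendsto_one_div_add_atTop_nhds_zero_nat.add_const x)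
      (by rw [zero_add]; exact h.ne')
    rw [zero_add, pow_two, mul_div_cancel_right₀ _ h.ne'] at this
    simp only [pow_two]; exact this
section
variable {n : ℕ} {d C₀ C₁ : ℝ} {Γ : Set (Euc n)} {T : Euc n → Euc n →L[ℝ] Euc n}
  {y : Euc n} {ρ : ℝ} {u : Euc n → ℝ} {v : Euc n → Euc n}
structure Gr (n : ℕ) (d : ℝ) (Γ : Set (Euc n)) (T : Euc n → Euc n →L[ℝ] Euc n) (y : Euc n) (ρ : ℝ)
    (u : Euc n → ℝ) (v : Euc n → Euc n) : Prop where
  inH : InH n d Γ u v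
  eq : ∀ φ ψ, InH n d Γ φ ψ → ∫ x, inner ℝ (T x (v x)) (ψ x) ∂(measW n d Γ) =
    ((measW n d Γ).real (ball y ρ))⁻¹ * ∫ x in ball y ρ, φ x ∂(measW n d Γ)
lemma Gr.exists (h : Cx n d C₀ Γ) (hT : El n d Γ T C₁) (hb : closedBall y ρ ⊆ Γᶜ) :
    ∃ u v, Gr n d Γ T y ρ u v := by
  set c := ((measW n d Γ).real (ball y ρ))⁻¹
  have hF : MemLp ((ball y ρ).indicator fun x => c * infDist x Γ) 2 (measW n d Γ) := by
    rw [memLp_indicator_iff_restrict measurableSet_ball]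
    have : IsFiniteMeasure ((measW n d Γ).restrict (ball y ρ)) :=
      ⟨by
        rw [Measure.restrict_apply_univ]
        exact (measure_mono ball_subset_closedBall).trans_lt
          (h.m_compact (isCompact_closedBall y ρ) hb)⟩
    have hcont : Continuous fun x => c * infDist x Γ := continuous_const.mul (continuous_infDist_pt Γ)
    obtain ⟨M, hM⟩ := (isCompact_closedBall y ρ).exists_bound_of_continuousOn hcont.continuousOn
    refine MemLp.of_bound hcont.aestronglyMeasurable M ?_
    filter_upwards [ae_restrict_mem measurableSet_ball] with x hx
    exact hM x (ball_subset_closedBall hx)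
  obtain ⟨u, v, hi, he⟩ := lax h hT hF
  refine ⟨u, v, hi, fun φ ψ hφ => ?_⟩
  rw [he φ ψ hφ, ← integral_const_mul, ← integral_indicator measurableSet_ball]
  refine integral_congr_ae ?_
  filter_upwards [h.m_notMem] with x hx
  by_cases hxb : x ∈ ball y ρ
  · have := (h.dpos hx).ne'
    simp only [indicator_of_mem hxb]; change c * _ * _ = c * _; field_simp
  · simp [indicator_of_notMem hxb]
lemma Gr.nonneg (h : Cx n d C₀ Γ) (hT : El n d Γ T C₁) (hg : Gr n d Γ T y ρ u v) :
    ∀ᵐ x ∂(measW n d Γ), 0 ≤ u x := by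
  have hi := hg.inH
  have hc : InH n d Γ (fun x => - pf (-(u x))) (fun x => p1 (-(u x)) • v x) := by
    refine hi.comp h (G := fun s => - pf (-s)) (G' := fun s => p1 (-s)) (L := 1) (fun s => ?_)
      (p1_cont.comp continuous_neg) (fun s => p1_abs _) (by simp [pf_neg])
    have := ((pf_deriv (-s)).comp s (hasDerivAt_neg s)).neg
    exact this.congr_deriv (by ring)
  have e := hg.eq _ _ hc
  have hC1 : 0 < C₁ := lt_of_lt_of_le one_pos hT.one
  have hle : ∫ x, inner ℝ (T x (v x)) (p1 (-(u x)) • v x) ∂(measW n d Γ) ≤ 0 := by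
    rw [e]
    refine mul_nonpos_of_nonneg_of_nonpos (by positivity) (integral_nonpos fun x => ?_)
    simp [pf_nonneg]
  have hge : ∀ᵐ x ∂(measW n d Γ), p1 (-(u x)) * (C₁⁻¹ * ‖v x‖ ^ 2) ≤
      inner ℝ (T x (v x)) (p1 (-(u x)) • v x) := by
    filter_upwards [h.m_notMem] with x hx
    rw [inner_smul_right]
    exact mul_le_mul_of_nonneg_left (hT.lo x hx _) (p1_nonneg _)
  have hge0 : 0 ≤ᵐ[measW n d Γ] fun x => inner ℝ (T x (v x)) (p1 (-(u x)) • v x) := by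
    filter_upwards [hge] with x hx
    exact le_trans (mul_nonneg (p1_nonneg _) (by positivity)) hx
  have hz := (integral_eq_zero_iff_of_nonneg_ae hge0
    (inner_int (hT.memLp_T hi.2.1) hc.2.1)).1 (le_antisymm hle (integral_nonneg_of_ae hge0))
  have hv : ∀ᵐ x ∂(measW n d Γ), p1 (-(u x)) • v x = 0 := by
    filter_upwards [hz, hge] with x h1 h2
    rw [h1] at h2
    simp only [Pi.zero_apply] at h2
    rw [smul_eq_zero]
    by_contra! hh
    have := (p1_nonneg (-(u x))).lt_of_ne' hh.1
    have h3 : 0 < ‖v x‖ := norm_pos_iff.2 hh.2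
    have : 0 < p1 (-(u x)) * (C₁⁻¹ * ‖v x‖ ^ 2) := by positivity
    linarith
  obtain ⟨C, hC⟩ := hardy_H n d C₀
  have hh := hC Γ h _ _ hc
  rw [lintegral_congr_ae (f := fun x => ‖p1 (-(u x)) • v x‖ₑ ^ 2) (g := fun _ => 0)
    (by filter_upwards [hv] with x hx; simp [hx])] at hh
  simp only [lintegral_zero, mul_zero, nonpos_iff_eq_zero] at hh
  rw [lintegral_eq_zero_iff' (hc.1.1.enorm.pow_const 2)] at hh
  filter_upwards [hh, h.m_notMem] with x hx hxΓ
  have hd := (h.dpos hxΓ).ne'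
  simp only [Pi.zero_apply, ne_eq, OfNat.ofNat_ne_zero, not_false_eq_true, pow_eq_zero_iff,
    enorm_eq_zero, div_eq_zero_iff, hd, or_false, neg_eq_zero] at hx
  by_contra! hneg
  rw [pf, max_eq_left (by linarith)] at hx
  have : 0 < (-(u x)) ^ 2 / (1 + -(u x)) := div_pos (by nlinarith) (by linarith)
  linarith
lemma lint_of_int {F : Type*} [NormedAddCommGroup F] {μ : Measure (Euc n)} {f : Euc n → F}
    (hf : MemLp f 2 μ) : ∫⁻ x, ‖f x‖ₑ ^ 2 ∂μ = ENNReal.ofReal (∫ x, ‖f x‖ ^ 2 ∂μ) := by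
  rw [ofReal_integral_eq_lintegral_ofReal (hf.integrable_norm_pow (by norm_num)) (ae_of_all _ fun x => by positivity)]
  refine lintegral_congr fun x => ?_
  rw [ENNReal.ofReal_pow (norm_nonneg _), ofReal_norm]
lemma Gr.energy (h : Cx n d C₀ Γ) (hT : El n d Γ T C₁) (hg : Gr n d Γ T y ρ u v) {M : ℝ} (hM : 0 < M) :
    ∃ h' : Euc n → Euc n, InH n d Γ (fun x => M * Real.arctan (u x / M)) h' ∧
      ∫⁻ x, ‖h' x‖ₑ ^ 2 ∂(measW n d Γ) ≤ ENNReal.ofReal (2 * C₁ * M) ∧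
      ∀ x, |u x| ≤ M → ‖v x‖ ≤ 2 * ‖h' x‖ := by
  have hi := hg.inH
  have hC1 : 0 < C₁ := lt_of_lt_of_le one_pos hT.one
  let G' : ℝ → ℝ := fun s => 1 / (1 + (s / M) ^ 2)
  have hpos : ∀ s, 0 < G' s := fun s => by simp only [G']; positivity
  have hle1 : ∀ s, G' s ≤ 1 := fun s => by
    simp only [G']; rw [div_le_one (by positivity)]; nlinarith [sq_nonneg (s / M)]
  have hc : InH n d Γ (fun x => M * Real.arctan (u x / M)) (fun x => G' (u x) • v x) := by
    refine hi.comp h (G := fun s => M * Real.arctan (s / M)) (G' := G') (L := 1) (fun s => ?_)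
      (continuous_const.div (by fun_prop) fun s => by positivity)
      (fun s => by rw [abs_of_pos (hpos s)]; exact hle1 s) (by simp)
    have := (((hasDerivAt_id' s).div_const M).arctan).const_mul M
    refine this.congr_deriv ?_
    simp only [G']; field_simp
  refine ⟨_, hc, ?_, fun x hx => ?_⟩
  · have e := hg.eq _ _ hc
    rw [lint_of_int hc.2.1]
    refine ENNReal.ofReal_le_ofReal ?_
    have hle : ∫ x, inner ℝ (T x (v x)) (G' (u x) • v x) ∂(measW n d Γ) ≤ 2 * M := by
      rw [e]
      refine (le_abs_self _).trans ?_
      rw [abs_mul, abs_of_nonneg (by positivity)]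
      rcases eq_or_ne ((measW n d Γ).real (ball y ρ)) 0 with h0 | h0
      · rw [h0]; simp; positivity
      have ht : measW n d Γ (ball y ρ) < ⊤ := by
        rw [lt_top_iff_ne_top]; intro ht; exact h0 (by simp [Measure.real, ht])
      have : ‖∫ x in ball y ρ, M * Real.arctan (u x / M) ∂(measW n d Γ)‖ ≤
          2 * M * (measW n d Γ).real (ball y ρ) := by
        refine norm_setIntegral_le_of_norm_le_const ht fun x _ => ?_
        rw [norm_mul, Real.norm_of_nonneg hM.le, mul_comm]
        gcongr
        rw [Real.norm_eq_abs, abs_le]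
        have a1 := Real.arctan_lt_pi_div_two (u x / M)
        have a2 := Real.neg_pi_div_two_lt_arctan (u x / M)
        have := Real.pi_le_four
        constructor <;> linarith
      rw [inv_mul_le_iff₀ (lt_of_le_of_ne (by positivity) h0.symm), ← Real.norm_eq_abs]; linarith
    calc ∫ x, ‖G' (u x) • v x‖ ^ 2 ∂(measW n d Γ) ≤
        ∫ x, C₁ * inner ℝ (T x (v x)) (G' (u x) • v x) ∂(measW n d Γ) := by
          refine integral_mono_ae (hc.2.1.integrable_norm_pow (by norm_num))
            ((inner_int (hT.memLp_T hi.2.1) hc.2.1).const_mul _) ?_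
          filter_upwards [h.m_notMem] with x hx
          have := hT.lo x hx (v x)
          rw [inv_mul_le_iff₀ hC1] at this
          rw [inner_smul_right, norm_smul, Real.norm_of_nonneg (hpos _).le]
          have h1 := hpos (u x)
          have h2 := hle1 (u x)
          calc (G' (u x) * ‖v x‖) ^ 2 = G' (u x) * (G' (u x) * ‖v x‖ ^ 2) := by ring
            _ ≤ 1 * (G' (u x) * ‖v x‖ ^ 2) := by gcongr
            _ ≤ 1 * (G' (u x) * (C₁ * inner ℝ (T x (v x)) (v x))) := by gcongr
            _ = _ := by ring
      _ ≤ C₁ * (2 * M) := by rw [integral_const_mul]; gcongr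
      _ = _ := by ring
  · rw [norm_smul, Real.norm_of_nonneg (hpos _).le]
    have : 1 / 2 ≤ G' (u x) := by
      simp only [G']
      have : (u x / M) ^ 2 ≤ 1 := by
        rw [div_pow, div_le_one (by positivity)]; exact sq_le_sq' (by linarith [abs_le.1 hx]) (abs_le.1 hx).2
      rw [div_le_div_iff₀ (by norm_num) (by positivity)]; linarith
    nlinarith [norm_nonneg (v x)]
end
end
noncomputable section
section
variable {n : ℕ} {d C₀ C₁ : ℝ} {Γ : Set (Euc n)} {T : Euc n → Euc n →L[ℝ] Euc n}
  {y : Euc n} {ρ : ℝ} {u : Euc n → ℝ} {v : Euc n → Euc n}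
lemma Gr.cacc0 (h : Cx n d C₀ Γ) (hT : El n d Γ T C₁) (hg : Gr n d Γ T y ρ u v) {η : Euc n → ℝ}
    (hη : ContDiff ℝ 1 η) {L : ℝ} (h1 : ∀ x, |η x| ≤ L) (h2 : ∀ x, ‖gradient η x‖ * infDist x Γ ≤ L)
    (h0 : ∀ x ∈ ball y ρ, η x = 0) {a τ : ℝ} (ha : 0 ≤ a) (hτ : 0 < τ) :
    ∃ v', InH n d Γ (fun x => η x * (τ * pf ((u x - a) / τ))) v' ∧
      ∫⁻ x, ‖v' x‖ₑ ^ 2 ∂(measW n d Γ) ≤ ENNReal.ofReal (2 * (4 * C₁ ^ 4 + 1)) *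
        ∫⁻ x, ‖max (u x - a) 0 • gradient η x‖ₑ ^ 2 ∂(measW n d Γ) := by
  have hi := hg.inH
  have hC1 : 0 < C₁ := lt_of_lt_of_le one_pos hT.one
  have hneg : (0 - a) / τ ≤ 0 := div_nonpos_of_nonpos_of_nonneg (by linarith) hτ.le
  have hlin : ∀ s, HasDerivAt (fun s : ℝ => (s - a) / τ) (1 / τ) s := fun s =>
    ((hasDerivAt_id' s).sub_const a).div_const τ
  have hcl : Continuous fun s : ℝ => (s - a) / τ := by fun_prop
  have iP : InH n d Γ (fun x => τ * pf ((u x - a) / τ)) (fun x => p1 ((u x - a) / τ) • v x) := by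
    refine hi.comp h (G := fun s => τ * pf ((s - a) / τ)) (G' := fun s => p1 ((s - a) / τ)) (L := 1)
      (fun s => ?_) (p1_cont.comp hcl) (fun s => p1_abs _) (by simp only [pf_neg hneg, mul_zero])
    refine (((pf_deriv _).comp s (hlin s)).const_mul τ).congr_deriv ?_
    field_simp
  have iG : InH n d Γ (fun x => τ * (pf ((u x - a) / τ) * p1 ((u x - a) / τ)))
      (fun x => p2 ((u x - a) / τ) • v x) := by
    refine hi.comp h (G := fun s => τ * (pf ((s - a) / τ) * p1 ((s - a) / τ)))
      (G' := fun s => p2 ((s - a) / τ)) (L := 3)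
      (fun s => ?_) (p2_cont.comp hcl) (fun s => p2_le _) (by simp only [pf_neg hneg, mul_zero, zero_mul])
    refine (((pp_deriv _).comp s (hlin s)).const_mul τ).congr_deriv ?_
    field_simp
  have i1 := iP.mul h hη h1 h2
  have i2 := (iG.mul h hη h1 h2).mul h hη h1 h2
  refine ⟨_, i1, ?_⟩
  have e := hg.eq _ _ i2
  rw [setIntegral_congr_fun (g := fun _ => 0) measurableSet_ball (fun x hx => by simp [h0 x hx])] at e
  simp only [integral_zero, mul_zero] at e
  have mb : MemLp (fun x => (τ * pf ((u x - a) / τ)) • gradient η x) 2 (measW n d Γ) := by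
    have m1 : MemLp (fun x => η x • p1 ((u x - a) / τ) • v x) 2 (measW n d Γ) := by
      refine iP.2.1.of_le_mul (c := L) (hη.continuous.aestronglyMeasurable.smul iP.2.1.1)
        (ae_of_all _ fun x => ?_)
      rw [norm_smul]; gcongr; exact h1 x
    refine (i1.2.1.sub m1).ae_eq (ae_of_all _ fun x => ?_)
    simp
  rw [lint_of_int i1.2.1]
  have hpt : ∫ x, ‖η x • p1 ((u x - a) / τ) • v x + (τ * pf ((u x - a) / τ)) • gradient η x‖ ^ 2
      ∂(measW n d Γ) ≤ 2 * (4 * C₁ ^ 4 + 1) * ∫ x, ‖(τ * pf ((u x - a) / τ)) • gradient η x‖ ^ 2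
        ∂(measW n d Γ) := by
    have hI := inner_int (hT.memLp_T hi.2.1) i2.2.1
    have hb := mb.integrable_norm_pow (by norm_num)
    have := integral_mono_ae (i1.2.1.integrable_norm_pow (by norm_num))
      ((hI.const_mul (4 * C₁)).add (hb.const_mul (2 * (4 * C₁ ^ 4 + 1)))) ?_
    · refine this.trans (le_of_eq ?_)
      simp only [Pi.add_apply]
      rw [integral_add (hI.const_mul _) (hb.const_mul _), integral_const_mul, integral_const_mul, e]
      simp
    · filter_upwards [h.m_notMem] with x hx
      simp only [Pi.add_apply]
      set t := p1 ((u x - a) / τ)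
      set P := pf ((u x - a) / τ)
      have ht : 0 ≤ t := p1_nonneg _
      have hP : 0 ≤ P := pf_nonneg _
      have hlo := hT.lo x hx (v x)
      have hbd : |inner ℝ (T x (v x)) (gradient η x)| ≤ C₁ * ‖v x‖ * ‖gradient η x‖ := by
        refine (abs_real_inner_le_norm _ _).trans ?_
        gcongr
        exact ((T x).le_opNorm _).trans (by gcongr; exact hT.bd x)
      set A := |η x| * t * ‖v x‖ with hA
      set B := τ * P * ‖gradient η x‖ with hB
      have hn : ‖η x • t • v x + (τ * P) • gradient η x‖ ≤ A + B := by
        refine (norm_add_le _ _).trans (le_of_eq ?_)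
        rw [norm_smul, norm_smul, norm_smul, Real.norm_of_nonneg ht,
          Real.norm_of_nonneg (by positivity : 0 ≤ τ * P), Real.norm_eq_abs (η x), hA, hB]; ring
      have hn2 : ‖η x • t • v x + (τ * P) • gradient η x‖ ^ 2 ≤ 2 * A ^ 2 + 2 * B ^ 2 := by
        have := pow_le_pow_left₀ (norm_nonneg _) hn 2
        nlinarith [sq_nonneg (A - B)]
      have hin : C₁⁻¹ * A ^ 2 - 2 * C₁ * (A * B) ≤ inner ℝ (T x (v x))
          (η x • (η x • p2 ((u x - a) / τ) • v x + (τ * (P * t)) • gradient η x) +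
            (η x * (τ * (P * t))) • gradient η x) := by
        simp only [inner_add_right, inner_smul_right]
        have q1 : C₁⁻¹ * A ^ 2 ≤ η x * (η x * (p2 ((u x - a) / τ) * inner ℝ (T x (v x)) (v x))) := by
          have hp2 := p2_ge ((u x - a) / τ)
          have hp20 : 0 ≤ p2 ((u x - a) / τ) := (sq_nonneg _).trans hp2
          have hin0 : 0 ≤ inner ℝ (T x (v x)) (v x) := le_trans (by positivity) hlo
          calc C₁⁻¹ * A ^ 2 = (η x) ^ 2 * (t ^ 2 * (C₁⁻¹ * ‖v x‖ ^ 2)) := by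
                rw [hA, mul_pow, mul_pow, sq_abs]; ring
            _ ≤ (η x) ^ 2 * (p2 ((u x - a) / τ) * inner ℝ (T x (v x)) (v x)) := by gcongr
            _ = _ := by ring
        have q2 : |η x * (τ * (P * t)) * inner ℝ (T x (v x)) (gradient η x)| ≤ C₁ * (A * B) := by
          rw [abs_mul, abs_mul, abs_of_nonneg (by positivity : 0 ≤ τ * (P * t))]
          calc _ ≤ |η x| * (τ * (P * t)) * (C₁ * ‖v x‖ * ‖gradient η x‖) := by gcongr
            _ = _ := by rw [hA, hB]; ring
        have q3 := (abs_le.1 q2).1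
        nlinarith
      have hbn : ‖(τ * P) • gradient η x‖ ^ 2 = B ^ 2 := by
        rw [norm_smul, Real.norm_of_nonneg (by positivity)]
      rw [hbn]
      have h4 : 4 * C₁ * (C₁⁻¹ * A ^ 2 - 2 * C₁ * (A * B)) = 4 * A ^ 2 - 8 * C₁ ^ 2 * (A * B) := by
        field_simp
        ring
      have h5 := mul_le_mul_of_nonneg_left hin (by positivity : 0 ≤ 4 * C₁)
      rw [h4] at h5
      nlinarith [sq_nonneg (A - 2 * C₁ ^ 2 * B)]
  refine (ENNReal.ofReal_le_ofReal hpt).trans ?_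
  rw [ENNReal.ofReal_mul (by positivity), ← lint_of_int mb]
  gcongr with x
  rw [enorm_smul, enorm_smul]
  gcongr
  rw [← ofReal_norm, ← ofReal_norm]
  refine ENNReal.ofReal_le_ofReal ?_
  have hp := pf_le ((u x - a) / τ)
  have hp0 := pf_nonneg ((u x - a) / τ)
  rw [Real.norm_of_nonneg (by positivity), Real.norm_of_nonneg (le_max_right _ _)]
  calc _ ≤ τ * max ((u x - a) / τ) 0 := by gcongr
    _ = max (u x - a) 0 := by
      rw [mul_max_of_nonneg _ _ hτ.le, mul_zero, mul_div_cancel₀ _ hτ.ne']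
lemma Gr.cacc (h : Cx n d C₀ Γ) (hT : El n d Γ T C₁) (hg : Gr n d Γ T y ρ u v) {η : Euc n → ℝ}
    (hη : ContDiff ℝ 1 η) {L : ℝ} (h1 : ∀ x, |η x| ≤ L) (h2 : ∀ x, ‖gradient η x‖ * infDist x Γ ≤ L)
    (h0 : ∀ x ∈ ball y ρ, η x = 0) {a : ℝ} (ha : 0 ≤ a) {c : Euc n → ℝ≥0∞} (hc : Measurable c)
    (hct : ∀ x, c x ≠ ⊤) {K : ℝ≥0∞} (hK : ∀ u v, InH n d Γ u v →
      ∫⁻ x, c x * ‖u x‖ₑ ^ 2 ∂(measW n d Γ) ≤ K * ∫⁻ x, ‖v x‖ₑ ^ 2 ∂(measW n d Γ)) :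
    ∫⁻ x, c x * ‖η x * max (u x - a) 0‖ₑ ^ 2 ∂(measW n d Γ) ≤
      K * (ENNReal.ofReal (2 * (4 * C₁ ^ 4 + 1)) *
        ∫⁻ x, ‖max (u x - a) 0 • gradient η x‖ₑ ^ 2 ∂(measW n d Γ)) := by
  have hτ : ∀ k : ℕ, (0 : ℝ) < ((k : ℝ) + 1)⁻¹ := fun k => by positivity
  choose v' hv' hle using fun k : ℕ => hg.cacc0 h hT hη h1 h2 h0 ha (hτ k)
  calc _ = ∫⁻ x, liminf (fun k : ℕ => c x * ‖η x * (((k : ℝ) + 1)⁻¹ *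
          pf ((u x - a) / ((k : ℝ) + 1)⁻¹))‖ₑ ^ 2) atTop ∂(measW n d Γ) := by
        refine lintegral_congr fun x => ?_
        refine (Tendsto.liminf_eq ?_).symm
        exact ENNReal.Tendsto.const_mul (ENNReal.Tendsto.pow
          ((pf_tendsto (u x - a)).const_mul (η x)).enorm) (Or.inr (hct x))
    _ ≤ liminf (fun k : ℕ => ∫⁻ x, c x * ‖η x * (((k : ℝ) + 1)⁻¹ *
          pf ((u x - a) / ((k : ℝ) + 1)⁻¹))‖ₑ ^ 2 ∂(measW n d Γ)) atTop := by
        refine lintegral_liminf_le' fun k => ?_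
        exact hc.aemeasurable.mul (((hv' k).meas h).enorm.pow_const 2)
    _ ≤ _ := by
        refine liminf_le_of_le (by isBoundedDefault) fun b hb => ?_
        obtain ⟨k, hk⟩ := hb.exists
        exact hk.trans ((hK _ _ (hv' k)).trans (by gcongr; exact hle k))
lemma Gr.total (h : Cx n d C₀ Γ) (hT : El n d Γ T C₁) (hg : Gr n d Γ T y ρ u v) {Λ : ℝ} (hΛ : 0 ≤ Λ)
    (hm : measW n d Γ (ball y ρ) ≠ ⊤)
    (hfk : ∫⁻ x in ball y ρ, ‖u x‖ₑ ^ 2 ∂(measW n d Γ) ≤ ENNReal.ofReal Λ * ∫⁻ x, ‖v x‖ₑ ^ 2 ∂(measW n d Γ)) :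
    ∫⁻ x, ‖v x‖ₑ ^ 2 ∂(measW n d Γ) ≤
      ENNReal.ofReal (C₁ ^ 2 * Λ * ((measW n d Γ).real (ball y ρ))⁻¹) := by
  have hi := hg.inH
  have hC1 : 0 < C₁ := lt_of_lt_of_le one_pos hT.one
  have e := hg.eq _ _ hi
  set μ := measW n d Γ
  set E := ∫ x, ‖v x‖ ^ 2 ∂μ
  have hE0 : 0 ≤ E := by positivity
  set mB := μ.real (ball y ρ)
  have hmB : 0 ≤ mB := by positivity
  have hum : AEStronglyMeasurable u (μ.restrict (ball y ρ)) := (hi.meas h).restrict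
  have hv := lint_of_int hi.2.1
  rw [hv, ← ENNReal.ofReal_mul hΛ] at hfk
  have huL : MemLp u 2 (μ.restrict (ball y ρ)) := memLp_of_lint hum (hfk.trans_lt (by finiteness))
  rw [lint_of_int huL, ENNReal.ofReal_le_ofReal_iff (by positivity)] at hfk
  rw [hv]
  refine ENNReal.ofReal_le_ofReal ?_
  have s1 : E ≤ C₁ * (mB⁻¹ * ∫ x in ball y ρ, u x ∂μ) := by
    rw [← e, ← integral_const_mul]
    refine integral_mono_ae (hi.2.1.integrable_norm_pow (by norm_num))
      ((inner_int (hT.memLp_T hi.2.1) hi.2.1).const_mul _) ?_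
    filter_upwards [h.m_notMem] with x hx
    have := hT.lo x hx (v x)
    rwa [inv_mul_le_iff₀ hC1] at this
  have : IsFiniteMeasure (μ.restrict (ball y ρ)) := ⟨by simpa using hm.lt_top⟩
  have s2 : (∫ x in ball y ρ, u x ∂μ) ^ 2 ≤ mB * ∫ x in ball y ρ, ‖u x‖ ^ 2 ∂μ := by
    have c := cs_lint (μ.restrict (ball y ρ)) (a := fun x => ‖u x‖ₑ) (b := fun _ => 1)
      hum.enorm aemeasurable_const
    simp only [mul_one, one_pow, lintegral_one, Measure.restrict_apply_univ] at c
    rw [lint_of_int huL] at c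
    have c2 := enorm_integral_le_lintegral_enorm (μ := μ.restrict (ball y ρ)) u
    have c3 := (pow_le_pow_left' c2 2).trans c
    rw [enorm_sq_real, ← ofReal_measureReal hm, ← ENNReal.ofReal_mul (by positivity),
      ENNReal.ofReal_le_ofReal_iff (by positivity)] at c3
    linarith
  rcases eq_or_lt_of_le hmB with h0 | h0
  · rw [← h0] at s1 ⊢; simpa using s1
  rcases eq_or_lt_of_le hE0 with hz | hz
  · change E ≤ _
    rw [← hz]; positivity
  have s3 : E ^ 2 ≤ (C₁ ^ 2 * Λ * mB⁻¹) * E := by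
    calc E ^ 2 ≤ (C₁ * (mB⁻¹ * ∫ x in ball y ρ, u x ∂μ)) ^ 2 := by gcongr
      _ = C₁ ^ 2 * (mB⁻¹) ^ 2 * (∫ x in ball y ρ, u x ∂μ) ^ 2 := by ring
      _ ≤ C₁ ^ 2 * (mB⁻¹) ^ 2 * (mB * (Λ * E)) := by gcongr; exact s2.trans (by gcongr)
      _ = _ := by field_simp
  change E ≤ _
  nlinarith
end
end
noncomputable section
lemma st_bound : ∃ L : ℝ, 1 ≤ L ∧ ∀ t, |deriv Real.smoothTransition t| ≤ L ∧
    ((t < 0 ∨ 1 < t) → deriv Real.smoothTransition t = 0) := by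
  have hz : ∀ t : ℝ, (t < 0 ∨ 1 < t) → deriv Real.smoothTransition t = 0 := by
    rintro t (ht | ht)
    · have : Real.smoothTransition =ᶠ[𝓝 t] fun _ => (0 : ℝ) := by
        filter_upwards [Iio_mem_nhds ht] with s hs
        exact Real.smoothTransition.zero_of_nonpos (le_of_lt hs)
      rw [this.deriv_eq]; simp
    · have : Real.smoothTransition =ᶠ[𝓝 t] fun _ => (1 : ℝ) := by
        filter_upwards [Ioi_mem_nhds ht] with s hs
        exact Real.smoothTransition.one_of_one_le (le_of_lt hs)
      rw [this.deriv_eq]; simp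
  have hc : Continuous (deriv Real.smoothTransition) :=
    (Real.smoothTransition.contDiff (n := 1)).continuous_deriv le_rfl
  obtain ⟨C, hC⟩ := (isCompact_Icc (a := (0 : ℝ)) (b := 1)).exists_bound_of_continuousOn hc.continuousOn
  refine ⟨max C 1, le_max_right _ _, fun t => ⟨?_, hz t⟩⟩
  by_cases ht : t < 0 ∨ 1 < t
  · rw [hz t ht]; simp
  · push Not at ht
    exact (hC t ⟨ht.1, ht.2⟩).trans (le_max_left _ _)
lemma cutoff : ∃ L : ℝ, 1 ≤ L ∧ ∀ (n : ℕ) (y : Euc n) (s s' : ℝ), 0 < s → s < s' →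
    ∃ η : Euc n → ℝ, ContDiff ℝ (⊤ : ℕ∞) η ∧ (∀ x, 0 ≤ η x) ∧ (∀ x, η x ≤ 1) ∧
      (∀ x, dist x y ≤ s → η x = 0) ∧ (∀ x, s' ≤ dist x y → η x = 1) ∧
      (∀ x, ‖gradient η x‖ ≤ L / (s' - s)) ∧
      (∀ x, (dist x y < s ∨ s' < dist x y) → gradient η x = 0) := by
  obtain ⟨L, hL1, hL⟩ := st_bound
  refine ⟨2 * L, by linarith, fun n y s s' hs hss => ?_⟩
  have hD : 0 < s' ^ 2 - s ^ 2 := by nlinarith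
  set f : Euc n → ℝ := fun x => (‖x - y‖ ^ 2 - s ^ 2) / (s' ^ 2 - s ^ 2) with hf
  have hfc : ContDiff ℝ (⊤ : ℕ∞) f :=
    ((((contDiff_id (E := Euc n)).sub contDiff_const).norm_sq ℝ).sub contDiff_const).div_const _
  have hfd : ∀ x, ‖gradient f x‖ ≤ 2 * ‖x - y‖ / (s' ^ 2 - s ^ 2) := by
    intro x
    have h1 : HasFDerivAt f ((s' ^ 2 - s ^ 2)⁻¹ • (2 • (innerSL ℝ (x - y)).comp (ContinuousLinearMap.id ℝ (Euc n)))) x := by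
      have := ((((hasFDerivAt_id x).sub_const y).norm_sq).sub_const (s ^ 2)).const_mul (s' ^ 2 - s ^ 2)⁻¹
      refine this.congr_of_eventuallyEq (Eventually.of_forall fun z => ?_)
      simp [hf, div_eq_inv_mul]
    rw [norm_grad, h1.fderiv, norm_smul, norm_inv, Real.norm_of_nonneg hD.le, div_eq_inv_mul]
    gcongr
    rw [two_nsmul, two_mul]
    refine (norm_add_le _ _).trans ?_
    rw [ContinuousLinearMap.comp_id, innerSL_apply_norm]
  have hg : ∀ x, gradient (fun x => Real.smoothTransition (f x)) x =
      deriv Real.smoothTransition (f x) • gradient f x := fun x =>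
    grad_comp (hfc.differentiable (by simp) x)
      (((Real.smoothTransition.contDiff (n := 1)).differentiable (by simp)) _).hasDerivAt
  have hz : ∀ x, (dist x y < s ∨ s' < dist x y) → f x < 0 ∨ 1 < f x := by
    intro x hx
    rw [dist_eq_norm] at hx
    rcases hx with hx | hx
    · left
      exact div_neg_of_neg_of_pos (by nlinarith [norm_nonneg (x - y)]) hD
    · right
      rw [hf]; simp only []
      rw [lt_div_iff₀ hD]; nlinarith [norm_nonneg (x - y)]
  refine ⟨fun x => Real.smoothTransition (f x), Real.smoothTransition.contDiff.comp hfc,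
    fun x => Real.smoothTransition.nonneg _, fun x => Real.smoothTransition.le_one _, fun x hx => ?_,
    fun x hx => ?_, fun x => ?_, fun x hx => ?_⟩
  · rw [dist_eq_norm] at hx
    exact Real.smoothTransition.zero_of_nonpos
      (div_nonpos_of_nonpos_of_nonneg (by nlinarith [norm_nonneg (x - y)]) hD.le)
  · rw [dist_eq_norm] at hx
    refine Real.smoothTransition.one_of_one_le ?_
    rw [hf]; simp only []
    rw [le_div_iff₀ hD]; nlinarith [norm_nonneg (x - y)]
  · by_cases hx : dist x y < s ∨ s' < dist x y
    · rw [hg, (hL _).2 (hz x hx), zero_smul, norm_zero]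
      have : 0 < s' - s := by linarith
      positivity
    · push Not at hx
      rw [hg, norm_smul]
      calc _ ≤ L * (2 * ‖x - y‖ / (s' ^ 2 - s ^ 2)) := by
            gcongr
            · exact (hL _).1
            · exact hfd x
        _ ≤ L * (2 * s' / (s' ^ 2 - s ^ 2)) := by
            gcongr
            rw [← dist_eq_norm]; exact hx.2
        _ ≤ L * (2 / (s' - s)) := by
            refine mul_le_mul_of_nonneg_left ?_ (by linarith)
            rw [div_le_div_iff₀ hD (by linarith)]
            nlinarith
        _ = _ := by ring
  · rw [hg, (hL _).2 (hz x hx), zero_smul]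
section
variable {n : ℕ} {d C₀ C₁ : ℝ} {Γ : Set (Euc n)} {T : Euc n → Euc n →L[ℝ] Euc n}
  {y : Euc n} {ρ : ℝ} {u : Euc n → ℝ} {v : Euc n → Euc n}
lemma cacc_ext (C₁ : ℝ) : ∃ CC : ℝ, 1 ≤ CC ∧ ∀ {n : ℕ} {d C₀ : ℝ} {Γ : Set (Euc n)}
    {T : Euc n → Euc n →L[ℝ] Euc n} {y : Euc n} {ρ : ℝ} {u : Euc n → ℝ} {v : Euc n → Euc n},
    Cx n d C₀ Γ → El n d Γ T C₁ → Gr n d Γ T y ρ u v → ∀ {s s' a : ℝ}, 0 < s → ρ ≤ s → s < s' → 0 ≤ a →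
    ∀ {c : Euc n → ℝ≥0∞}, Measurable c → (∀ x, c x ≠ ⊤) → ∀ {K : ℝ≥0∞}, (∀ u v, InH n d Γ u v →
      ∫⁻ x, c x * ‖u x‖ₑ ^ 2 ∂(measW n d Γ) ≤ K * ∫⁻ x, ‖v x‖ₑ ^ 2 ∂(measW n d Γ)) →
    ∫⁻ x in {x | s' ≤ dist x y}, c x * ‖max (u x - a) 0‖ₑ ^ 2 ∂(measW n d Γ) ≤
      K * (ENNReal.ofReal (CC * ((s' - s) ^ 2)⁻¹) *
        ∫⁻ x in {x | s ≤ dist x y ∧ dist x y ≤ s'}, ‖max (u x - a) 0‖ₑ ^ 2 ∂(measW n d Γ)) := by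
  obtain ⟨L, hL1, hL⟩ := cutoff
  refine ⟨2 * (4 * C₁ ^ 4 + 1) * L ^ 2, ?_, ?_⟩
  · have : 0 ≤ C₁ ^ 4 := by positivity
    nlinarith
  intro n d C₀ Γ T y ρ u v h hT hg s s' a hs hρ hss ha c hc hct K hK
  obtain ⟨η, e1, e2, e3, e4, e5, e6, e7⟩ := hL n y s s' hs hss
  have hss' : 0 < s' - s := by linarith
  set B := max 1 (L / (s' - s) * (infDist y Γ + s'))
  have q := hg.cacc h hT (e1.of_le (by simp)) (L := B) (fun x => ?_) (fun x => ?_) (fun x hx => ?_) ha hc hct hK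
  rotate_left
  · rw [abs_of_nonneg (e2 x)]; exact (e3 x).trans (le_max_left _ _)
  · by_cases hx : s' < dist x y
    · rw [e7 x (Or.inr hx), norm_zero, zero_mul]; positivity
    · refine le_trans ?_ (le_max_right _ _)
      have := infDist_le_infDist_add_dist (s := Γ) (x := x) (y := y)
      gcongr
      · exact infDist_nonneg
      · exact e6 x
      · push Not at hx; linarith
  · exact e4 x ((mem_ball.1 hx).le.trans hρ)
  calc _ ≤ ∫⁻ x in {x | s' ≤ dist x y}, c x * ‖η x * max (u x - a) 0‖ₑ ^ 2 ∂(measW n d Γ) := by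
        refine setLIntegral_mono_ae' (measurableSet_le measurable_const (by fun_prop)) (ae_of_all _ fun x hx => ?_)
        rw [e5 x hx, one_mul]
    _ ≤ _ := setLIntegral_le_lintegral _ _
    _ ≤ _ := q
    _ ≤ _ := by
      have hm : MeasurableSet {x : Euc n | s ≤ dist x y ∧ dist x y ≤ s'} :=
        (measurableSet_le measurable_const (measurable_id.dist measurable_const)).inter
          (measurableSet_le (measurable_id.dist measurable_const) measurable_const)
      rw [mul_assoc (2 * (4 * C₁ ^ 4 + 1)), ENNReal.ofReal_mul (by positivity : 0 ≤ 2 * (4 * C₁ ^ 4 + 1)),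
        mul_assoc (ENNReal.ofReal _)]
      gcongr K * (_ * ?_)
      rw [← lintegral_indicator hm, ← lintegral_const_mul' _ _ (by finiteness)]
      gcongr with x
      by_cases hx : x ∈ {x : Euc n | s ≤ dist x y ∧ dist x y ≤ s'}
      · rw [indicator_of_mem hx, enorm_smul, mul_pow, mul_comm]
        gcongr
        rw [← ofReal_norm, ← ENNReal.ofReal_pow (norm_nonneg _)]
        refine ENNReal.ofReal_le_ofReal ?_
        rw [← div_eq_mul_inv, ← div_pow]
        gcongr
        exact e6 x
      · rw [indicator_of_notMem hx, e7 x (by simp only [mem_setOf_eq, not_and_or, not_le] at hx; exact hx)]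
        simp
end
end
noncomputable section
structure Lc (n : ℕ) (d : ℝ) (Γ : Set (Euc n)) (y : Euc n) (R Λ w0 θ : ℝ) : Prop where
  θ0 : 0 < θ
  θ1 : θ < 1
  Λ0 : 0 < Λ
  w00 : 0 < w0
  fk : ∀ u v, InH n d Γ u v → ∀ S, MeasurableSet S → S ⊆ ball y R →
    ∫⁻ x in S, ‖u x‖ₑ ^ 2 ∂(measW n d Γ) ≤
      ENNReal.ofReal Λ * volume S ^ θ * ∫⁻ x, ‖v x‖ₑ ^ 2 ∂(measW n d Γ)
  wlo : ∀ x ∈ ball y R, x ∉ Γ → w0 ≤ weightW n d Γ x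
section
variable {n : ℕ} {d C₀ C₁ : ℝ} {Γ : Set (Euc n)} {T : Euc n → Euc n →L[ℝ] Euc n}
  {y : Euc n} {ρ R Λ w0 θ : ℝ} {u : Euc n → ℝ} {v : Euc n → Euc n}
lemma Lc.m_low (hl : Lc n d Γ y R Λ w0 θ) {S : Set (Euc n)} (hS : MeasurableSet S) (h1 : S ⊆ ball y R)
    (h2 : S ⊆ Γᶜ) : ENNReal.ofReal w0 * volume S ≤ measW n d Γ S := by
  rw [measW, withDensity_apply _ hS, ← setLIntegral_const]
  exact setLIntegral_mono_ae' hS (ae_of_all _ fun x hx => ENNReal.ofReal_le_ofReal (hl.wlo x (h1 hx) (h2 hx)))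
def ann (y : Euc n) (s R : ℝ) : Set (Euc n) := {x | s ≤ dist x y} ∩ ball y R
lemma meas_ext (y : Euc n) (s : ℝ) : MeasurableSet {x : Euc n | s ≤ dist x y} :=
  measurableSet_le measurable_const (measurable_id.dist measurable_const)
lemma meas_ann (y : Euc n) (s R : ℝ) : MeasurableSet (ann y s R) := (meas_ext y s).inter measurableSet_ball
def cc (C₁ : ℝ) : ℝ := (cacc_ext C₁).choose
lemma cc_one (C₁ : ℝ) : 1 ≤ cc C₁ := (cacc_ext C₁).choose_spec.1
lemma dg_step (h : Cx n d C₀ Γ) (hT : El n d Γ T C₁) (hg : Gr n d Γ T y ρ u v) (hu : Measurable u)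
    (hl : Lc n d Γ y R Λ w0 θ) {s s' a b : ℝ} (hs : 0 < s) (hρ : ρ ≤ s) (hss : s < s') (hR : s' < R)
    (ha : 0 ≤ a) (hab : a < b) :
    ∫⁻ x in ann y s' R, ‖max (u x - b) 0‖ₑ ^ 2 ∂(measW n d Γ) ≤
      ENNReal.ofReal (Λ * cc C₁ * ((s' - s) ^ 2)⁻¹) *
        (ENNReal.ofReal ((w0 * (b - a) ^ 2)⁻¹) * ∫⁻ x in ann y s R, ‖max (u x - a) 0‖ₑ ^ 2 ∂(measW n d Γ)) ^ θ *
        ∫⁻ x in ann y s R, ‖max (u x - a) 0‖ₑ ^ 2 ∂(measW n d Γ) := by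
  set S := ann y s' R ∩ {x | b < u x} ∩ Γᶜ
  have hSm : MeasurableSet S := ((meas_ann y s' R).inter (measurableSet_lt measurable_const hu)).inter
    h.cl.measurableSet.compl
  have hSb : S ⊆ ball y R := fun x hx => hx.1.1.2
  set Y := ∫⁻ x in ann y s R, ‖max (u x - a) 0‖ₑ ^ 2 ∂(measW n d Γ) with hY
  have q := (cacc_ext C₁).choose_spec.2 h hT hg hs hρ hss (ha.trans hab.le)
    (c := S.indicator 1) (measurable_one.indicator hSm)
    (fun x => by by_cases hx : x ∈ S <;> simp [hx]) (K := ENNReal.ofReal Λ * volume S ^ θ)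
    (fun u v huv => by
      refine le_trans (le_of_eq ?_) (hl.fk u v huv S hSm hSb)
      rw [← lintegral_indicator hSm]
      refine lintegral_congr fun x => ?_
      by_cases hx : x ∈ S <;> simp [hx])
  have hvol : volume S ≤ ENNReal.ofReal ((w0 * (b - a) ^ 2)⁻¹) * Y := by
    have hp : 0 < w0 * (b - a) ^ 2 := mul_pos hl.w00 (by have : 0 < b - a := by linarith
                                                         positivity)
    rw [ENNReal.ofReal_inv_of_pos hp, ← ENNReal.mul_le_iff_le_inv (by simpa using hp) (by finiteness),
      mul_comm w0, ENNReal.ofReal_mul (by positivity), mul_assoc]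
    calc _ ≤ ENNReal.ofReal ((b - a) ^ 2) * measW n d Γ S := by
          gcongr; exact hl.m_low hSm hSb inter_subset_right
      _ = ∫⁻ x in S, ENNReal.ofReal ((b - a) ^ 2) ∂(measW n d Γ) := (setLIntegral_const _ _).symm
      _ ≤ ∫⁻ x in S, ‖max (u x - a) 0‖ₑ ^ 2 ∂(measW n d Γ) := by
          refine setLIntegral_mono_ae' hSm (ae_of_all _ fun x hx => ?_)
          rw [enorm_sq_real]
          refine ENNReal.ofReal_le_ofReal ?_
          have hx2 : b < u x := hx.1.2
          have := le_max_left (u x - a) 0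
          have h3 : 0 < b - a := by linarith
          gcongr; linarith
      _ ≤ Y := lintegral_mono_set fun x hx => ⟨hss.le.trans hx.1.1.1, hx.1.1.2⟩
  calc _ ≤ ∫⁻ x in {x | s' ≤ dist x y}, S.indicator 1 x * ‖max (u x - b) 0‖ₑ ^ 2 ∂(measW n d Γ) := by
        rw [← lintegral_indicator (meas_ann y s' R), ← lintegral_indicator (meas_ext y s')]
        refine lintegral_mono_ae ?_
        filter_upwards [h.m_notMem] with x hx
        by_cases h1 : x ∈ ann y s' R
        · rw [indicator_of_mem h1, indicator_of_mem h1.1]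
          by_cases h2 : b < u x
          · rw [indicator_of_mem (show x ∈ S from ⟨⟨h1, h2⟩, hx⟩)]; simp
          · rw [max_eq_right (by linarith)]; simp
        · rw [indicator_of_notMem h1]; exact zero_le
    _ ≤ _ := q
    _ ≤ ENNReal.ofReal Λ * (ENNReal.ofReal ((w0 * (b - a) ^ 2)⁻¹) * Y) ^ θ *
          (ENNReal.ofReal (cc C₁ * ((s' - s) ^ 2)⁻¹) * Y) := by
        have := hl.θ0
        change _ * _ * (ENNReal.ofReal (cc C₁ * ((s' - s) ^ 2)⁻¹) * _) ≤ _
        gcongr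
        calc _ ≤ ∫⁻ x in ann y s R, ‖max (u x - b) 0‖ₑ ^ 2 ∂(measW n d Γ) :=
              lintegral_mono_set fun x hx => ⟨hx.1, mem_ball.2 (lt_of_le_of_lt hx.2 hR)⟩
          _ ≤ Y := by
              rw [hY]
              gcongr with x
              rw [Real.enorm_of_nonneg (le_max_right _ _), Real.enorm_of_nonneg (le_max_right _ _)]
              gcongr
    _ = _ := by
        rw [mul_assoc Λ, ENNReal.ofReal_mul hl.Λ0.le]; ring
lemma dg (h : Cx n d C₀ Γ) (hT : El n d Γ T C₁) (hg : Gr n d Γ T y ρ u v) (hu : Measurable u)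
    (hl : Lc n d Γ y R Λ w0 θ) {s s' t Y0 : ℝ} (hs : 0 < s) (hρ : ρ ≤ s) (hss : s < s') (hR : s' ≤ R)
    (ht : 0 < t) (hY0 : 0 < Y0)
    (hY : ∫⁻ x in ann y s R, ‖u x‖ₑ ^ 2 ∂(measW n d Γ) ≤ ENNReal.ofReal Y0)
    (hc : 16 * 16 ^ (1 / θ) * (Λ * cc C₁ * ((s' - s) ^ 2)⁻¹) * (Y0 / (w0 * t ^ 2)) ^ θ ≤ 1) :
    ∀ᵐ x ∂(measW n d Γ), s' ≤ dist x y → u x ≤ t := by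
  have hθ := hl.θ0
  have hcc : 0 < cc C₁ := lt_of_lt_of_le one_pos (cc_one C₁)
  set r : ℕ → ℝ := fun k => s' - (s' - s) / 2 ^ k with hr
  set τ : ℕ → ℝ := fun k => t - t / 2 ^ k with hτ
  set lam : ℝ := (16 ^ (1 / θ))⁻¹ with hlam
  have hlp : 0 < lam := by positivity
  have hlθ : lam ^ θ = 16⁻¹ := by
    rw [hlam, Real.inv_rpow (by positivity), ← Real.rpow_mul (by norm_num), one_div_mul_cancel hθ.ne',
      Real.rpow_one]
  have hl16 : lam ≤ 16⁻¹ := by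
    rw [hlam]
    refine inv_anti₀ (by norm_num) ?_
    calc (16 : ℝ) = 16 ^ (1 : ℝ) := (Real.rpow_one _).symm
      _ ≤ _ := Real.rpow_le_rpow_of_exponent_le (by norm_num) (by
        rw [le_div_iff₀ hθ]; linarith [hl.θ1])
  have hss' : 0 < s' - s := by linarith
  have hrd : ∀ k, r (k + 1) - r k = (s' - s) / 2 ^ (k + 1) := fun k => by
    simp only [hr, pow_succ]; field_simp; ring
  have htd : ∀ k, τ (k + 1) - τ k = t / 2 ^ (k + 1) := fun k => by
    simp only [hτ, pow_succ]; field_simp; ring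
  have hrs : ∀ k, s ≤ r k := fun k => by
    have : (s' - s) / 2 ^ k ≤ s' - s := div_le_self hss'.le (one_le_pow₀ (by norm_num))
    simp only [hr]; linarith
  have hrs' : ∀ k, r k < s' := fun k => by
    have : 0 < (s' - s) / 2 ^ k := by positivity
    simp only [hr]; linarith
  have hτ0 : ∀ k, 0 ≤ τ k := fun k => by
    have : t / 2 ^ k ≤ t := div_le_self ht.le (one_le_pow₀ (by norm_num))
    simp only [hτ]; linarith
  have hτt : ∀ k, τ k ≤ t := fun k => by
    have : 0 < t / 2 ^ k := by positivity
    simp only [hτ]; linarith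
  have hmono : ∀ k, r k < r (k + 1) := fun k => by
    have := hrd k
    have h2 : 0 < (s' - s) / 2 ^ (k + 1) := by positivity
    linarith
  have key : ∀ k, ∫⁻ x in ann y (r k) R, ‖max (u x - τ k) 0‖ₑ ^ 2 ∂(measW n d Γ) ≤
      ENNReal.ofReal (Y0 * lam ^ k) := by
    intro k
    induction k with
    | zero =>
      simp only [hr, hτ, pow_zero, div_one, mul_one, sub_self, sub_zero]
      refine le_trans ?_ hY
      rw [show s' - (s' - s) = s by ring]
      gcongr with x
      rw [Real.enorm_of_nonneg (le_max_right _ _), ← ofReal_norm, Real.norm_eq_abs]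
      exact ENNReal.ofReal_le_ofReal (max_le (le_abs_self _) (abs_nonneg _))
    | succ k ih =>
      have st := dg_step h hT hg hu hl (hs.trans_le (hrs k)) (hρ.trans (hrs k)) (hmono k)
        ((hrs' (k + 1)).trans_le hR) (hτ0 k) (b := τ (k + 1))
        (by have h2 : 0 < t / 2 ^ (k + 1) := by positivity
            have := htd k; linarith)
      refine st.trans ?_
      rw [hrd, htd]
      have hw := hl.w00
      have hΛ := hl.Λ0
      calc _ ≤ ENNReal.ofReal (Λ * cc C₁ * (((s' - s) / 2 ^ (k + 1)) ^ 2)⁻¹) *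
            (ENNReal.ofReal ((w0 * (t / 2 ^ (k + 1)) ^ 2)⁻¹) * ENNReal.ofReal (Y0 * lam ^ k)) ^ θ *
            ENNReal.ofReal (Y0 * lam ^ k) := by gcongr
        _ = ENNReal.ofReal (Λ * cc C₁ * (((s' - s) / 2 ^ (k + 1)) ^ 2)⁻¹ *
            ((w0 * (t / 2 ^ (k + 1)) ^ 2)⁻¹ * (Y0 * lam ^ k)) ^ θ * (Y0 * lam ^ k)) := by
            rw [← ENNReal.ofReal_mul (by positivity), ENNReal.ofReal_rpow_of_nonneg (by positivity) hθ.le,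
              ← ENNReal.ofReal_mul (by positivity), ← ENNReal.ofReal_mul (by positivity)]
        _ ≤ _ := by
            refine ENNReal.ofReal_le_ofReal ?_
            set P := (Y0 / (w0 * t ^ 2)) ^ θ with hP
            set X := Λ * cc C₁ * ((s' - s) ^ 2)⁻¹ with hX
            have hP0 : 0 ≤ P := by positivity
            have hX0 : 0 ≤ X := by positivity
            have e1 : Λ * cc C₁ * (((s' - s) / 2 ^ (k + 1)) ^ 2)⁻¹ = X * 4 ^ (k + 1) := by
              rw [hX, div_pow, ← pow_mul, mul_comm (k + 1) 2, pow_mul, inv_div]; norm_num; ring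
            have e2 : ((w0 * (t / 2 ^ (k + 1)) ^ 2)⁻¹ * (Y0 * lam ^ k)) ^ θ =
                (4 ^ (k + 1)) ^ θ * P * (16⁻¹) ^ k := by
              rw [hP, ← hlθ, Real.rpow_pow_comm hlp.le, ← Real.mul_rpow (by positivity) (by positivity),
                ← Real.mul_rpow (by positivity) (by positivity)]
              congr 1
              rw [div_pow, ← pow_mul, mul_comm (k + 1) 2, pow_mul]; norm_num
              field_simp
            have e3 : ((4 : ℝ) ^ (k + 1)) ^ θ ≤ 4 ^ (k + 1) := by
              conv_rhs => rw [← Real.rpow_one ((4 : ℝ) ^ (k + 1))]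
              exact Real.rpow_le_rpow_of_exponent_le (one_le_pow₀ (by norm_num)) hl.θ1.le
            have e4 : 16 * X * P ≤ lam := by
              rw [hlam, ← one_div, le_div_iff₀ (by positivity)]
              linarith
            rw [e1, e2]
            calc _ ≤ X * 4 ^ (k + 1) * (4 ^ (k + 1) * P * 16⁻¹ ^ k) * (Y0 * lam ^ k) := by gcongr
              _ = (16 * X * P) * (Y0 * lam ^ k) * ((4 * 4 * 16⁻¹) ^ k) := by
                  rw [mul_pow, mul_pow]; ring
              _ ≤ lam * (Y0 * lam ^ k) * ((4 * 4 * 16⁻¹) ^ k) := by gcongr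
              _ = _ := by norm_num; ring
  obtain ⟨K, hK⟩ := hardy_H n d C₀
  have hfin : ∀ k : ℕ, ∫⁻ x in {x | s' ≤ dist x y}, ‖(infDist x Γ)⁻¹‖ₑ ^ 2 * ‖max (u x - t) 0‖ₑ ^ 2 ∂(measW n d Γ)
      ≤ ENNReal.ofReal (K * (4 * (cc C₁ * ((s' - s) ^ 2)⁻¹) * Y0) * (4⁻¹) ^ k) := by
    intro k
    have q := (cacc_ext C₁).choose_spec.2 h hT hg (hs.trans_le (hrs k)) (hρ.trans (hrs k)) (hmono k) (hτ0 k)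
      (c := fun x => ‖(infDist x Γ)⁻¹‖ₑ ^ 2) (((continuous_infDist_pt Γ).measurable.inv).enorm.pow_const 2)
      (fun x => by finiteness) (K := K) (fun u v huv => by
        refine le_trans (le_of_eq ?_) (hK Γ h u v huv)
        refine lintegral_congr fun x => ?_
        rw [← mul_pow, ← enorm_mul, div_eq_inv_mul])
    calc _ ≤ ∫⁻ x in {x | r (k + 1) ≤ dist x y}, ‖(infDist x Γ)⁻¹‖ₑ ^ 2 * ‖max (u x - τ k) 0‖ₑ ^ 2 ∂(measW n d Γ) := by
          refine (lintegral_mono_set (t := {x | r (k + 1) ≤ dist x y}) fun x (hx : s' ≤ dist x y) => (hrs' (k + 1)).le.trans hx).trans ?_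
          gcongr with x
          rw [Real.enorm_of_nonneg (le_max_right _ _), Real.enorm_of_nonneg (le_max_right _ _)]
          gcongr
          exact hτt k
      _ ≤ _ := q
      _ ≤ K * (ENNReal.ofReal (cc C₁ * ((r (k + 1) - r k) ^ 2)⁻¹) * ENNReal.ofReal (Y0 * lam ^ k)) := by
          change _ * (ENNReal.ofReal (cc C₁ * ((r (k + 1) - r k) ^ 2)⁻¹) * _) ≤ _
          gcongr
          refine le_trans (lintegral_mono_set fun x hx => ?_) (key k)
          exact ⟨hx.1, mem_ball.2 (lt_of_le_of_lt hx.2 ((hrs' (k + 1)).trans_le hR))⟩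
      _ ≤ _ := by
          rw [← ENNReal.ofReal_coe_nnreal, ← ENNReal.ofReal_mul (by positivity), ← ENNReal.ofReal_mul (by positivity), hrd]
          refine ENNReal.ofReal_le_ofReal ?_
          rw [mul_assoc (K : ℝ)]
          gcongr (K : ℝ) * ?_
          have e1 : (((s' - s) / 2 ^ (k + 1)) ^ 2)⁻¹ = ((s' - s) ^ 2)⁻¹ * 4 ^ (k + 1) := by
            rw [div_pow, ← pow_mul, mul_comm (k + 1) 2, pow_mul, inv_div]; norm_num; ring
          rw [e1]
          calc _ = 4 * (cc C₁ * ((s' - s) ^ 2)⁻¹) * Y0 * (4 * lam) ^ k := by rw [mul_pow]; ring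
            _ ≤ _ := by
              gcongr
              linarith
  have hz : ∫⁻ x in {x | s' ≤ dist x y}, ‖(infDist x Γ)⁻¹‖ₑ ^ 2 * ‖max (u x - t) 0‖ₑ ^ 2 ∂(measW n d Γ) = 0 := by
    refine le_antisymm (ge_of_tendsto' (x := atTop) ?_ hfin) zero_le
    have := ENNReal.tendsto_ofReal ((tendsto_pow_atTop_nhds_zero_of_lt_one (r := (4⁻¹ : ℝ)) (by norm_num)
      (by norm_num)).const_mul (K * (4 * (cc C₁ * ((s' - s) ^ 2)⁻¹) * Y0)))
    simpa using this
  rw [lintegral_eq_zero_iff (by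
    exact (((continuous_infDist_pt Γ).measurable.inv).enorm.pow_const 2).mul
      (((hu.sub_const t).max measurable_const).enorm.pow_const 2)),
    EventuallyEq, ae_restrict_iff' (meas_ext y s')] at hz
  filter_upwards [hz, h.m_notMem] with x hx hxΓ hxs
  have := hx hxs
  have hd := h.dpos hxΓ
  simp only [Pi.zero_apply, mul_eq_zero, pow_eq_zero_iff, ne_eq, OfNat.ofNat_ne_zero, not_false_eq_true,
    enorm_eq_zero, inv_eq_zero, hd.ne', false_or] at this
  have h2 := le_max_left (u x - t) 0
  linarith
end
end
noncomputable section
lemma arctan_half {x : ℝ} (h0 : 0 ≤ x) (h1 : x ≤ 1) : x ≤ 2 * Real.arctan x := by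
  set z := Real.arctan x with hz
  have hz0 : 0 ≤ z := Real.arctan_nonneg.2 h0
  have hz1 : z ≤ Real.pi / 4 := by rw [← Real.arctan_one]; exact Real.arctan_mono h1
  have hpi := Real.pi_lt_d2
  have hx : x = Real.tan z := (Real.tan_arctan x).symm
  have hs := Real.sin_le hz0
  have hcos : 1 / 2 ≤ Real.cos z := by
    have := Real.one_sub_sq_div_two_le_cos (x := z)
    nlinarith
  rw [hx, Real.tan_eq_sin_div_cos, div_le_iff₀ (by linarith)]
  nlinarith
section
variable {n : ℕ} {d C₀ C₁ : ℝ} {Γ : Set (Euc n)} {T : Euc n → Euc n →L[ℝ] Euc n}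
  {y : Euc n} {ρ R Λ w0 θ r : ℝ} {u : Euc n → ℝ} {v : Euc n → Euc n}
lemma enorm_le_arctan {M a : ℝ} (hM : 0 < M) (h0 : 0 ≤ a) (h1 : a ≤ M) (c : ℝ) :
    ‖a * c‖ₑ ^ 2 ≤ 4 * ‖M * Real.arctan (a / M) * c‖ₑ ^ 2 := by
  have h := arctan_half (div_nonneg h0 hM.le) ((div_le_one hM).2 h1)
  have h2 : a ≤ 2 * (M * Real.arctan (a / M)) := by
    rw [div_le_iff₀ hM] at h; linarith
  rw [enorm_sq_real, enorm_sq_real, show (4 : ℝ≥0∞) = ENNReal.ofReal 4 by simp, ← ENNReal.ofReal_mul (by norm_num)]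
  refine ENNReal.ofReal_le_ofReal ?_
  have h3 := pow_le_pow_left₀ h0 h2 2
  have h4 := mul_le_mul_of_nonneg_right h3 (sq_nonneg c)
  nlinarith
def bb (C₁ θ Λ w0 V r : ℝ) : ℝ :=
  8 * C₁ * Λ * V ^ θ * w0⁻¹ * (16 * 16 ^ (1 / θ) * (Λ * cc C₁ * (r ^ 2)⁻¹)) ^ (1 / θ)
lemma dg_cond {X Y w t θ : ℝ} (hX : 0 < X) (hY : 0 < Y) (hw : 0 < w) (ht : 0 < t) (hθ : 0 < θ)
    (h : Y * w⁻¹ * X ^ (1 / θ) ≤ t ^ 2) : X * (Y / (w * t ^ 2)) ^ θ ≤ 1 := by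
  have h1 : Y / (w * t ^ 2) ≤ (X ^ (1 / θ))⁻¹ := by
    rw [← one_div, div_le_div_iff₀ (by positivity) (by positivity), one_mul]
    calc Y * X ^ (1 / θ) = w * (Y * w⁻¹ * X ^ (1 / θ)) := by field_simp
      _ ≤ _ := by gcongr
  calc _ ≤ X * ((X ^ (1 / θ))⁻¹) ^ θ := by gcongr
    _ = 1 := by
      rw [Real.inv_rpow (by positivity), ← Real.rpow_mul hX.le, one_div_mul_cancel hθ.ne', Real.rpow_one,
        mul_inv_cancel₀ hX.ne']
lemma sup_bd (h : Cx n d C₀ Γ) (hT : El n d Γ T C₁) (hg : Gr n d Γ T y ρ u v) (hu : Measurable u)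
    (hρ : 0 < ρ) (hr : ρ < r) (hl : Lc n d Γ y (2 * r) Λ w0 θ) :
    ∀ᵐ x ∂(measW n d Γ), 2 * r ≤ dist x y →
      u x ≤ bb C₁ θ Λ w0 (volume.real (ball y (2 * r))) r * (4 ^ (1 / θ)) ^ 2 * 2 := by
  have hθ := hl.θ0
  have hΛ := hl.Λ0
  have hw := hl.w00
  have hr0 : 0 < r := hρ.trans hr
  have hC1 : 0 < C₁ := lt_of_lt_of_le one_pos hT.one
  have hcc : 0 < cc C₁ := lt_of_lt_of_le one_pos (cc_one C₁)
  set V := volume.real (ball y (2 * r)) with hV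
  have hVp : 0 < V := by
    rw [hV, measureReal_def]
    exact ENNReal.toReal_pos (measure_ball_pos _ _ (by linarith)).ne' measure_ball_lt_top.ne
  have hVe : volume (ball y (2 * r)) ^ θ = ENNReal.ofReal (V ^ θ) := by
    rw [← ENNReal.ofReal_rpow_of_nonneg hVp.le hθ.le, hV, ofReal_measureReal measure_ball_lt_top.ne]
  set b := bb C₁ θ Λ w0 V r with hb
  set c : ℝ := 4 ^ (1 / θ) with hc
  have hbp : 0 < b := by rw [hb, bb]; positivity
  have hc1 : 1 ≤ c := Real.one_le_rpow (by norm_num) (by positivity)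
  set s : ℕ → ℝ := fun j => r + r / 2 ^ j with hs
  set M : ℕ → ℝ := fun j => b * c ^ (j + 2) * 2 ^ (2 ^ j) with hM
  have hMp : ∀ j, 0 < M j := fun j => by simp only [hM]; positivity
  have hnn := hg.nonneg h hT
  have hrs : ∀ j, r < s j := fun j => by
    have : 0 < r / 2 ^ j := by positivity
    simp only [hs]; linarith
  have hs2 : ∀ j, s j ≤ 2 * r := fun j => by
    have : r / 2 ^ j ≤ r := div_le_self hr0.le (one_le_pow₀ (by norm_num))
    simp only [hs]; linarith
  have hsd : ∀ j, s j - s (j + 1) = r / 2 ^ (j + 1) := fun j => by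
    simp only [hs, pow_succ]; field_simp; ring
  have step : ∀ j, (∀ᵐ x ∂(measW n d Γ), s (j + 1) ≤ dist x y → u x ≤ M (j + 1)) →
      ∀ᵐ x ∂(measW n d Γ), s j ≤ dist x y → u x ≤ M j := by
    intro j hj
    obtain ⟨h', i', e', -⟩ := hg.energy h hT (hMp (j + 1))
    have hsj : 0 < r / 2 ^ (j + 1) := by positivity
    refine dg h hT hg hu hl (Y0 := 8 * C₁ * Λ * V ^ θ * M (j + 1)) (s := s (j + 1)) (hr0.trans (hrs _)) (hr.trans (hrs _)).le
      (by have := hsd j; linarith) (hs2 j) (hMp j) (by have := hMp (j + 1); positivity) ?_ ?_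
    · calc _ ≤ ∫⁻ x in ann y (s (j + 1)) (2 * r), 4 * ‖M (j + 1) * Real.arctan (u x / M (j + 1))‖ₑ ^ 2 ∂(measW n d Γ) := by
            refine setLIntegral_mono_ae' (meas_ann _ _ _) ?_
            filter_upwards [hj, hnn] with x hx hx0 hxa
            have := enorm_le_arctan (hMp (j + 1)) hx0 (hx hxa.1) 1
            simpa only [mul_one] using this
        _ = 4 * ∫⁻ x in ann y (s (j + 1)) (2 * r), ‖M (j + 1) * Real.arctan (u x / M (j + 1))‖ₑ ^ 2 ∂(measW n d Γ) :=
            lintegral_const_mul' _ _ (by finiteness)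
        _ ≤ 4 * (ENNReal.ofReal Λ * volume (ball y (2 * r)) ^ θ * ENNReal.ofReal (2 * C₁ * M (j + 1))) := by
            gcongr
            refine (hl.fk _ _ i' _ (meas_ann _ _ _) inter_subset_right).trans ?_
            gcongr
            exact inter_subset_right
        _ = _ := by
            rw [hVe, show (4 : ℝ≥0∞) = ENNReal.ofReal 4 by simp, ← ENNReal.ofReal_mul hΛ.le,
              ← ENNReal.ofReal_mul (by positivity), ← ENNReal.ofReal_mul (by norm_num)]
            congr 1; ring
    · rw [hsd]
      have := hMp (j + 1)
      refine dg_cond (by positivity) (by positivity) hw (hMp j) hθ (le_of_eq ?_)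
      have e1 : 16 * 16 ^ (1 / θ) * (Λ * cc C₁ * ((r / 2 ^ (j + 1)) ^ 2)⁻¹) =
          (16 * 16 ^ (1 / θ) * (Λ * cc C₁ * (r ^ 2)⁻¹)) * 4 ^ (j + 1) := by
        rw [div_pow, ← pow_mul, mul_comm (j + 1) 2, pow_mul, inv_div]; norm_num; ring
      rw [e1, Real.mul_rpow (by positivity) (by positivity), ← Real.rpow_pow_comm (by norm_num), ← hc]
      have e2 : 8 * C₁ * Λ * V ^ θ * M (j + 1) * w0⁻¹ *
          ((16 * 16 ^ (1 / θ) * (Λ * cc C₁ * (r ^ 2)⁻¹)) ^ (1 / θ) * c ^ (j + 1)) = b * c ^ (j + 1) * M (j + 1) := by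
        rw [hb, bb]; ring
      rw [e2]
      simp only [hM]
      rw [pow_succ 2 j, pow_mul]
      ring
  obtain ⟨t, htp, ht⟩ : ∃ t, 0 < t ∧ ∀ᵐ x ∂(measW n d Γ), r ≤ dist x y → u x ≤ t := by
    have hfin : ∫⁻ x in ann y ρ (2 * r), ‖u x‖ₑ ^ 2 ∂(measW n d Γ) < ⊤ := by
      refine (hl.fk _ _ hg.inH _ (meas_ann _ _ _) inter_subset_right).trans_lt ?_
      have h1 : volume (ann y ρ (2 * r)) ^ θ ≤ volume (ball y (2 * r)) ^ θ := by
        gcongr; exact inter_subset_right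
      have h2 := MemLp.lint hg.inH.2.1
      have h3 : volume (ann y ρ (2 * r)) ^ θ < ⊤ := h1.trans_lt (by rw [hVe]; finiteness)
      exact ENNReal.mul_lt_top (ENNReal.mul_lt_top (by finiteness) h3) h2
    set Y := (∫⁻ x in ann y ρ (2 * r), ‖u x‖ₑ ^ 2 ∂(measW n d Γ)).toReal
    set Z := (Y + 1) * w0⁻¹ * (16 * 16 ^ (1 / θ) * (Λ * cc C₁ * ((r - ρ) ^ 2)⁻¹)) ^ (1 / θ) with hZ
    have hY : 0 ≤ Y := ENNReal.toReal_nonneg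
    have hrρ : 0 < r - ρ := by linarith
    have hZp : 0 < Z := by positivity
    refine ⟨√Z, by positivity, dg h hT hg hu hl (Y0 := Y + 1) hρ le_rfl hr (by linarith) (by positivity) (by positivity) ?_ ?_⟩
    · rw [← ENNReal.ofReal_toReal hfin.ne]
      exact ENNReal.ofReal_le_ofReal (by simp only [Y]; linarith)
    · exact dg_cond (by positivity) (by positivity) hw (by positivity) hθ (by rw [Real.sq_sqrt hZp.le])
  obtain ⟨J, hJ⟩ : ∃ J : ℕ, t ≤ M J := by
    obtain ⟨J, hJ⟩ := exists_nat_gt (t / b)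
    refine ⟨J, ?_⟩
    rw [div_lt_iff₀ hbp] at hJ
    have h1 : (J : ℝ) ≤ 2 ^ (2 ^ J) := by
      have : J ≤ 2 ^ (2 ^ J) := (Nat.lt_two_pow_self.trans Nat.lt_two_pow_self).le
      exact_mod_cast this
    calc t ≤ b * 1 * J := by linarith
      _ ≤ M J := by
        simp only [hM]
        gcongr
        exact one_le_pow₀ hc1
  have all : ∀ i, i ≤ J → ∀ᵐ x ∂(measW n d Γ), s (J - i) ≤ dist x y → u x ≤ M (J - i) := by
    intro i
    induction i with
    | zero =>
      intro _
      filter_upwards [ht] with x hx hxs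
      exact (hx ((hrs _).le.trans hxs)).trans hJ
    | succ i ih =>
      intro hi
      refine step _ ?_
      rw [show J - (i + 1) + 1 = J - i by omega]
      exact ih (by omega)
  have fin := all J le_rfl
  filter_upwards [fin] with x hx hxs
  have := hx (by simp [hs]; linarith)
  simpa [hM] using this
lemma ext_energy (n : ℕ) (d C₀ C₁ : ℝ) : ∃ K : ℝ, 0 < K ∧ ∀ {Γ : Set (Euc n)} {T : Euc n → Euc n →L[ℝ] Euc n}
    {y : Euc n} {ρ : ℝ} {u : Euc n → ℝ} {v : Euc n → Euc n},
    Cx n d C₀ Γ → El n d Γ T C₁ → Gr n d Γ T y ρ u v → ∀ s M, 0 < M →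
    (∀ᵐ x ∂(measW n d Γ), s ≤ dist x y → u x ≤ M) →
    ∫⁻ x in {x | s ≤ dist x y}, (‖v x‖ₑ ^ 2 + ‖u x / infDist x Γ‖ₑ ^ 2) ∂(measW n d Γ) ≤ ENNReal.ofReal (K * M) := by
  obtain ⟨K, hK⟩ := hardy_H n d C₀
  refine ⟨max (4 * (1 + K) * (2 * C₁)) 1, by positivity, fun {Γ T y ρ u v} h hT hg s M hM hb => ?_⟩
  obtain ⟨h', i', e', hv⟩ := hg.energy h hT hM
  have hC1 : 0 < C₁ := lt_of_lt_of_le one_pos hT.one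
  have hKi := hK Γ h _ _ i'
  calc _ ≤ ∫⁻ x in {x | s ≤ dist x y}, 4 * (‖h' x‖ₑ ^ 2 + ‖M * Real.arctan (u x / M) / infDist x Γ‖ₑ ^ 2) ∂(measW n d Γ) := by
        refine setLIntegral_mono_ae' (meas_ext _ _) ?_
        filter_upwards [hb, hg.nonneg h hT] with x hx hx0 hxs
        rw [mul_add]
        gcongr
        · have := hv x (by rw [abs_of_nonneg hx0]; exact hx hxs)
          rw [← ofReal_norm, ← ofReal_norm, ← ENNReal.ofReal_pow (norm_nonneg _), ← ENNReal.ofReal_pow (norm_nonneg _),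
            show (4 : ℝ≥0∞) = ENNReal.ofReal 4 by simp, ← ENNReal.ofReal_mul (by norm_num)]
          refine ENNReal.ofReal_le_ofReal ?_
          nlinarith [norm_nonneg (v x), norm_nonneg (h' x)]
        · simpa only [div_eq_mul_inv] using enorm_le_arctan hM hx0 (hx hxs) (infDist x Γ)⁻¹
    _ ≤ _ := setLIntegral_le_lintegral _ _
    _ = 4 * (∫⁻ x, ‖h' x‖ₑ ^ 2 ∂(measW n d Γ) + ∫⁻ x, ‖M * Real.arctan (u x / M) / infDist x Γ‖ₑ ^ 2 ∂(measW n d Γ)) := by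
        rw [lintegral_const_mul' _ _ (by finiteness), lintegral_add_left' (i'.2.1.1.enorm.pow_const 2)]
    _ ≤ 4 * (ENNReal.ofReal (2 * C₁ * M) + K * ENNReal.ofReal (2 * C₁ * M)) := by
        gcongr; exact hKi.trans (by gcongr)
    _ = ENNReal.ofReal (4 * (1 + K) * (2 * C₁) * M) := by
        rw [← ENNReal.ofReal_coe_nnreal, ← ENNReal.ofReal_mul (by positivity), ← ENNReal.ofReal_add (by positivity) (by positivity),
          show (4 : ℝ≥0∞) = ENNReal.ofReal 4 by simp, ← ENNReal.ofReal_mul (by norm_num)]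
        congr 1; ring
    _ ≤ _ := by
        refine ENNReal.ofReal_le_ofReal ?_
        gcongr
        exact le_max_left _ _
end
end
noncomputable section
def ex (n : ℕ) (θ : ℝ) : ℝ := (2 - n * θ) * (1 + 1 / θ)
lemma Adm.ex_nonneg {n : ℕ} {θ : ℝ} (h : Adm n θ) : 0 ≤ ex n θ := by
  have := h.pos
  have := h.le
  exact mul_nonneg (by linarith) (by positivity)
lemma ex_zero {n : ℕ} (hn : 3 ≤ n) : ex n (2 / n) = 0 := by
  have : (0 : ℝ) < n := by positivity
  rw [ex, mul_div_cancel₀ _ this.ne']; simp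
lemma exists_adm {n : ℕ} (hn : 2 ≤ n) {ε : ℝ} (hε : 0 < ε) : ∃ θ, Adm n θ ∧ ex n θ ≤ ε := by
  rcases Nat.lt_or_ge 2 n with h | h
  · exact ⟨2 / n, Or.inl ⟨h, rfl⟩, by rw [ex_zero h]; exact hε.le⟩
  · obtain rfl : n = 2 := by omega
    obtain ⟨q, hq⟩ := exists_nat_gt (6 / ε)
    have hq' : (0 : ℝ) < max (q : ℝ) 2 := by positivity
    have hq2 : (2 : ℝ) ≤ max (q : ℝ) 2 := le_max_right _ _
    have hq1 : (q : ℝ) ≤ max (q : ℝ) 2 := le_max_left _ _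
    have had : Adm 2 (1 - 1 / ((max q 2 : ℕ) : ℝ)) := Or.inr ⟨rfl, max q 2, le_max_right _ _, rfl⟩
    refine ⟨1 - 1 / ((max q 2 : ℕ) : ℝ), had, ?_⟩
    push_cast at had ⊢
    set t : ℝ := 1 / max (q : ℝ) 2
    have ht0 : 0 < t := by positivity
    have ht : t ≤ 1 / 2 := one_div_le_one_div_of_le (by norm_num) hq2
    have ht2 : 6 * t ≤ ε := by
      have : 6 / ε ≤ max (q : ℝ) 2 := hq.le.trans hq1
      rw [div_le_iff₀ hε] at this
      rw [mul_one_div, div_le_iff₀ hq']; linarith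
    have h1 : 1 / (1 - t) ≤ 2 := by rw [div_le_iff₀ (by linarith)]; linarith
    rw [ex]; push_cast
    calc (2 - 2 * (1 - t)) * (1 + 1 / (1 - t)) ≤ (2 * t) * (1 + 2) := by
          have : 2 - 2 * (1 - t) = 2 * t := by ring
          rw [this]; gcongr
      _ ≤ ε := by linarith
lemma vol_ball {n : ℕ} (y : Euc n) {r : ℝ} (hr : 0 < r) :
    volume.real (ball y r) = volume.real (ball (0 : Euc n) 1) * r ^ n := by
  rw [measureReal_def, Measure.addHaar_ball_of_pos _ _ hr, ENNReal.toReal_mul, ENNReal.toReal_ofReal (by positivity),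
    finrank_euclideanSpace, Fintype.card_fin, mul_comm, measureReal_def]
lemma vol_unit_pos (n : ℕ) : 0 < volume.real (ball (0 : Euc n) 1) :=
  ENNReal.toReal_pos (measure_ball_pos _ _ one_pos).ne' measure_ball_lt_top.ne
lemma exists_lc (d C₀ : ℝ) {n : ℕ} {θ : ℝ} (hθ : Adm n θ) : ∃ K : ℝ, 0 < K ∧ ∀ Γ, Cx n d C₀ Γ → ∀ (y : Euc n) R, 0 < R →
    Lc n d Γ y R (K * (infDist y Γ + R) ^ (2 - n * θ)) ((infDist y Γ + R) ^ (d + 1 - n)) θ := by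
  obtain ⟨K, hK⟩ := fk_H (n := n) (θ := θ) d C₀ hθ
  refine ⟨K + 1, by positivity, fun Γ h y R hR => ?_⟩
  have hD : 0 < infDist y Γ + R := by have := infDist_nonneg (s := Γ) (x := y); linarith
  refine ⟨hθ.pos, hθ.lt, by positivity, by positivity, fun u v huv S hS hSb => ?_, fun x hx hxΓ => ?_⟩
  · refine (hK Γ h u v huv y R hR S hS hSb).trans ?_
    rw [ENNReal.ofReal_mul (by positivity), add_comm R]
    gcongr
    rw [← ENNReal.ofReal_coe_nnreal]
    exact ENNReal.ofReal_le_ofReal (by linarith)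
  · have h1 := infDist_le_infDist_add_dist (s := Γ) (x := x) (y := y)
    rw [mem_ball] at hx
    exact Real.rpow_le_rpow_of_nonpos (h.dpos hxΓ) (by linarith) (by linarith [h.hdn])
section
variable {n : ℕ} {d C₀ C₁ : ℝ} {Γ : Set (Euc n)} {T : Euc n → Euc n →L[ℝ] Euc n}
  {y : Euc n} {ρ R Λ w0 θ r : ℝ} {u : Euc n → ℝ} {v : Euc n → Euc n}
def Mb (n : ℕ) (d θ δ r : ℝ) : ℝ :=
  (δ + 2 * r) ^ (n - d - 1) * ((δ + 2 * r) / r) ^ (ex n θ) * r ^ (2 - (n : ℝ))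
lemma green_bd (d C₀ : ℝ) (hC1 : 1 ≤ C₁) (hθ : Adm n θ) : ∃ C : ℝ, 0 < C ∧ ∀ (Γ : Set (Euc n)) T y ρ u v, Cx n d C₀ Γ →
    El n d Γ T C₁ → Gr n d Γ T y ρ u v → Measurable u → 0 < ρ → ∀ r, ρ < r →
    ∀ᵐ x ∂(measW n d Γ), 2 * r ≤ dist x y → u x ≤ C * Mb n d θ (infDist y Γ) r := by
  obtain ⟨K, hK0, hK⟩ := exists_lc d C₀ hθ
  have hvn := vol_unit_pos n
  have hcc : 0 < cc C₁ := lt_of_lt_of_le one_pos (cc_one C₁)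
  have hC1' : 0 < C₁ := lt_of_lt_of_le one_pos hC1
  have hθ0 := hθ.pos
  set vn := volume.real (ball (0 : Euc n) 1)
  refine ⟨8 * C₁ * K * (vn * 2 ^ n) ^ θ * (16 * 16 ^ (1 / θ) * K * cc C₁) ^ (1 / θ) * (4 ^ (1 / θ)) ^ 2 * 2,
    by positivity, fun Γ T y ρ u v h hT hg hu hρ r hr => ?_⟩
  have hr0 : 0 < r := hρ.trans hr
  have hD : 0 < infDist y Γ + 2 * r := by have := infDist_nonneg (s := Γ) (x := y); linarith
  filter_upwards [sup_bd h hT hg hu hρ hr (hK Γ h y (2 * r) (by linarith))] with x hx hxs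
  refine (hx hxs).trans (le_of_eq ?_)
  rw [vol_ball y (by linarith), bb, Mb]
  set D := infDist y Γ + 2 * r
  have e1 : (vn * (2 * r) ^ n) ^ θ = (vn * 2 ^ n) ^ θ * r ^ (n * θ) := by
    rw [mul_pow, ← mul_assoc, Real.mul_rpow (by positivity) (by positivity), ← Real.rpow_natCast_mul hr0.le]
  have e2 : (16 * 16 ^ (1 / θ) * (K * D ^ (2 - n * θ) * cc C₁ * (r ^ 2)⁻¹)) ^ (1 / θ) =
      (16 * 16 ^ (1 / θ) * K * cc C₁) ^ (1 / θ) * D ^ ((2 - n * θ) * (1 / θ)) * r ^ (-2 * (1 / θ)) := by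
    rw [Real.rpow_mul hD.le, Real.rpow_mul hr0.le, ← Real.mul_rpow (by positivity) (by positivity),
      ← Real.mul_rpow (by positivity) (by positivity)]
    congr 1
    rw [Real.rpow_neg hr0.le, Real.rpow_two]; ring
  have e3 : (D ^ (d + 1 - (n : ℝ)))⁻¹ = D ^ (n - d - 1) := by
    rw [← Real.rpow_neg hD.le]; congr 1; ring
  have e4 : (D / r) ^ (ex n θ) = D ^ (2 - n * θ) * D ^ ((2 - n * θ) * (1 / θ)) * r ^ (-ex n θ) := by
    rw [Real.div_rpow hD.le hr0.le, Real.rpow_neg hr0.le, div_eq_mul_inv, ← Real.rpow_add hD]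
    congr 2; rw [ex]; ring
  have e5 : r ^ (-ex n θ) * r ^ (2 - (n : ℝ)) = r ^ (n * θ) * r ^ (-2 * (1 / θ)) := by
    rw [← Real.rpow_add hr0, ← Real.rpow_add hr0]; congr 1; rw [ex]; field_simp; ring
  rw [e1, e2, e3, e4]
  calc _ = 8 * C₁ * K * (vn * 2 ^ n) ^ θ * (16 * 16 ^ (1 / θ) * K * cc C₁) ^ (1 / θ) * (4 ^ (1 / θ)) ^ 2 * 2 *
      (D ^ (n - d - 1) * (D ^ (2 - n * θ) * D ^ ((2 - n * θ) * (1 / θ)))) * (r ^ (n * θ) * r ^ (-2 * (1 / θ))) := by ring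
    _ = _ := by rw [← e5]; ring
lemma unif (h : Cx n d C₀ Γ) (hT : El n d Γ T C₁) (hθ : Adm n θ) (y : Euc n) (hy : y ∉ Γ) : ∃ N : ℝ, 0 < N ∧
    ∀ ρ u v, Gr n d Γ T y ρ u v → Measurable u → 0 < ρ → ρ ≤ 1 → ρ < infDist y Γ → ∀ r, 0 < r → r ≤ 1 →
    ∫⁻ x in {x | r ≤ dist x y}, (‖v x‖ₑ ^ 2 + ‖u x / infDist x Γ‖ₑ ^ 2) ∂(measW n d Γ) ≤
      ENNReal.ofReal (N * r ^ (-((n : ℝ) - 2 + ex n θ))) := by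
  obtain ⟨Cb, hCb, hb⟩ := green_bd (C₁ := C₁) d C₀ hT.one hθ
  obtain ⟨Ke, hKe, he⟩ := ext_energy n d C₀ C₁
  obtain ⟨K, hK0, hK⟩ := exists_lc d C₀ hθ
  obtain ⟨Kh, hKh⟩ := hardy_H n d C₀
  have hvn := vol_unit_pos n
  set vn := volume.real (ball (0 : Euc n) 1)
  have hC1 : 0 < C₁ := lt_of_lt_of_le one_pos hT.one
  have hdy := h.dpos hy
  have hex := hθ.ex_nonneg
  have hnd : 0 < n - d - 1 := by linarith [h.hdn]
  have hn2 : (2 : ℝ) ≤ n := by exact_mod_cast h.hn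
  set p := (n : ℝ) - 2 + ex n θ with hp
  have hp0 : 0 ≤ p := by linarith
  set D := infDist y Γ + 2
  have hD : 0 < D := by simp only [D]; linarith
  set N1 := Ke * (Cb * (D ^ (n - d - 1) * D ^ ex n θ)) with hN1
  set N2 := (1 + Kh) * (C₁ ^ 2 * (K * D ^ (2 - n * θ) * vn ^ θ) * (D ^ (n - d - 1) * vn⁻¹)) with hN2
  have hN1p : 0 < N1 := by positivity
  have hN2p : 0 < N2 := by positivity
  refine ⟨(N1 + N2) * 2 ^ p, by positivity, fun ρ u v hg hu hρ hρ1 hρd r hr hr1 => ?_⟩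
  have hr2 : 2 ^ p * r ^ (-p) = (r / 2) ^ (-p) := by
    rw [Real.div_rpow hr.le (by norm_num), Real.rpow_neg (by norm_num : (0:ℝ) ≤ 2), div_inv_eq_mul, mul_comm]
  rw [mul_assoc, hr2]
  rcases lt_or_ge ρ (r / 2) with hc | hc
  · have b1 := hb Γ T y ρ u v h hT hg hu hρ (r / 2) hc
    rw [mul_div_cancel₀ _ (two_ne_zero)] at b1
    have hr2p : 0 < r / 2 := by positivity
    have hM0 : 0 < Mb n d θ (infDist y Γ) (r / 2) := by rw [Mb]; positivity
    refine (he h hT hg r _ (by positivity) b1).trans (ENNReal.ofReal_le_ofReal ?_)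
    have hMb : Mb n d θ (infDist y Γ) (r / 2) ≤ (D ^ (n - d - 1) * D ^ ex n θ) * (r / 2) ^ (-p) := by
      rw [Mb, Real.div_rpow (by positivity) hr2p.le]
      have : (r / 2) ^ (-p) = ((r / 2) ^ ex n θ)⁻¹ * (r / 2) ^ (2 - (n : ℝ)) := by
        rw [← Real.rpow_neg hr2p.le, ← Real.rpow_add hr2p]; congr 1; rw [hp]; ring
      rw [this]
      have hle : infDist y Γ + 2 * (r / 2) ≤ D := by simp only [D]; linarith
      set Q := infDist y Γ + 2 * (r / 2) with hQ
      have hQ0 : 0 ≤ Q := by positivity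
      clear_value Q
      calc _ = Q ^ (n - d - 1) * Q ^ ex n θ * (((r / 2) ^ ex n θ)⁻¹ * (r / 2) ^ (2 - (n : ℝ))) := by
            rw [div_eq_mul_inv (Q ^ ex n θ)]; ring
        _ ≤ _ := by gcongr
    calc _ ≤ Ke * (Cb * ((D ^ (n - d - 1) * D ^ ex n θ) * (r / 2) ^ (-p))) := by gcongr
      _ = N1 * (r / 2) ^ (-p) := by rw [hN1]; ring
      _ ≤ _ := by gcongr; linarith
  · have hl := hK Γ h y ρ hρ
    have hbΓ : closedBall y ρ ⊆ Γᶜ := fun x hx hxΓ => by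
      have := infDist_le_dist_of_mem (x := y) hxΓ
      rw [mem_closedBall, dist_comm] at hx; linarith
    have hmt : measW n d Γ (ball y ρ) ≠ ⊤ :=
      ((measure_mono ball_subset_closedBall).trans_lt (h.m_compact (isCompact_closedBall y ρ) hbΓ)).ne
    have hml := hl.m_low measurableSet_ball subset_rfl (ball_subset_closedBall.trans hbΓ)
    set V := volume.real (ball y ρ) with hV
    have hVeq := vol_ball y hρ
    have hVe : volume (ball y ρ) = ENNReal.ofReal V := by rw [hV, ofReal_measureReal measure_ball_lt_top.ne]
    have hVp : 0 < V := by rw [hV, hVeq]; positivity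
    have hθ0 := hθ.pos
    have hDρ : 0 < infDist y Γ + ρ := by linarith
    have hfk := hl.fk _ _ hg.inH _ measurableSet_ball subset_rfl
    rw [hVe, ENNReal.ofReal_rpow_of_nonneg hVp.le hθ0.le, ← ENNReal.ofReal_mul (by positivity)] at hfk
    have tot := hg.total h hT (by positivity) hmt hfk
    have hmr : (infDist y Γ + ρ) ^ (d + 1 - (n : ℝ)) * V ≤ (measW n d Γ).real (ball y ρ) := by
      rw [hVe, ← ENNReal.ofReal_mul (by positivity), ← ofReal_measureReal hmt,
        ENNReal.ofReal_le_ofReal_iff (by positivity)] at hml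
      exact hml
    have hDD : infDist y Γ + ρ ≤ D := by simp only [D]; linarith
    have tot2 : C₁ ^ 2 * (K * (infDist y Γ + ρ) ^ (2 - n * θ) * V ^ θ) * ((measW n d Γ).real (ball y ρ))⁻¹ ≤
        C₁ ^ 2 * (K * D ^ (2 - n * θ) * vn ^ θ) * (D ^ (n - d - 1) * vn⁻¹) * ρ ^ (-p) := by
      calc _ ≤ C₁ ^ 2 * (K * D ^ (2 - n * θ) * V ^ θ) * ((infDist y Γ + ρ) ^ (d + 1 - (n : ℝ)) * V)⁻¹ := by
            have := hθ.le
            gcongr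
        _ = C₁ ^ 2 * (K * D ^ (2 - n * θ) * V ^ θ) * ((infDist y Γ + ρ) ^ (n - d - 1) * V⁻¹) := by
            rw [mul_inv, ← Real.rpow_neg hDρ.le]; congr 3; ring
        _ ≤ C₁ ^ 2 * (K * D ^ (2 - n * θ) * V ^ θ) * (D ^ (n - d - 1) * V⁻¹) := by gcongr
        _ = C₁ ^ 2 * (K * D ^ (2 - n * θ) * vn ^ θ) * (D ^ (n - d - 1) * vn⁻¹) * ρ ^ (n * θ - n) := by
            rw [show V = vn * ρ ^ n from hVeq, Real.mul_rpow hvn.le (by positivity), ← Real.rpow_natCast_mul hρ.le, Real.rpow_sub hρ, Real.rpow_natCast]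
            rw [mul_inv]; ring
        _ ≤ _ := by
            gcongr 1
            refine Real.rpow_le_rpow_of_exponent_ge hρ hρ1 ?_
            rw [hp, ex]
            have : 0 ≤ (2 - n * θ) * (1 / θ) := mul_nonneg (by linarith [hθ.le]) (by positivity)
            linarith
    have tot3 := tot.trans (ENNReal.ofReal_le_ofReal tot2)
    have har := hKh Γ h _ _ hg.inH
    calc _ ≤ _ := setLIntegral_le_lintegral _ _
      _ = ∫⁻ x, ‖v x‖ₑ ^ 2 ∂(measW n d Γ) + ∫⁻ x, ‖u x / infDist x Γ‖ₑ ^ 2 ∂(measW n d Γ) :=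
          lintegral_add_left' (hg.inH.2.1.1.enorm.pow_const 2) _
      _ ≤ ENNReal.ofReal (C₁ ^ 2 * (K * D ^ (2 - n * θ) * vn ^ θ) * (D ^ (n - d - 1) * vn⁻¹) * ρ ^ (-p)) +
          Kh * ENNReal.ofReal (C₁ ^ 2 * (K * D ^ (2 - n * θ) * vn ^ θ) * (D ^ (n - d - 1) * vn⁻¹) * ρ ^ (-p)) := by
          gcongr; exact har.trans (by gcongr)
      _ = ENNReal.ofReal (N2 * ρ ^ (-p)) := by
          rw [← ENNReal.ofReal_coe_nnreal, ← ENNReal.ofReal_mul (by positivity), ← ENNReal.ofReal_add (by positivity) (by positivity)]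
          congr 1; rw [hN2]; ring
      _ ≤ _ := by
          refine ENNReal.ofReal_le_ofReal ?_
          calc _ ≤ N2 * (r / 2) ^ (-p) := by
                gcongr 1
                exact Real.rpow_le_rpow_of_nonpos (by positivity) hc (by linarith)
            _ ≤ _ := by gcongr; linarith
end
end
noncomputable section
lemma nested {H : Type*} [NormedAddCommGroup H] [InnerProductSpace ℝ H] [CompleteSpace H] {K : ℕ → Set H}
    (hc : ∀ j, Convex ℝ (K j)) (ha : Antitone K) (M : ℝ) (hM : ∀ j, ∃ x ∈ K j, ‖x‖ ≤ M) :
    ∃ f, ∀ j, f ∈ closure (K j) := by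
  have h1 : ∀ j, ∃ p ∈ closure (K j), ∀ w ∈ closure (K j), ‖p‖ ^ 2 ≤ inner ℝ p w := fun j => by
    obtain ⟨x, hx, -⟩ := hM j
    obtain ⟨p, hp, he⟩ := exists_norm_eq_iInf_of_complete_convex ⟨x, subset_closure hx⟩
      isClosed_closure.isComplete (hc j).closure 0
    refine ⟨p, hp, fun w hw => ?_⟩
    have := (norm_eq_iInf_iff_real_inner_le_zero (hc j).closure hp).1 he w hw
    rw [zero_sub, inner_neg_left, inner_sub_right, real_inner_self_eq_norm_sq] at this
    linarith
  choose p hp hpw using h1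
  have hmem : ∀ i j, j ≤ i → p i ∈ closure (K j) := fun i j hij => closure_mono (ha hij) (hp i)
  have hd : ∀ i j, j ≤ i → ‖p i - p j‖ ^ 2 ≤ ‖p i‖ ^ 2 - ‖p j‖ ^ 2 := fun i j hij => by
    have := hpw j _ (hmem i j hij)
    rw [norm_sub_sq_real, real_inner_comm]; linarith
  have hmono : Monotone fun i => ‖p i‖ ^ 2 := fun j i hij => by
    have := hd i j hij
    have := sq_nonneg ‖p i - p j‖
    simp only; linarith
  have hbd : ∀ i, ‖p i‖ ≤ M := fun i => by
    obtain ⟨x, hx, hxM⟩ := hM i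
    have h1 := hpw i x (subset_closure hx)
    have h2 := real_inner_le_norm (p i) x
    rcases (norm_nonneg (p i)).eq_or_lt with h0 | h0
    · rw [← h0]; exact (norm_nonneg x).trans hxM
    · have : ‖p i‖ * ‖p i‖ ≤ ‖p i‖ * ‖x‖ := by nlinarith
      exact (le_of_mul_le_mul_left this h0).trans hxM
  have hbdd : BddAbove (range fun i => ‖p i‖ ^ 2) := ⟨M ^ 2, by
    rintro _ ⟨i, rfl⟩; exact pow_le_pow_left₀ (norm_nonneg _) (hbd i) 2⟩
  have hlim := tendsto_atTop_ciSup hmono hbdd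
  set Λ := ⨆ i, ‖p i‖ ^ 2
  have hle : ∀ i, ‖p i‖ ^ 2 ≤ Λ := le_ciSup hbdd
  have hcs : CauchySeq p := by
    refine cauchySeq_of_le_tendsto_0' (fun j => √(Λ - ‖p j‖ ^ 2)) (fun j i hij => ?_) ?_
    · rw [dist_comm, dist_eq_norm]
      exact Real.le_sqrt_of_sq_le ((hd i j hij).trans (by linarith [hle i]))
    · have := (hlim.const_sub Λ).sqrt
      simpa using this
  obtain ⟨f, hf⟩ := cauchySeq_tendsto_of_complete hcs
  exact ⟨f, fun j => isClosed_closure.mem_of_tendsto hf (eventually_atTop.2 ⟨j, fun i hi => hmem i j hi⟩)⟩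
def bj (j : ℕ) : ℝ := (1 / 2) ^ j
lemma bj_pos (j : ℕ) : 0 < bj j := by rw [bj]; positivity
lemma bj_one (j : ℕ) : bj j ≤ 1 := pow_le_one₀ (by norm_num) (by norm_num)
lemma bj_lim : Tendsto bj atTop (𝓝 0) := tendsto_pow_atTop_nhds_zero_of_lt_one (by norm_num) (by norm_num)
def me (n : ℕ) (d : ℝ) (Γ : Set (Euc n)) (y : Euc n) (e : ℝ) : Measure (Euc n) :=
  Measure.sum fun j : ℕ => ENNReal.ofReal (bj j ^ ((n : ℝ) - 2 + e)) • (measW n d Γ).restrict {x | bj j ≤ dist x y}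
section
variable {n : ℕ} {d C₀ C₁ : ℝ} {Γ : Set (Euc n)} {T : Euc n → Euc n →L[ℝ] Euc n}
  {y : Euc n} {ρ R Λ w0 θ r e s : ℝ} {u : Euc n → ℝ} {v : Euc n → Euc n}
lemma me_lint (f : Euc n → ℝ≥0∞) : ∫⁻ x, f x ∂(me n d Γ y e) =
    ∑' j, ENNReal.ofReal (bj j ^ ((n : ℝ) - 2 + e)) * ∫⁻ x in {x | bj j ≤ dist x y}, f x ∂(measW n d Γ) := by
  rw [me, lintegral_sum_measure]
  simp only [lintegral_smul_measure, smul_eq_mul]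
lemma me_le (f : Euc n → ℝ≥0∞) (j : ℕ) : ∫⁻ x in {x | bj j ≤ dist x y}, f x ∂(measW n d Γ) ≤
    ENNReal.ofReal (bj j ^ (-((n : ℝ) - 2 + e))) * ∫⁻ x, f x ∂(me n d Γ y e) := by
  rw [me_lint]
  have hb := bj_pos j
  calc _ = ENNReal.ofReal (bj j ^ (-((n : ℝ) - 2 + e))) * (ENNReal.ofReal (bj j ^ ((n : ℝ) - 2 + e)) *
      ∫⁻ x in {x | bj j ≤ dist x y}, f x ∂(measW n d Γ)) := by
        rw [← mul_assoc, ← ENNReal.ofReal_mul (by positivity), ← Real.rpow_add hb, neg_add_cancel,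
          Real.rpow_zero, ENNReal.ofReal_one, one_mul]
    _ ≤ _ := by gcongr; exact ENNReal.le_tsum j
lemma me_ac : me n d Γ y e ≪ measW n d Γ := by
  rw [me]
  refine Measure.absolutelyContinuous_sum_left fun j => ?_
  intro A hA
  rw [Measure.smul_apply, Measure.restrict_le_self.absolutelyContinuous hA, smul_zero]
lemma ac_me (hn : 2 ≤ n) {p : Euc n → Prop} (hp : ∀ᵐ x ∂(me n d Γ y e), p x) : ∀ᵐ x ∂(measW n d Γ), p x := by
  rw [me, Measure.ae_sum_iff] at hp
  have h1 : ∀ᵐ x ∂(measW n d Γ), ∀ j, bj j ≤ dist x y → p x := by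
    refine ae_all_iff.2 fun j => ?_
    have := hp j
    rw [Measure.ae_ennreal_smul_measure_iff (by have := bj_pos j; simp; positivity),
      ae_restrict_iff' (meas_ext y _)] at this
    exact this
  have : Nonempty (Fin n) := ⟨⟨0, by omega⟩⟩
  have h2 : ∀ᵐ x ∂(measW n d Γ), x ≠ y := m_ac.ae_le (Measure.ae_ne volume y)
  filter_upwards [h1, h2] with x hx hxy
  obtain ⟨j, hj⟩ := (bj_lim.eventually (gt_mem_nhds (dist_pos.2 hxy))).exists
  exact hx j hj.le
lemma me_fin {N ex' : ℝ} (hN : 0 ≤ N) (hex : ex' < e) {f : Euc n → ℝ≥0∞}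
    (hf : ∀ r, 0 < r → r ≤ 1 → ∫⁻ x in {x | r ≤ dist x y}, f x ∂(measW n d Γ) ≤
      ENNReal.ofReal (N * r ^ (-((n : ℝ) - 2 + ex')))) :
    ∫⁻ x, f x ∂(me n d Γ y e) ≤ ENNReal.ofReal (N * (1 - (1 / 2 : ℝ) ^ (e - ex'))⁻¹) := by
  rw [me_lint]
  have h1 : (1 / 2 : ℝ) ^ (e - ex') < 1 := Real.rpow_lt_one (by norm_num) (by norm_num) (by linarith)
  have hs := (hasSum_geometric_of_lt_one (r := (1 / 2 : ℝ) ^ (e - ex')) (by positivity) h1).mul_left N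
  rw [← hs.tsum_eq, ENNReal.ofReal_tsum_of_nonneg (fun j => by positivity) hs.summable]
  refine ENNReal.tsum_le_tsum fun j => ?_
  have hb := bj_pos j
  calc _ ≤ ENNReal.ofReal (bj j ^ ((n : ℝ) - 2 + e)) * ENNReal.ofReal (N * bj j ^ (-((n : ℝ) - 2 + ex'))) := by
        gcongr; exact hf _ hb (bj_one j)
    _ = _ := by
        rw [← ENNReal.ofReal_mul (by positivity)]
        congr 1
        rw [mul_left_comm, ← Real.rpow_add hb, bj, ← Real.rpow_natCast, ← Real.rpow_natCast, ← Real.rpow_mul (by norm_num),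
          ← Real.rpow_mul (by norm_num)]
        congr 2; ring
structure Ap (n : ℕ) (d : ℝ) (Γ : Set (Euc n)) (T : Euc n → Euc n →L[ℝ] Euc n) (y : Euc n) (Cb N : ℝ → ℝ) (s : ℝ)
    (u : Euc n → ℝ) (v : Euc n → Euc n) : Prop where
  inH : InH n d Γ u v
  nn : ∀ᵐ x ∂(measW n d Γ), 0 ≤ u x
  ub : ∀ θ, Adm n θ → ∀ r, s < r → ∀ᵐ x ∂(measW n d Γ), 2 * r ≤ dist x y → u x ≤ Cb θ * Mb n d θ (infDist y Γ) r
  en : ∀ θ, Adm n θ → ∀ r, 0 < r → r ≤ 1 →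
    ∫⁻ x in {x | r ≤ dist x y}, (‖v x‖ₑ ^ 2 + ‖u x / infDist x Γ‖ₑ ^ 2) ∂(measW n d Γ) ≤
      ENNReal.ofReal (N θ * r ^ (-((n : ℝ) - 2 + ex n θ)))
  eq : ∀ φ, IsTest Γ φ → ∀ ε, (∀ x ∈ ball y s, |φ x - φ y| ≤ ε) →
    |∫ x, inner ℝ (T x (v x)) (gradient φ x) ∂(measW n d Γ) - φ y| ≤ ε
variable {Cb N : ℝ → ℝ}
lemma Ap.mono (h : Ap n d Γ T y Cb N s u v) {s' : ℝ} (hs : s ≤ s') : Ap n d Γ T y Cb N s' u v :=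
  ⟨h.inH, h.nn, fun θ hθ r hr => h.ub θ hθ r (hs.trans_lt hr), h.en,
    fun φ hφ ε hε => h.eq φ hφ ε fun x hx => hε x (ball_subset_ball hs hx)⟩
lemma lc_ae {F : Type*} [NormedAddCommGroup F] [NormedSpace ℝ F] {μ : Measure (Euc n)} (f g : Lp F 2 μ) {f' g' : Euc n → F}
    (hf : f =ᵐ[μ] f') (hg : g =ᵐ[μ] g') (a b : ℝ) :
    ((a • f + b • g : Lp F 2 μ) : Euc n → F) =ᵐ[μ] fun x => a • f' x + b • g' x := by
  filter_upwards [Lp.coeFn_add (a • f) (b • g), Lp.coeFn_smul a f, Lp.coeFn_smul b g, hf, hg] with x e1 e2 e3 e4 e5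
  rw [e1, Pi.add_apply, e2, e3, Pi.smul_apply, Pi.smul_apply, e4, e5]
lemma InH.toXX (h1 : InH n d Γ u v) : ∃ X : XX n d Γ, X.fst =ᵐ[measW n d Γ] (fun t => u t / infDist t Γ) ∧
    X.snd =ᵐ[measW n d Γ] v :=
  ⟨WithLp.toLp 2 (h1.1.toLp, h1.2.1.toLp), h1.1.coeFn_toLp, h1.2.1.coeFn_toLp⟩
lemma InH.add (h : Cx n d C₀ Γ) {u' : Euc n → ℝ} {v' : Euc n → Euc n} (h1 : InH n d Γ u v) (h2 : InH n d Γ u' v') (a b : ℝ) :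
    InH n d Γ (fun x => a * u x + b * u' x) (fun x => a • v x + b • v' x) := by
  obtain ⟨X, p1, p2⟩ := h1.toXX
  obtain ⟨X', q1, q2⟩ := h2.toXX
  have hX : X ∈ HH n d Γ := (mem_HH h p1 p2).2 h1
  have hX' : X' ∈ HH n d Γ := (mem_HH h q1 q2).2 h2
  refine (mem_HH h (x := a • X + b • X') ?_ ?_).1
    ((HH n d Γ).add_mem ((HH n d Γ).smul_mem a hX) ((HH n d Γ).smul_mem b hX'))
  · rw [WithLp.add_fst, WithLp.smul_fst, WithLp.smul_fst]
    refine (lc_ae _ _ p1 q1 a b).trans (ae_of_all _ fun x => ?_)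
    simp only [smul_eq_mul]; ring
  · rw [WithLp.add_snd, WithLp.smul_snd, WithLp.smul_snd]
    exact lc_ae _ _ p2 q2 a b
lemma sq_conv {F : Type*} [NormedAddCommGroup F] [NormedSpace ℝ F] {a b : ℝ} (ha : 0 ≤ a) (hb : 0 ≤ b) (hab : a + b = 1) (x z : F) :
    ‖a • x + b • z‖ₑ ^ 2 ≤ ENNReal.ofReal a * ‖x‖ₑ ^ 2 + ENNReal.ofReal b * ‖z‖ₑ ^ 2 := by
  simp only [← ofReal_norm]
  rw [← ENNReal.ofReal_pow (norm_nonneg _), ← ENNReal.ofReal_pow (norm_nonneg _), ← ENNReal.ofReal_pow (norm_nonneg _),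
    ← ENNReal.ofReal_mul ha, ← ENNReal.ofReal_mul hb, ← ENNReal.ofReal_add (by positivity) (by positivity)]
  refine ENNReal.ofReal_le_ofReal ?_
  have h1 : ‖a • x + b • z‖ ≤ a * ‖x‖ + b * ‖z‖ := by
    refine (norm_add_le _ _).trans_eq ?_
    rw [norm_smul, norm_smul, Real.norm_of_nonneg ha, Real.norm_of_nonneg hb]
  have h2 := pow_le_pow_left₀ (norm_nonneg _) h1 2
  obtain rfl : b = 1 - a := by linarith
  nlinarith [mul_nonneg (mul_nonneg ha hb) (sq_nonneg (‖x‖ - ‖z‖))]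
lemma Ap.conv (h : Cx n d C₀ Γ) (hT : El n d Γ T C₁) {u' : Euc n → ℝ} {v' : Euc n → Euc n}
    (h1 : Ap n d Γ T y Cb N s u v) (h2 : Ap n d Γ T y Cb N s u' v') {a b : ℝ} (ha : 0 ≤ a) (hb : 0 ≤ b) (hab : a + b = 1) :
    Ap n d Γ T y Cb N s (fun x => a * u x + b * u' x) (fun x => a • v x + b • v' x) := by
  refine ⟨h1.inH.add h h2.inH a b, ?_, fun θ hθ r hr => ?_, fun θ hθ r hr hr1 => ?_, fun φ hφ ε hε => ?_⟩
  · filter_upwards [h1.nn, h2.nn] with x e1 e2; positivity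
  · filter_upwards [h1.ub θ hθ r hr, h2.ub θ hθ r hr] with x e1 e2 hx
    have := mul_le_mul_of_nonneg_left (e1 hx) ha
    have := mul_le_mul_of_nonneg_left (e2 hx) hb
    have : a * (Cb θ * Mb n d θ (infDist y Γ) r) + b * (Cb θ * Mb n d θ (infDist y Γ) r) = Cb θ * Mb n d θ (infDist y Γ) r := by
      rw [← add_mul, hab, one_mul]
    linarith
  · set E := ENNReal.ofReal (N θ * r ^ (-((n : ℝ) - 2 + ex n θ)))
    have m1 : AEMeasurable (fun x => ‖v x‖ₑ ^ 2 + ‖u x / infDist x Γ‖ₑ ^ 2) ((measW n d Γ).restrict {x | r ≤ dist x y}) :=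
      ((h1.inH.2.1.1.enorm.pow_const 2).add (h1.inH.1.1.enorm.pow_const 2)).restrict
    calc _ ≤ ∫⁻ x in {x | r ≤ dist x y}, (ENNReal.ofReal a * (‖v x‖ₑ ^ 2 + ‖u x / infDist x Γ‖ₑ ^ 2) +
            ENNReal.ofReal b * (‖v' x‖ₑ ^ 2 + ‖u' x / infDist x Γ‖ₑ ^ 2)) ∂(measW n d Γ) := by
          refine lintegral_mono fun x => ?_
          have e1 := sq_conv ha hb hab (v x) (v' x)
          have e2 := sq_conv ha hb hab (u x / infDist x Γ) (u' x / infDist x Γ)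
          have e3 : (a * u x + b * u' x) / infDist x Γ = a • (u x / infDist x Γ) + b • (u' x / infDist x Γ) := by
            simp only [smul_eq_mul]; ring
          rw [e3]
          refine (add_le_add e1 e2).trans_eq (by ring)
      _ = ENNReal.ofReal a * (∫⁻ x in {x | r ≤ dist x y}, (‖v x‖ₑ ^ 2 + ‖u x / infDist x Γ‖ₑ ^ 2) ∂(measW n d Γ)) +
            ENNReal.ofReal b * ∫⁻ x in {x | r ≤ dist x y}, (‖v' x‖ₑ ^ 2 + ‖u' x / infDist x Γ‖ₑ ^ 2) ∂(measW n d Γ) := by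
          rw [lintegral_add_left' (m1.const_mul _), lintegral_const_mul' _ _ ENNReal.ofReal_ne_top,
            lintegral_const_mul' _ _ ENNReal.ofReal_ne_top]
      _ ≤ ENNReal.ofReal a * E + ENNReal.ofReal b * E := by
          gcongr
          · exact h1.en θ hθ r hr hr1
          · exact h2.en θ hθ r hr hr1
      _ = E := by rw [← add_mul, ← ENNReal.ofReal_add ha hb, hab, ENNReal.ofReal_one, one_mul]
  · have i1 := inner_int (hT.memLp_T h1.inH.2.1) (hφ.grad h)
    have i2 := inner_int (hT.memLp_T h2.inH.2.1) (hφ.grad h)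
    have : ∫ x, inner ℝ (T x (a • v x + b • v' x)) (gradient φ x) ∂(measW n d Γ) =
        a * ∫ x, inner ℝ (T x (v x)) (gradient φ x) ∂(measW n d Γ) + b * ∫ x, inner ℝ (T x (v' x)) (gradient φ x) ∂(measW n d Γ) := by
      simp only [map_add, map_smul, inner_add_left, real_inner_smul_left]
      rw [integral_add (i1.const_mul a) (i2.const_mul b), integral_const_mul, integral_const_mul]
    rw [this]
    have e1 := abs_le.1 (h1.eq φ hφ ε hε)
    have e2 := abs_le.1 (h2.eq φ hφ ε hε)
    obtain rfl : b = 1 - a := by linarith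
    rw [abs_le]
    constructor <;> nlinarith
lemma Gr.ap (h : Cx n d C₀ Γ) (hT : El n d Γ T C₁) (hg : Gr n d Γ T y ρ u v) (hu : Measurable u) (hρ : 0 < ρ) (hρ1 : ρ ≤ 1)
    (hρd : ρ < infDist y Γ)
    (hCb : ∀ θ, Adm n θ → ∀ (Γ : Set (Euc n)) T y ρ u v, Cx n d C₀ Γ →
      El n d Γ T C₁ → Gr n d Γ T y ρ u v → Measurable u → 0 < ρ → ∀ r, ρ < r →
      ∀ᵐ x ∂(measW n d Γ), 2 * r ≤ dist x y → u x ≤ Cb θ * Mb n d θ (infDist y Γ) r)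
    (hN : ∀ θ, Adm n θ → ∀ ρ u v, Gr n d Γ T y ρ u v → Measurable u → 0 < ρ → ρ ≤ 1 → ρ < infDist y Γ → ∀ r, 0 < r → r ≤ 1 →
      ∫⁻ x in {x | r ≤ dist x y}, (‖v x‖ₑ ^ 2 + ‖u x / infDist x Γ‖ₑ ^ 2) ∂(measW n d Γ) ≤
      ENNReal.ofReal (N θ * r ^ (-((n : ℝ) - 2 + ex n θ)))) : Ap n d Γ T y Cb N ρ u v := by
  refine ⟨hg.inH, hg.nonneg h hT, fun θ hθ => hCb θ hθ Γ T y ρ u v h hT hg hu hρ,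
    fun θ hθ => hN θ hθ ρ u v hg hu hρ hρ1 hρd, fun φ hφ ε hε => ?_⟩
  rw [hg.eq _ _ (InH.of_test h hφ)]
  have hbΓ : closedBall y ρ ⊆ Γᶜ := fun x hx hxΓ => by
    have := infDist_le_dist_of_mem (x := y) hxΓ
    rw [mem_closedBall, dist_comm] at hx; linarith
  have hmt : measW n d Γ (ball y ρ) < ⊤ :=
    ((measure_mono ball_subset_closedBall).trans_lt (h.m_compact (isCompact_closedBall y ρ) hbΓ))
  have hmp : 0 < (measW n d Γ).real (ball y ρ) := by
    refine ENNReal.toReal_pos (fun h0 => ?_) hmt.ne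
    have h1 := h.ac_m (measure_eq_zero_iff_ae_notMem.1 h0)
    have h2 : volume (ball y ρ) = 0 := by
      rw [measure_eq_zero_iff_ae_notMem]
      filter_upwards [h1] with x hx hxb
      exact hx (hbΓ (ball_subset_closedBall hxb)) hxb
    exact (measure_ball_pos volume y hρ).ne' h2
  have hi : IntegrableOn φ (ball y ρ) (measW n d Γ) := by
    have : IsFiniteMeasure ((measW n d Γ).restrict (ball y ρ)) := ⟨by rwa [Measure.restrict_apply_univ]⟩
    obtain ⟨C, hC⟩ := hφ.cd.continuous.bounded_above_of_compact_support hφ.cs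
    exact Integrable.of_bound hφ.cd.continuous.aestronglyMeasurable C (ae_of_all _ hC)
  set M := (measW n d Γ).real (ball y ρ) with hM
  have e1 : ∫ x in ball y ρ, (φ x - φ y) ∂(measW n d Γ) = ∫ x in ball y ρ, φ x ∂(measW n d Γ) - M * φ y := by
    rw [integral_sub hi (integrableOn_const hmt.ne), setIntegral_const, smul_eq_mul]
  have e2 : |∫ x in ball y ρ, (φ x - φ y) ∂(measW n d Γ)| ≤ ε * M := by
    have := norm_setIntegral_le_of_norm_le_const (f := fun x => φ x - φ y) (C := ε) hmt (fun x hx => hε x hx)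
    rwa [Real.norm_eq_abs] at this
  rw [e1] at e2
  have e3 : M⁻¹ * ∫ x in ball y ρ, φ x ∂(measW n d Γ) - φ y = M⁻¹ * (∫ x in ball y ρ, φ x ∂(measW n d Γ) - M * φ y) := by
    field_simp
  rw [e3, abs_mul, abs_of_pos (inv_pos.2 hmp)]
  calc _ ≤ M⁻¹ * (ε * M) := by gcongr
    _ = ε := by field_simp
end
end
noncomputable section
section
variable {n : ℕ} {d C₀ C₁ : ℝ} {Γ : Set (Euc n)} {T : Euc n → Euc n →L[ℝ] Euc n}
  {y : Euc n} {ρ R Λ w0 θ r e s : ℝ} {u : Euc n → ℝ} {v : Euc n → Euc n} {Cb N : ℝ → ℝ}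
abbrev YY (n : ℕ) (d : ℝ) (Γ : Set (Euc n)) (y : Euc n) :=
  WithLp 2 (Lp ℝ 2 (me n d Γ y 1) × Lp (Euc n) 2 (me n d Γ y 1))
def KK (n : ℕ) (d : ℝ) (Γ : Set (Euc n)) (T : Euc n → Euc n →L[ℝ] Euc n) (y : Euc n) (Cb N : ℝ → ℝ) (j : ℕ) :
    Set (YY n d Γ y) :=
  {x | ∃ u v, Ap n d Γ T y Cb N (bj j) u v ∧ x.fst =ᵐ[me n d Γ y 1] (fun t => u t / infDist t Γ) ∧ x.snd =ᵐ[me n d Γ y 1] v}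
lemma KK_conv (h : Cx n d C₀ Γ) (hT : El n d Γ T C₁) (j : ℕ) : Convex ℝ (KK n d Γ T y Cb N j) := by
  rintro x ⟨u, v, hA, p1, p2⟩ z ⟨u', v', hA', q1, q2⟩ a b ha hb hab
  refine ⟨_, _, hA.conv h hT hA' ha hb hab, ?_, ?_⟩
  · rw [WithLp.add_fst, WithLp.smul_fst, WithLp.smul_fst]
    refine (lc_ae _ _ p1 q1 a b).trans (ae_of_all _ fun x => ?_)
    simp only [smul_eq_mul]; ring
  · rw [WithLp.add_snd, WithLp.smul_snd, WithLp.smul_snd]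
    exact lc_ae _ _ p2 q2 a b
lemma bj_anti : Antitone bj := fun _ _ hij => pow_le_pow_of_le_one (by norm_num) (by norm_num) hij
lemma YY_sq (x : YY n d Γ y) {f : Euc n → ℝ} {g : Euc n → Euc n} (h1 : x.fst =ᵐ[me n d Γ y 1] f) (h2 : x.snd =ᵐ[me n d Γ y 1] g) :
    ENNReal.ofReal (‖x‖ ^ 2) = ∫⁻ t, (‖g t‖ₑ ^ 2 + ‖f t‖ₑ ^ 2) ∂(me n d Γ y 1) := by
  have hg : AEMeasurable (fun t => ‖g t‖ₑ ^ 2) (me n d Γ y 1) :=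
    ((Lp.aestronglyMeasurable x.snd).congr h2).enorm.pow_const 2
  rw [WithLp.prod_norm_sq_eq_of_L2, ENNReal.ofReal_add (by positivity) (by positivity), lp_sq, lp_sq, lintegral_add_left' hg, add_comm]
  congr 1
  · exact lintegral_congr_ae (by filter_upwards [h2] with t ht; rw [ht])
  · exact lintegral_congr_ae (by filter_upwards [h1] with t ht; rw [ht])
lemma toYY {f : Euc n → ℝ} {g : Euc n → Euc n} (m1 : MemLp f 2 (me n d Γ y 1)) (m2 : MemLp g 2 (me n d Γ y 1)) :
    ∃ X : YY n d Γ y, X.fst =ᵐ[me n d Γ y 1] f ∧ X.snd =ᵐ[me n d Γ y 1] g :=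
  ⟨WithLp.toLp 2 (m1.toLp, m2.toLp), m1.coeFn_toLp, m2.coeFn_toLp⟩
lemma KK_mk {j : ℕ} (hn : 2 ≤ n) (hA : Ap n d Γ T y Cb N (bj j) u v) (hN : ∀ θ, 0 ≤ N θ) : ∃ x ∈ KK n d Γ T y Cb N j, ∃ M : ℝ,
    0 ≤ M ∧ M = N (exists_adm hn (ε := 1 / 2) (by norm_num)).choose * (1 - (1 / 2 : ℝ) ^ (1 / 2 : ℝ))⁻¹ ∧ ‖x‖ ≤ √ M := by
  set θ := (exists_adm hn (ε := 1 / 2) (by norm_num)).choose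
  obtain ⟨hθ, hex⟩ := (exists_adm hn (ε := 1 / 2) (by norm_num)).choose_spec
  have h1 : (1 / 2 : ℝ) ^ (1 / 2 : ℝ) < 1 := Real.rpow_lt_one (by norm_num) (by norm_num) (by norm_num)
  have hpos : 0 ≤ N θ * (1 - (1 / 2 : ℝ) ^ (1 / 2 : ℝ))⁻¹ := mul_nonneg (hN θ) (inv_nonneg.2 (by linarith))
  have hl : ∫⁻ x, (‖v x‖ₑ ^ 2 + ‖u x / infDist x Γ‖ₑ ^ 2) ∂(me n d Γ y 1) ≤
      ENNReal.ofReal (N θ * (1 - (1 / 2 : ℝ) ^ (1 / 2 : ℝ))⁻¹) := by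
    have := me_fin (n := n) (d := d) (Γ := Γ) (y := y) (e := 1) (ex' := 1 / 2) (hN θ) (by norm_num)
      (f := fun x => ‖v x‖ₑ ^ 2 + ‖u x / infDist x Γ‖ₑ ^ 2) (fun r hr hr1 => (hA.en θ hθ r hr hr1).trans
        (ENNReal.ofReal_le_ofReal (mul_le_mul_of_nonneg_left
          (Real.rpow_le_rpow_of_exponent_ge hr hr1 (by linarith)) (hN θ))))
    norm_num at this ⊢
    exact this
  have m1 : MemLp (fun x => u x / infDist x Γ) 2 (me n d Γ y 1) :=
    memLp_of_lint (hA.inH.1.1.mono_ac me_ac)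
      (((lintegral_mono fun x => le_add_self).trans hl).trans_lt ENNReal.ofReal_lt_top)
  have m2 : MemLp v 2 (me n d Γ y 1) :=
    memLp_of_lint (hA.inH.2.1.1.mono_ac me_ac)
      (((lintegral_mono fun x => le_self_add).trans hl).trans_lt ENNReal.ofReal_lt_top)
  obtain ⟨X, hX1, hX2⟩ := toYY m1 m2
  refine ⟨X, ⟨u, v, hA, hX1, hX2⟩, _, hpos, rfl, ?_⟩
  refine Real.le_sqrt_of_sq_le ?_
  rw [← YY_sq _ hX1 hX2] at hl
  exact (ENNReal.ofReal_le_ofReal_iff hpos).1 hl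
lemma exists_lim (h : Cx n d C₀ Γ) (hT : El n d Γ T C₁) (hN : ∀ θ, 0 ≤ N θ) (hA : ∀ s, 0 < s → ∃ u v, Ap n d Γ T y Cb N s u v) :
    ∃ (G : Euc n → ℝ) (V : Euc n → Euc n) (us : ℕ → Euc n → ℝ) (vs : ℕ → Euc n → Euc n), StronglyMeasurable G ∧ StronglyMeasurable V ∧
      ∀ j, Ap n d Γ T y Cb N (bj j) (us j) (vs j) ∧
      ∫⁻ x, (‖vs j x - V x‖ₑ ^ 2 + ‖us j x / infDist x Γ - G x‖ₑ ^ 2) ∂(me n d Γ y 1) ≤ ENNReal.ofReal (bj j) := by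
  obtain ⟨f, hf⟩ := nested (K := KK n d Γ T y Cb N) (KK_conv h hT)
    (fun i j hij => by
      rintro x ⟨u, v, hA, p⟩
      exact ⟨u, v, hA.mono (bj_anti hij), p⟩)
    (√(N (exists_adm h.hn (ε := 1 / 2) (by norm_num)).choose * (1 - (1 / 2 : ℝ) ^ (1 / 2 : ℝ))⁻¹))
    (fun j => by
      obtain ⟨u, v, hAj⟩ := hA _ (bj_pos j)
      obtain ⟨x, hx, M, -, rfl, hM⟩ := KK_mk h.hn hAj hN
      exact ⟨x, hx, hM⟩)
  have h2 : ∀ j, ∃ u v, Ap n d Γ T y Cb N (bj j) u v ∧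
      ∫⁻ x, (‖v x - f.snd x‖ₑ ^ 2 + ‖u x / infDist x Γ - f.fst x‖ₑ ^ 2) ∂(me n d Γ y 1) ≤ ENNReal.ofReal (bj j) := fun j => by
    obtain ⟨x, ⟨u, v, hAj, p1, p2⟩, hx⟩ := Metric.mem_closure_iff.1 (hf j) _ (bj_pos j)
    refine ⟨u, v, hAj, ?_⟩
    rw [dist_comm, dist_eq_norm] at hx
    have e1 : (x - f).fst =ᵐ[me n d Γ y 1] fun t => u t / infDist t Γ - f.fst t := by
      rw [WithLp.sub_fst]
      filter_upwards [Lp.coeFn_sub x.fst f.fst, p1] with t h1 h2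
      rw [h1, Pi.sub_apply, h2]
    have e2 : (x - f).snd =ᵐ[me n d Γ y 1] fun t => v t - f.snd t := by
      rw [WithLp.sub_snd]
      filter_upwards [Lp.coeFn_sub x.snd f.snd, p2] with t h1 h2
      rw [h1, Pi.sub_apply, h2]
    rw [← YY_sq _ e1 e2]
    refine ENNReal.ofReal_le_ofReal ?_
    have := bj_one j
    have := norm_nonneg (x - f)
    nlinarith
  choose us vs hA2 hl using h2
  exact ⟨f.fst, f.snd, us, vs, Lp.stronglyMeasurable _, Lp.stronglyMeasurable _, fun j => ⟨hA2 j, hl j⟩⟩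
end
end
noncomputable section
section
variable {n : ℕ} {d C₀ C₁ : ℝ} {Γ : Set (Euc n)} {T : Euc n → Euc n →L[ℝ] Euc n}
  {y : Euc n} {ρ R Λ w0 θ r e s : ℝ} {u : Euc n → ℝ} {v : Euc n → Euc n} {Cb N : ℝ → ℝ}
lemma Cx.vol_ac (h : Cx n d C₀ Γ) : (volume : Measure (Euc n)).restrict Γᶜ ≪ measW n d Γ := by
  intro A hA
  have h1 := h.ac_m (measure_eq_zero_iff_ae_notMem.1 hA)
  rw [measure_eq_zero_iff_ae_notMem, ae_restrict_iff' h.cl.measurableSet.compl]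
  exact h1
lemma Cx.vol_le (h : Cx n d C₀ Γ) (hR : 0 < R) {S : Set (Euc n)} (hS : MeasurableSet S) (hSb : S ⊆ ball y R) (f : Euc n → ℝ≥0∞) :
    ∫⁻ x in S ∩ Γᶜ, f x ≤ ENNReal.ofReal ((infDist y Γ + R) ^ (n - d - 1)) * ∫⁻ x in S, f x ∂(measW n d Γ) := by
  have hD : 0 < infDist y Γ + R := by have := infDist_nonneg (s := Γ) (x := y); linarith
  rw [← lintegral_indicator hS (μ := measW n d Γ), Cx.lint_m, ← lintegral_const_mul' _ _ ENNReal.ofReal_ne_top,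
    ← lintegral_indicator (hS.inter h.cl.measurableSet.compl)]
  refine lintegral_mono fun x => ?_
  by_cases hx : x ∈ S ∩ Γᶜ
  · rw [indicator_of_mem hx, indicator_of_mem hx.1, ← mul_assoc, ← ENNReal.ofReal_mul (by positivity)]
    have h1 := infDist_le_infDist_add_dist (s := Γ) (x := x) (y := y)
    have h2 := mem_ball.1 (hSb hx.1)
    have h3 := h.dpos hx.2
    have : 1 ≤ (infDist y Γ + R) ^ (n - d - 1) * weightW n d Γ x := by
      calc 1 = (infDist y Γ + R) ^ (n - d - 1) * (infDist y Γ + R) ^ (d + 1 - n) := by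
            rw [← Real.rpow_add hD]; ring_nf; simp
        _ ≤ _ := by
          gcongr
          exact Real.rpow_le_rpow_of_nonpos h3 (by linarith) (by linarith [h.hdn])
    calc f x = 1 * f x := (one_mul _).symm
      _ ≤ _ := by
        gcongr
        rw [← ENNReal.ofReal_one]; exact ENNReal.ofReal_le_ofReal this
  · rw [indicator_of_notMem hx]; exact zero_le
lemma dyad {x y : Euc n} (hxy : x ≠ y) {R : ℝ} (hR : 2 ≤ R) (hx : dist x y < R) : ∃ j, bj j ≤ dist x y ∧ dist x y < R * bj j := by
  have hex : ∃ j, bj j ≤ dist x y := by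
    obtain ⟨j, hj⟩ := (bj_lim.eventually (gt_mem_nhds (dist_pos.2 hxy))).exists
    exact ⟨j, hj.le⟩
  classical
  refine ⟨Nat.find hex, Nat.find_spec hex, ?_⟩
  rcases Nat.eq_zero_or_pos (Nat.find hex) with h0 | h0
  · rw [h0]; simpa [bj] using hx
  · have h1 := Nat.find_min hex (Nat.sub_one_lt h0.ne')
    have h2 : bj (Nat.find hex - 1) = 2 * bj (Nat.find hex) := by
      obtain ⟨k, hk⟩ := Nat.exists_eq_add_of_lt h0
      rw [hk]; simp [bj, pow_succ]; ring
    have := bj_pos (Nat.find hex)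
    rw [h2, not_le] at h1
    nlinarith
lemma lq (h : Cx n d C₀ Γ) (y : Euc n) {q : ℝ} (hq : 1 ≤ q) (hq2 : q < 2) (hc : q * ((n : ℝ) - 2 + e) < n * (2 - q)) (R : ℝ) :
    ∃ K : ℝ≥0∞, K < ⊤ ∧ ∀ F : Euc n → ℝ≥0∞, AEMeasurable F (measW n d Γ) →
      ∫⁻ x in ball y R ∩ Γᶜ, F x ^ q ≤ K * (∫⁻ x, F x ^ 2 ∂(me n d Γ y e)) ^ (q / 2) := by
  set R' := max R 2
  have hR2 : 2 ≤ R' := le_max_right _ _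
  have hR'0 : 0 < R' := by linarith
  have hRR : R ≤ R' := le_max_left _ _
  set W := (infDist y Γ + R') ^ (n - d - 1)
  have hD : 0 < infDist y Γ + R' := by have := infDist_nonneg (s := Γ) (x := y); linarith
  have hW : 0 < W := by positivity
  have hvn := vol_unit_pos n
  set vn := volume.real (ball (0 : Euc n) 1)
  set γ := n * (1 - q / 2) - ((n : ℝ) - 2 + e) * (q / 2) with hγ
  have hγ0 : 0 < γ := by rw [hγ]; nlinarith
  have h1 : (1 / 2 : ℝ) ^ γ < 1 := Real.rpow_lt_one (by norm_num) (by norm_num) hγ0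
  set K0 := W ^ (q / 2) * (vn * R' ^ n) ^ (1 - q / 2) with hK0
  have hK0p : 0 < K0 := by positivity
  have hs := (hasSum_geometric_of_lt_one (r := (1 / 2 : ℝ) ^ γ) (by positivity) h1).mul_left K0
  refine ⟨ENNReal.ofReal (∑' j : ℕ, K0 * ((1 / 2 : ℝ) ^ γ) ^ j), ENNReal.ofReal_lt_top, fun F hF => ?_⟩
  rw [ENNReal.ofReal_tsum_of_nonneg (fun j => by positivity) hs.summable, ← ENNReal.tsum_mul_right]
  set I := ∫⁻ x, F x ^ 2 ∂(me n d Γ y e)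
  let S : ℕ → Set (Euc n) := fun j => {x | bj j ≤ dist x y} ∩ ball y (R' * bj j)
  have hSm : ∀ j, MeasurableSet (S j) := fun j => (meas_ext y _).inter measurableSet_ball
  have hSb : ∀ j, S j ⊆ ball y R' := fun j x hx => by
    have := mem_ball.1 hx.2
    have := bj_one j
    rw [mem_ball]; nlinarith
  have : Nonempty (Fin n) := ⟨⟨0, by have := h.hn; omega⟩⟩
  have hsub : (ball y R ∩ Γᶜ : Set (Euc n)) ≤ᵐ[volume] ⋃ j, (S j ∩ Γᶜ) := by
    filter_upwards [Measure.ae_ne volume y] with x hxy hx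
    obtain ⟨j, hj1, hj2⟩ := dyad hxy hR2 ((mem_ball.1 hx.1).trans_le hRR)
    exact mem_iUnion.2 ⟨j, ⟨hj1, hj2⟩, hx.2⟩
  refine (lintegral_mono' (Measure.restrict_mono_ae hsub) le_rfl).trans ((lintegral_iUnion_le _ _).trans ?_)
  refine ENNReal.tsum_le_tsum fun j => ?_
  have hb := bj_pos j
  have hFm : AEMeasurable (fun x => F x ^ 2) (volume.restrict (S j ∩ Γᶜ)) :=
    ((hF.pow_const 2).mono_ac h.vol_ac).mono_measure (Measure.restrict_mono inter_subset_right le_rfl)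
  have e1 := holder_set (volume.restrict (S j ∩ Γᶜ)) hFm (t := q / 2) (by linarith) (by linarith) univ
  rw [Measure.restrict_univ, Measure.restrict_apply_univ] at e1
  have e0 : ∀ x, (F x ^ 2) ^ (q / 2) = F x ^ q := fun x => by
    rw [← ENNReal.rpow_natCast, ← ENNReal.rpow_mul]; congr 1; push_cast; ring
  simp only [e0] at e1
  have e2 : ∫⁻ x in S j ∩ Γᶜ, F x ^ 2 ≤ ENNReal.ofReal (W * bj j ^ (-((n : ℝ) - 2 + e))) * I := by
    refine (h.vol_le hR'0 (hSm j) (hSb j) _).trans ?_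
    rw [ENNReal.ofReal_mul hW.le, mul_assoc]
    gcongr
    refine le_trans ?_ (me_le _ j)
    exact lintegral_mono_set inter_subset_left
  have e3 : volume (S j ∩ Γᶜ) ≤ ENNReal.ofReal (vn * R' ^ n * bj j ^ (n : ℝ)) := by
    refine (measure_mono (inter_subset_left.trans inter_subset_right)).trans (le_of_eq ?_)
    rw [← ofReal_measureReal measure_ball_lt_top.ne, vol_ball y (by positivity), mul_pow, Real.rpow_natCast, mul_assoc]
  calc _ ≤ (ENNReal.ofReal (W * bj j ^ (-((n : ℝ) - 2 + e))) * I) ^ (q / 2) *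
        ENNReal.ofReal (vn * R' ^ n * bj j ^ (n : ℝ)) ^ (1 - q / 2) := by
        refine e1.trans ?_
        gcongr
        linarith
    _ = ENNReal.ofReal ((W * bj j ^ (-((n : ℝ) - 2 + e))) ^ (q / 2) * (vn * R' ^ n * bj j ^ (n : ℝ)) ^ (1 - q / 2)) * I ^ (q / 2) := by
        rw [ENNReal.mul_rpow_of_nonneg _ _ (by linarith), ENNReal.ofReal_rpow_of_nonneg (by positivity) (by linarith),
          ENNReal.ofReal_rpow_of_nonneg (by positivity) (by linarith), ENNReal.ofReal_mul (by positivity)]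
        ring
    _ = _ := by
        congr 2
        rw [Real.mul_rpow hW.le (by positivity), Real.mul_rpow (by positivity) (by positivity), ← Real.rpow_mul hb.le, ← Real.rpow_mul hb.le]
        have : ((1 / 2 : ℝ) ^ γ) ^ j = bj j ^ γ := by rw [bj, Real.rpow_pow_comm (by norm_num)]
        have e4 : bj j ^ γ = bj j ^ (-((n : ℝ) - 2 + e) * (q / 2)) * bj j ^ (n * (1 - q / 2)) := by
          rw [← Real.rpow_add hb]; congr 1; rw [hγ]; ring
        rw [this, e4, hK0]; ring
end
end
noncomputable section
section
variable {n : ℕ} {d C₀ C₁ : ℝ} {Γ : Set (Euc n)} {T : Euc n → Euc n →L[ℝ] Euc n}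
  {y : Euc n} {ρ R Λ w0 θ r e s : ℝ} {u : Euc n → ℝ} {v : Euc n → Euc n} {Cb N : ℝ → ℝ}
  {us : ℕ → Euc n → ℝ} {vs : ℕ → Euc n → Euc n}
lemma l1 (h : Cx n d C₀ Γ) (y : Euc n) (R : ℝ) : ∃ K : ℝ≥0∞, K < ⊤ ∧ ∀ F : Euc n → ℝ≥0∞, AEMeasurable F (measW n d Γ) →
      ∫⁻ x in ball y R ∩ Γᶜ, F x ≤ K * (∫⁻ x, F x ^ 2 ∂(me n d Γ y 1)) ^ (1 / 2 : ℝ) := by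
  have := lq (e := 1) h y (q := 1) le_rfl (by norm_num) (by linarith) R
  simpa using this
lemma me_le_m (hn : 2 ≤ n) (f : Euc n → ℝ≥0∞) : ∫⁻ x, f x ∂(me n d Γ y 1) ≤ 2 * ∫⁻ x, f x ∂(measW n d Γ) := by
  rw [me_lint]
  have hn2 : (2 : ℝ) ≤ n := by exact_mod_cast hn
  calc _ ≤ ∑' j, ENNReal.ofReal ((1 / 2) ^ j) * ∫⁻ x, f x ∂(measW n d Γ) := by
        refine ENNReal.tsum_le_tsum fun j => ?_
        gcongr
        · refine (Real.rpow_le_rpow_of_exponent_ge (bj_pos j) (bj_one j) (z := 1) (by linarith)).trans_eq (Real.rpow_one _)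
        · exact Measure.restrict_le_self
    _ = _ := by
        rw [ENNReal.tsum_mul_right, ← ENNReal.ofReal_tsum_of_nonneg (fun j => by positivity) summable_geometric_two,
          tsum_geometric_two]
        simp
structure Cv (n : ℕ) (d : ℝ) (Γ : Set (Euc n)) (y : Euc n) (us : ℕ → Euc n → ℝ) (vs : ℕ → Euc n → Euc n)
    (u : Euc n → ℝ) (v : Euc n → Euc n) : Prop where
  mus : ∀ k, AEStronglyMeasurable (us k) (measW n d Γ)
  mvs : ∀ k, AEStronglyMeasurable (vs k) (measW n d Γ)
  mu : AEStronglyMeasurable u (measW n d Γ)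
  mv : AEStronglyMeasurable v (measW n d Γ)
  fin : ∫⁻ x, (‖v x‖ₑ ^ 2 + ‖u x / infDist x Γ‖ₑ ^ 2) ∂(me n d Γ y 1) < ⊤
  lim : Tendsto (fun k => ∫⁻ x, (‖vs k x - v x‖ₑ ^ 2 + ‖(us k x - u x) / infDist x Γ‖ₑ ^ 2) ∂(me n d Γ y 1)) atTop (𝓝 0)
lemma l1u (h : Cx n d C₀ Γ) (f : Euc n → ℝ) :
    ∫⁻ x in ball y R ∩ Γᶜ, ‖f x‖ₑ ≤ ENNReal.ofReal (infDist y Γ + R) * ∫⁻ x in ball y R ∩ Γᶜ, ‖f x / infDist x Γ‖ₑ := by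
  rw [← lintegral_const_mul' _ _ ENNReal.ofReal_ne_top]
  refine setLIntegral_mono_ae' (measurableSet_ball.inter h.cl.measurableSet.compl) (ae_of_all _ fun x hx => ?_)
  have h3 := h.dpos hx.2
  have h1 := infDist_le_infDist_add_dist (s := Γ) (x := x) (y := y)
  have h2 := mem_ball.1 hx.1
  calc ‖f x‖ₑ = ‖infDist x Γ‖ₑ * ‖f x / infDist x Γ‖ₑ := by rw [← enorm_mul]; congr 1; field_simp
    _ ≤ _ := by
      gcongr
      rw [← ofReal_norm, Real.norm_of_nonneg h3.le]
      exact ENNReal.ofReal_le_ofReal (by linarith)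
lemma Cv.fins (hc : Cv n d Γ y us vs u v) (h : Cx n d C₀ Γ) (hR : 0 < R) :
    ∫⁻ x in ball y R ∩ Γᶜ, ‖u x‖ₑ < ⊤ ∧ ∫⁻ x in ball y R ∩ Γᶜ, ‖v x‖ₑ < ⊤ := by
  obtain ⟨K, hK, hl⟩ := l1 h y R
  constructor
  · refine (l1u h u).trans_lt (ENNReal.mul_lt_top ENNReal.ofReal_lt_top ((hl _ (meas_div hc.mu).enorm).trans_lt ?_))
    refine ENNReal.mul_lt_top hK (ENNReal.rpow_lt_top_of_nonneg (by norm_num) ?_)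
    exact ((lintegral_mono fun x => le_add_self).trans_lt hc.fin).ne
  · refine (hl _ hc.mv.enorm).trans_lt ?_
    refine ENNReal.mul_lt_top hK (ENNReal.rpow_lt_top_of_nonneg (by norm_num) ?_)
    exact ((lintegral_mono fun x => le_self_add).trans_lt hc.fin).ne
lemma Cv.lims (hc : Cv n d Γ y us vs u v) (h : Cx n d C₀ Γ) (hR : 0 < R) :
    Tendsto (fun k => ∫⁻ x in ball y R ∩ Γᶜ, ‖us k x - u x‖ₑ) atTop (𝓝 0) ∧
    Tendsto (fun k => ∫⁻ x in ball y R ∩ Γᶜ, ‖vs k x - v x‖ₑ) atTop (𝓝 0) := by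
  obtain ⟨K, hK, hl⟩ := l1 h y R
  have key : Tendsto (fun k => K * (∫⁻ x, (‖vs k x - v x‖ₑ ^ 2 + ‖(us k x - u x) / infDist x Γ‖ₑ ^ 2) ∂(me n d Γ y 1)) ^ (1 / 2 : ℝ))
      atTop (𝓝 0) := by
    have h1 := ENNReal.Tendsto.const_mul (a := K) ((ENNReal.continuous_rpow_const (y := 1 / 2)).continuousAt.tendsto.comp hc.lim)
      (Or.inr hK.ne)
    simpa using h1
  constructor
  · have k2 := ENNReal.Tendsto.const_mul (a := ENNReal.ofReal (infDist y Γ + R)) key (Or.inr ENNReal.ofReal_ne_top)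
    rw [mul_zero] at k2
    refine tendsto_of_tendsto_of_tendsto_of_le_of_le tendsto_const_nhds k2 (fun k => zero_le) fun k => ?_
    refine (l1u h _).trans ?_
    gcongr
    refine (hl _ (meas_div ((hc.mus k).sub hc.mu)).enorm).trans ?_
    gcongr
    exact le_add_self
  · refine tendsto_of_tendsto_of_tendsto_of_le_of_le tendsto_const_nhds key (fun k => zero_le) fun k => ?_
    refine (hl _ ((hc.mvs k).sub hc.mv).enorm).trans ?_
    gcongr
    exact le_self_add
lemma lim_gen {E E' : Type*} [NormedAddCommGroup E] [NormedSpace ℝ E] [NormedAddCommGroup E'] [NormedSpace ℝ E'] [CompleteSpace E']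
    (hΓ : IsClosed Γ) {f : ℕ → Euc n → E} {f0 : Euc n → E} {H : Euc n → E →L[ℝ] E'} {c : ℝ≥0∞} (hc : c ≠ ⊤) (hH : ∀ x, x ∉ Γ → ‖H x‖ₑ ≤ c)
    (hH0 : ∀ x, x ∉ ball y R → H x = 0)
    (hm : ∀ k, AEStronglyMeasurable (fun x => H x (f k x)) (volume.restrict Γᶜ))
    (hm0 : AEStronglyMeasurable (fun x => H x (f0 x)) (volume.restrict Γᶜ))
    (hfin : ∫⁻ x in ball y R ∩ Γᶜ, ‖f0 x‖ₑ < ⊤)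
    (hlim : Tendsto (fun k => ∫⁻ x in ball y R ∩ Γᶜ, ‖f k x - f0 x‖ₑ) atTop (𝓝 0)) :
    Tendsto (fun k => ∫ x in Γᶜ, H x (f k x)) atTop (𝓝 (∫ x in Γᶜ, H x (f0 x))) := by
  have key : ∀ g : Euc n → E, ∫⁻ x in Γᶜ, ‖H x (g x)‖ₑ ≤ c * ∫⁻ x in ball y R ∩ Γᶜ, ‖g x‖ₑ := fun g => by
    rw [← lintegral_const_mul' _ _ hc, ← lintegral_indicator hΓ.measurableSet.compl,
      ← lintegral_indicator (measurableSet_ball.inter hΓ.measurableSet.compl)]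
    refine lintegral_mono fun x => ?_
    by_cases hx : x ∈ Γᶜ
    · by_cases hb : x ∈ ball y R
      · rw [indicator_of_mem hx, indicator_of_mem (show x ∈ ball y R ∩ Γᶜ from ⟨hb, hx⟩)]
        exact ((H x).le_opENorm _).trans (by gcongr; exact hH x hx)
      · rw [indicator_of_mem hx, hH0 x hb]; simp
    · rw [indicator_of_notMem hx]; exact zero_le
  have hi0 : Integrable (fun x => H x (f0 x)) (volume.restrict Γᶜ) :=
    ⟨hm0, (key f0).trans_lt (ENNReal.mul_lt_top hc.lt_top hfin)⟩
  have hl2 : Tendsto (fun k => ∫⁻ x in Γᶜ, ‖H x (f k x) - H x (f0 x)‖ₑ) atTop (𝓝 0) := by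
    have k2 := ENNReal.Tendsto.const_mul (a := c) hlim (Or.inr hc)
    rw [mul_zero] at k2
    refine tendsto_of_tendsto_of_tendsto_of_le_of_le tendsto_const_nhds k2 (fun k => zero_le) fun k => ?_
    have := key (fun x => f k x - f0 x)
    simpa only [map_sub] using this
  refine tendsto_integral_of_L1 _ hm0 ?_ hl2
  filter_upwards [hl2.eventually (gt_mem_nhds ENNReal.zero_lt_top)] with k hk
  have : Integrable (fun x => H x (f k x) - H x (f0 x)) (volume.restrict Γᶜ) := ⟨(hm k).sub hm0, hk⟩
  exact (this.add hi0).congr (ae_of_all _ fun x => by simp)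
lemma bd_ball {φ : Euc n → ℝ} (hφ : HasCompactSupport φ) (y : Euc n) : ∃ R, 0 < R ∧ ∀ x, x ∉ ball y R → φ x = 0 ∧ gradient φ x = 0 := by
  obtain ⟨R, hR, hs⟩ := hφ.isCompact.isBounded.subset_ball_lt 0 y
  refine ⟨R, hR, fun x hx => ⟨?_, ?_⟩⟩
  · exact image_eq_zero_of_notMem_tsupport fun hh => hx (hs hh)
  · exact image_eq_zero_of_notMem_tsupport fun hh => hx (hs (grad_tsupport φ hh))
lemma Cv.wg (hc : Cv n d Γ y us vs u v) (h : Cx n d C₀ Γ) {φ : Euc n → ℝ} (hφ : ContDiff ℝ 1 φ) (hφc : HasCompactSupport φ)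
    (hk : ∀ k, ∫ x in Γᶜ, us k x • gradient φ x = - ∫ x in Γᶜ, φ x • vs k x) :
    ∫ x in Γᶜ, u x • gradient φ x = - ∫ x in Γᶜ, φ x • v x := by
  obtain ⟨R, hR, hs⟩ := bd_ball hφc y
  obtain ⟨c1, hc1⟩ := hφ.continuous.bounded_above_of_compact_support hφc
  obtain ⟨c2, hc2⟩ := (grad_cont hφ).bounded_above_of_compact_support
    (hφc.mono' ((subset_tsupport _).trans (grad_tsupport φ)))
  have L1 := lim_gen (R := R) h.cl (H := fun x => ContinuousLinearMap.toSpanSingleton ℝ (gradient φ x)) (c := ENNReal.ofReal c2)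
    ENNReal.ofReal_ne_top (fun x _ => by
      rw [← ofReal_norm, ContinuousLinearMap.norm_toSpanSingleton]; exact ENNReal.ofReal_le_ofReal (hc2 x))
    (fun x hx => by rw [(hs x hx).2]; ext; simp)
    (fun k => by
      simp only [ContinuousLinearMap.toSpanSingleton_apply]
      exact ((hc.mus k).mono_ac h.vol_ac).smul (grad_cont hφ).aestronglyMeasurable)
    (by
      simp only [ContinuousLinearMap.toSpanSingleton_apply]
      exact (hc.mu.mono_ac h.vol_ac).smul (grad_cont hφ).aestronglyMeasurable)
    (hc.fins h hR).1 (hc.lims h hR).1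
  have L2 := lim_gen (R := R) h.cl (H := fun x => φ x • ContinuousLinearMap.id ℝ (Euc n)) (c := ENNReal.ofReal c1)
    ENNReal.ofReal_ne_top (fun x _ => by
      rw [← ofReal_norm, norm_smul]
      refine ENNReal.ofReal_le_ofReal ?_
      calc _ ≤ ‖φ x‖ * 1 := by gcongr; exact ContinuousLinearMap.norm_id_le
        _ ≤ _ := by rw [mul_one]; exact hc1 x)
    (fun x hx => by ext; simp [(hs x hx).1])
    (fun k => hφ.continuous.aestronglyMeasurable.smul ((hc.mvs k).mono_ac h.vol_ac))
    (hφ.continuous.aestronglyMeasurable.smul (hc.mv.mono_ac h.vol_ac))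
    (hc.fins h hR).2 (hc.lims h hR).2
  simp only [ContinuousLinearMap.toSpanSingleton_apply, hk] at L1
  exact tendsto_nhds_unique L1 L2.neg
lemma IsTest.wg {t φ : Euc n → ℝ} (ht : IsTest Γ t) (hΓ : IsClosed Γ) (hφ : ContDiff ℝ 1 φ) (hφc : HasCompactSupport φ) :
    ∫ x in Γᶜ, t x • gradient φ x = - ∫ x in Γᶜ, φ x • gradient t x := by
  have ht0 : ∀ x, x ∉ Γᶜ → t x = 0 ∧ gradient t x = 0 := fun x hx =>
    ⟨image_eq_zero_of_notMem_tsupport fun hh => hx (ht.sup hh),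
      image_eq_zero_of_notMem_tsupport fun hh => hx (ht.sup (grad_tsupport t hh))⟩
  rw [setIntegral_eq_integral_of_forall_compl_eq_zero (fun x hx => by rw [(ht0 x hx).1, zero_smul]),
    setIntegral_eq_integral_of_forall_compl_eq_zero (fun x hx => by rw [(ht0 x hx).2, smul_zero])]
  have i1 : Integrable fun x => t x • gradient φ x :=
    (ht.cd.continuous.smul (grad_cont hφ)).integrable_of_hasCompactSupport ht.cs.smul_right
  have i2 : Integrable fun x => φ x • gradient t x :=
    (hφ.continuous.smul (grad_cont ht.cd)).integrable_of_hasCompactSupport hφc.smul_right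
  refine ext_inner_right ℝ fun w => ?_
  rw [inner_neg_left, real_inner_comm, ← integral_inner i1, real_inner_comm, ← integral_inner i2]
  have hg : ∀ (f : Euc n → ℝ) x, inner ℝ w (gradient f x) = fderiv ℝ f x w := fun f x => by
    rw [real_inner_comm, gradient, InnerProductSpace.toDual_symm_apply]
  simp only [real_inner_smul_right, hg]
  have c1 : Continuous fun x => fderiv ℝ φ x w := (hφ.continuous_fderiv one_ne_zero).clm_apply continuous_const
  have c2 : Continuous fun x => fderiv ℝ t x w := (ht.cd.continuous_fderiv one_ne_zero).clm_apply continuous_const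
  rw [integral_mul_fderiv_eq_neg_fderiv_mul_of_integrable]
  · congr 2; funext x; ring
  · exact (c2.mul hφ.continuous).integrable_of_hasCompactSupport hφc.mul_left
  · exact (ht.cd.continuous.mul c1).integrable_of_hasCompactSupport ht.cs.mul_right
  · exact (ht.cd.continuous.mul hφ.continuous).integrable_of_hasCompactSupport ht.cs.mul_right
  · exact fun x _ => ht.cd.differentiable one_ne_zero x
  · exact fun x _ => hφ.differentiable one_ne_zero x
lemma Cv.of_m (h : Cx n d C₀ Γ) (hi : InH n d Γ u v) : ∃ us vs, (∀ k, IsTest Γ (us k) ∧ vs k = gradient (us k)) ∧ Cv n d Γ y us vs u v := by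
  obtain ⟨φ, hφ, h1, h2, -⟩ := hi.seq h
  refine ⟨φ, fun k => gradient (φ k), fun k => ⟨hφ k, rfl⟩, fun k => (hφ k).cd.continuous.aestronglyMeasurable,
    fun k => (grad_cont (hφ k).cd).aestronglyMeasurable, hi.meas h, hi.2.1.1, ?_, ?_⟩
  · refine (me_le_m h.hn _).trans_lt (ENNReal.mul_lt_top (by norm_num) ?_)
    rw [lintegral_add_left' (hi.2.1.1.enorm.pow_const 2)]
    exact ENNReal.add_lt_top.2 ⟨MemLp.lint hi.2.1, MemLp.lint hi.1⟩
  · have := ENNReal.Tendsto.const_mul (a := 2) ((ENNReal.Tendsto.pow (n := 2) h2).add (ENNReal.Tendsto.pow (n := 2) h1)) (Or.inr (by norm_num))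
    simp only [sq_l2] at this
    norm_num at this
    refine tendsto_of_tendsto_of_tendsto_of_le_of_le tendsto_const_nhds this (fun k => zero_le) fun k => ?_
    refine (me_le_m h.hn _).trans_eq ?_
    have hh : AEMeasurable (fun x => ‖gradient (φ k) x - v x‖ₑ ^ 2) (measW n d Γ) :=
      ((grad_cont (hφ k).cd).aestronglyMeasurable.sub hi.2.1.1).enorm.pow_const 2
    rw [lintegral_add_left' hh]
lemma InH.wg (h : Cx n d C₀ Γ) (hi : InH n d Γ u v) {φ : Euc n → ℝ} (hφ : ContDiff ℝ 1 φ) (hφc : HasCompactSupport φ) :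
    ∫ x in Γᶜ, u x • gradient φ x = - ∫ x in Γᶜ, φ x • v x := by
  obtain ⟨us, vs, hk, hc⟩ := Cv.of_m (y := 0) h hi
  exact hc.wg h hφ hφc fun k => by rw [(hk k).2]; exact (hk k).1.wg h.cl hφ hφc
end
end
noncomputable section
section
variable {n : ℕ} {d C₀ C₁ : ℝ} {Γ : Set (Euc n)} {T : Euc n → Euc n →L[ℝ] Euc n}
  {y : Euc n} {ρ R Λ w0 θ r e s : ℝ} {u : Euc n → ℝ} {v : Euc n → Euc n} {Cb N : ℝ → ℝ}
  {us : ℕ → Euc n → ℝ} {vs : ℕ → Euc n → Euc n}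
lemma l2_zero {α F : Type*} [MeasurableSpace α] [NormedAddCommGroup F] {μ : Measure α} {f : ℕ → α → F}
    (h : Tendsto (fun k => ∫⁻ x, ‖f k x‖ₑ ^ 2 ∂μ) atTop (𝓝 0)) : Tendsto (fun k => eLpNorm (f k) 2 μ) atTop (𝓝 0) := by
  have h1 := (ENNReal.continuous_rpow_const (y := 1 / 2)).continuousAt.tendsto.comp h
  rw [ENNReal.zero_rpow_of_pos (by norm_num)] at h1
  refine h1.congr fun k => ?_
  rw [Function.comp_apply, ← sq_l2, ← ENNReal.rpow_natCast, ← ENNReal.rpow_mul]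
  norm_num
structure Lm (n : ℕ) (d : ℝ) (Γ : Set (Euc n)) (T : Euc n → Euc n →L[ℝ] Euc n) (y : Euc n) (Cb N : ℝ → ℝ)
    (g : Euc n → ℝ) (V : Euc n → Euc n) : Prop where
  mg : Measurable g
  mV : StronglyMeasurable V
  g0 : ∀ x ∈ Γ, g x = 0
  V0 : ∀ x ∈ Γ, V x = 0
  nn : ∀ᵐ x ∂(measW n d Γ), 0 ≤ g x
  ub : ∀ θ, Adm n θ → ∀ r, 0 < r → ∀ᵐ x ∂(measW n d Γ), 2 * r ≤ dist x y → g x ≤ Cb θ * Mb n d θ (infDist y Γ) r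
  en : ∀ θ, Adm n θ → ∀ r, 0 < r → r ≤ 1 →
    ∫⁻ x in {x | r ≤ dist x y}, (‖V x‖ₑ ^ 2 + ‖g x / infDist x Γ‖ₑ ^ 2) ∂(measW n d Γ) ≤
      ENNReal.ofReal (N θ * r ^ (-((n : ℝ) - 2 + ex n θ)))
  wg : ∀ φ : Euc n → ℝ, ContDiff ℝ 1 φ → HasCompactSupport φ →
    ∫ x in Γᶜ, g x • gradient φ x = - ∫ x in Γᶜ, φ x • V x
  eq : ∀ φ, IsTest Γ φ → ∫ x, inner ℝ (T x (V x)) (gradient φ x) ∂(measW n d Γ) = φ y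
  inH : ∀ (η : Euc n → ℝ) (L : ℝ), ContDiff ℝ 1 η → (∀ x, |η x| ≤ L) → (∀ x, ‖gradient η x‖ * infDist x Γ ≤ L) →
    (∀ᶠ x in 𝓝 y, η x = 0) → InH n d Γ (fun x => η x * g x) (fun x => η x • V x + g x • gradient η x)
lemma fin_of_en (hn : 2 ≤ n) (hN : ∀ θ, 0 ≤ N θ) (he : 0 < e)
    (hen : ∀ θ, Adm n θ → ∀ r, 0 < r → r ≤ 1 →
    ∫⁻ x in {x | r ≤ dist x y}, (‖v x‖ₑ ^ 2 + ‖u x / infDist x Γ‖ₑ ^ 2) ∂(measW n d Γ) ≤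
      ENNReal.ofReal (N θ * r ^ (-((n : ℝ) - 2 + ex n θ)))) :
    ∫⁻ x, (‖v x‖ₑ ^ 2 + ‖u x / infDist x Γ‖ₑ ^ 2) ∂(me n d Γ y e) < ⊤ := by
  obtain ⟨θ, hθ, hex⟩ := exists_adm hn (ε := e / 2) (by positivity)
  refine (me_fin (N := N θ) (e := e) (ex' := ex n θ) (hN θ) (by linarith)
      (f := fun x => ‖v x‖ₑ ^ 2 + ‖u x / infDist x Γ‖ₑ ^ 2) (hen θ hθ)).trans_lt ENNReal.ofReal_lt_top
lemma mul_key (h : Cx n d C₀ Γ) {η : Euc n → ℝ} {L : ℝ} (h1 : ∀ x, |η x| ≤ L) (h2 : ∀ x, ‖gradient η x‖ * infDist x Γ ≤ L)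
    {i : ℕ} (hi : ∀ x ∈ ball y (bj i), η x = 0) (f : Euc n → ℝ) (w : Euc n → Euc n) :
    ∫⁻ x, ‖η x * f x / infDist x Γ‖ₑ ^ 2 ∂(measW n d Γ) ≤ ENNReal.ofReal (2 * L ^ 2) *
      ∫⁻ x in {x | bj i ≤ dist x y}, (‖w x‖ₑ ^ 2 + ‖f x / infDist x Γ‖ₑ ^ 2) ∂(measW n d Γ) ∧
    ∫⁻ x, ‖η x • w x + f x • gradient η x‖ₑ ^ 2 ∂(measW n d Γ) ≤ ENNReal.ofReal (2 * L ^ 2) *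
      ∫⁻ x in {x | bj i ≤ dist x y}, (‖w x‖ₑ ^ 2 + ‖f x / infDist x Γ‖ₑ ^ 2) ∂(measW n d Γ) := by
  have hg : ∀ x ∈ ball y (bj i), gradient η x = 0 := fun x hx => by
    have : η =ᶠ[𝓝 x] fun _ => 0 := by
      filter_upwards [isOpen_ball.mem_nhds hx] with z hz using hi z hz
    rw [gradient, this.fderiv_eq]; simp
  have hL : 0 ≤ L := (abs_nonneg _).trans (h1 0)
  have a1 : ∀ x, ‖η x‖ₑ ≤ ENNReal.ofReal L := fun x => by
    rw [← ofReal_norm]; exact ENNReal.ofReal_le_ofReal (h1 x)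
  have a2 : ∀ x, x ∉ Γ → ‖f x • gradient η x‖ₑ ≤ ENNReal.ofReal L * ‖f x / infDist x Γ‖ₑ := fun x hx => by
    have hd := h.dpos hx
    rw [← ofReal_norm, ← ofReal_norm, ← ENNReal.ofReal_mul hL]
    refine ENNReal.ofReal_le_ofReal ?_
    rw [norm_smul, norm_div, Real.norm_of_nonneg hd.le, mul_div_assoc', le_div_iff₀ hd]
    nlinarith [h2 x, norm_nonneg (f x)]
  have e2 : ENNReal.ofReal (2 * L ^ 2) = 2 * ENNReal.ofReal L ^ 2 := by
    rw [ENNReal.ofReal_mul (by norm_num), ENNReal.ofReal_pow hL]; norm_num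
  have hS := meas_ext (n := n) y (bj i)
  rw [← lintegral_const_mul' _ _ ENNReal.ofReal_ne_top, ← lintegral_indicator hS]
  constructor
  · refine lintegral_mono_ae ?_
    filter_upwards [h.m_notMem] with x hx
    by_cases hb : bj i ≤ dist x y
    · rw [indicator_of_mem (show x ∈ {x | bj i ≤ dist x y} from hb), mul_div_assoc, enorm_mul, mul_pow, e2]
      calc _ ≤ ENNReal.ofReal L ^ 2 * ‖f x / infDist x Γ‖ₑ ^ 2 := by gcongr; exact a1 x
        _ ≤ 2 * ENNReal.ofReal L ^ 2 * ‖f x / infDist x Γ‖ₑ ^ 2 := by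
          gcongr; nth_rewrite 1 [← one_mul (ENNReal.ofReal L ^ 2)]; gcongr; norm_num
        _ ≤ _ := by gcongr; exact le_add_self
    · rw [hi x (mem_ball.2 (not_le.1 hb))]; simp
  · refine lintegral_mono_ae ?_
    filter_upwards [h.m_notMem] with x hx
    by_cases hb : bj i ≤ dist x y
    · rw [indicator_of_mem (show x ∈ {x | bj i ≤ dist x y} from hb), e2]
      calc _ ≤ (ENNReal.ofReal L * ‖w x‖ₑ + ENNReal.ofReal L * ‖f x / infDist x Γ‖ₑ) ^ 2 := by
            gcongr
            refine (enorm_add_le _ _).trans (add_le_add ?_ (a2 x hx))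
            rw [enorm_smul]; gcongr; exact a1 x
        _ ≤ _ := (add_sq_le_enn _ _).trans_eq (by ring)
    · rw [hi x (mem_ball.2 (not_le.1 hb)), hg x (mem_ball.2 (not_le.1 hb))]; simp
lemma Cv.inH (h : Cx n d C₀ Γ) (hc : Cv n d Γ y us vs u v) (hI : ∀ k, InH n d Γ (us k) (vs k)) {η : Euc n → ℝ} {L : ℝ}
    (hη : ContDiff ℝ 1 η) (h1 : ∀ x, |η x| ≤ L) (h2 : ∀ x, ‖gradient η x‖ * infDist x Γ ≤ L)
    (h0 : ∀ᶠ x in 𝓝 y, η x = 0) : InH n d Γ (fun x => η x * u x) (fun x => η x • v x + u x • gradient η x) := by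
  obtain ⟨ε, hε, hb⟩ := Metric.eventually_nhds_iff_ball.1 h0
  obtain ⟨i, hi⟩ := (bj_lim.eventually (gt_mem_nhds hε)).exists
  have hi0 : ∀ x ∈ ball y (bj i), η x = 0 := fun x hx => hb x (ball_subset_ball hi.le hx)
  have hηm := hη.continuous.aestronglyMeasurable (μ := measW n d Γ)
  have hgm := (grad_cont hη).aestronglyMeasurable (μ := measW n d Γ)
  have K := mul_key h h1 h2 hi0
  have K2 : ∀ (f : Euc n → ℝ) (w : Euc n → Euc n),
    ∫⁻ x in {x | bj i ≤ dist x y}, (‖w x‖ₑ ^ 2 + ‖f x / infDist x Γ‖ₑ ^ 2) ∂(measW n d Γ) ≤ _ := fun f w => me_le (e := 1) _ i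
  have hfin : ENNReal.ofReal (2 * L ^ 2) *
      ∫⁻ x in {x | bj i ≤ dist x y}, (‖v x‖ₑ ^ 2 + ‖u x / infDist x Γ‖ₑ ^ 2) ∂(measW n d Γ) < ⊤ :=
    ENNReal.mul_lt_top ENNReal.ofReal_lt_top ((K2 u v).trans_lt (ENNReal.mul_lt_top ENNReal.ofReal_lt_top hc.fin))
  have hl : Tendsto (fun k => ENNReal.ofReal (2 * L ^ 2) *
      ∫⁻ x in {x | bj i ≤ dist x y}, (‖vs k x - v x‖ₑ ^ 2 + ‖(us k x - u x) / infDist x Γ‖ₑ ^ 2) ∂(measW n d Γ)) atTop (𝓝 0) := by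
    have t1 := ENNReal.Tendsto.const_mul (a := ENNReal.ofReal (bj i ^ (-((n : ℝ) - 2 + 1)))) hc.lim (Or.inr ENNReal.ofReal_ne_top)
    rw [mul_zero] at t1
    have t2 := ENNReal.Tendsto.const_mul (a := ENNReal.ofReal (2 * L ^ 2))
      (tendsto_of_tendsto_of_tendsto_of_le_of_le tendsto_const_nhds t1 (fun k => zero_le) fun k => K2 (fun x => us k x - u x) (fun x => vs k x - v x)) (Or.inr ENNReal.ofReal_ne_top)
    rwa [mul_zero] at t2
  have q1 := l2_zero (f := fun k x => (η x * us k x - η x * u x) / infDist x Γ) (μ := measW n d Γ)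
    (tendsto_of_tendsto_of_tendsto_of_le_of_le tendsto_const_nhds hl (fun k => zero_le) fun k => by
      have := (K (fun x => us k x - u x) (fun x => vs k x - v x)).1
      simpa only [mul_sub] using this)
  have q2 := l2_zero (f := fun k x => (η x • vs k x + us k x • gradient η x) - (η x • v x + u x • gradient η x)) (μ := measW n d Γ)
    (tendsto_of_tendsto_of_tendsto_of_le_of_le tendsto_const_nhds hl (fun k => zero_le) fun k => by
      have := (K (fun x => us k x - u x) (fun x => vs k x - v x)).2
      refine le_trans (le_of_eq ?_) this
      congr 1; funext x; congr 2
      rw [smul_sub, sub_smul]; abel)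
  refine InH.lim (memLp_of_lint (meas_div (hηm.mul hc.mu)) ((K u v).1.trans_lt hfin))
    (memLp_of_lint ((hηm.smul hc.mv).add (hc.mu.smul hgm)) ((K u v).2.trans_lt hfin)) fun ε hε => ?_
  obtain ⟨k, hk1, hk2⟩ := ((q1.eventually (gt_mem_nhds hε)).and (q2.eventually (gt_mem_nhds hε))).exists
  exact ⟨_, _, (hI k).mul h hη h1 h2, hk1.le, hk2.le⟩
lemma Cv.eq (h : Cx n d C₀ Γ) (hT : El n d Γ T C₁) (hc : Cv n d Γ y us vs u v) {φ : Euc n → ℝ} (hφ : IsTest Γ φ) :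
    Tendsto (fun k => ∫ x, inner ℝ (T x (vs k x)) (gradient φ x) ∂(measW n d Γ)) atTop
      (𝓝 (∫ x, inner ℝ (T x (v x)) (gradient φ x) ∂(measW n d Γ))) := by
  obtain ⟨R, hR, hs⟩ := bd_ball hφ.cs y
  have hz : ∀ x, x ∉ tsupport φ → gradient φ x = 0 := fun x hx =>
    image_eq_zero_of_notMem_tsupport fun hh => hx (grad_tsupport φ hh)
  have hcw : ContinuousOn (fun x => weightW n d Γ x • gradient φ x) (tsupport φ) := ContinuousOn.smul (fun x hx =>
    ((continuous_infDist_pt Γ).continuousAt.rpow_const (Or.inl (h.dpos (hφ.sup hx)).ne')).continuousWithinAt)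
    (grad_cont hφ.cd).continuousOn
  obtain ⟨C, hC⟩ := hφ.cs.isCompact.exists_bound_of_continuousOn hcw
  set H : Euc n → Euc n →L[ℝ] ℝ := fun x => (innerSL ℝ (weightW n d Γ x • gradient φ x)).comp (T x)
  have hHe : ∀ w : Euc n → Euc n, ∫ x, inner ℝ (T x (w x)) (gradient φ x) ∂(measW n d Γ) = ∫ x in Γᶜ, H x (w x) := fun w => by
    rw [Cx.int_m, setIntegral_eq_integral_of_forall_compl_eq_zero fun x hx => by
      have := hz x fun hh => hx (hφ.sup hh)
      simp [H, this]]
    congr 1; funext x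
    simp only [H, ContinuousLinearMap.comp_apply, innerSL_apply_apply, real_inner_smul_left]
    rw [real_inner_comm]
  have hm : ∀ w : Euc n → Euc n, AEStronglyMeasurable w (measW n d Γ) →
      AEStronglyMeasurable (fun x => H x (w x)) (volume.restrict Γᶜ) := fun w hw => by
    simp only [H, ContinuousLinearMap.comp_apply, innerSL_apply_apply]
    refine AEStronglyMeasurable.inner ((Cx.meas_w.aestronglyMeasurable).smul (grad_cont hφ.cd).aestronglyMeasurable) ?_
    exact (isBoundedBilinearMap_apply.continuous.comp_aestronglyMeasurable₂ hT.meas hw).mono_ac h.vol_ac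
  simp only [hHe]
  refine lim_gen (R := R) (y := y) h.cl (c := ENNReal.ofReal (|C| * C₁)) ENNReal.ofReal_ne_top (fun x _ => ?_) (fun x hx => ?_)
    (fun k => hm _ (hc.mvs k)) (hm _ hc.mv) (hc.fins h hR).2 (hc.lims h hR).2
  · rw [← ofReal_norm]
    refine ENNReal.ofReal_le_ofReal ((ContinuousLinearMap.opNorm_comp_le _ _).trans ?_)
    rw [innerSL_apply_norm]
    refine mul_le_mul ?_ (hT.bd x) (norm_nonneg _) (abs_nonneg _)
    by_cases hx : x ∈ tsupport φ
    · exact (hC x hx).trans (le_abs_self _)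
    · rw [hz x hx]; simp
  · simp [H, (hs x hx).2]
lemma exists_lm (h : Cx n d C₀ Γ) (hT : El n d Γ T C₁) (hN : ∀ θ, 0 ≤ N θ)
    (hA : ∀ s, 0 < s → ∃ u v, Ap n d Γ T y Cb N s u v) : ∃ g V, Lm n d Γ T y Cb N g V := by
  obtain ⟨G, V, us, vs, mG, mV, hj⟩ := exists_lim h hT hN hA
  have hlim : Tendsto (fun j => ∫⁻ x, (‖vs j x - V x‖ₑ ^ 2 + ‖us j x / infDist x Γ - G x‖ₑ ^ 2) ∂(me n d Γ y 1)) atTop (𝓝 0) := by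
    refine tendsto_of_tendsto_of_tendsto_of_le_of_le tendsto_const_nhds ?_ (fun j => zero_le) fun j => (hj j).2
    have := (ENNReal.continuous_ofReal.tendsto 0).comp bj_lim
    simpa [Function.comp_def] using this
  have t1 := tendstoInMeasure_of_tendsto_eLpNorm (p := 2) (μ := me n d Γ y 1) (l := atTop) (by norm_num)
      (fun k => (hj k).1.inH.1.1.mono_ac me_ac) mG.aestronglyMeasurable (l2_zero (f := fun k x => us k x / infDist x Γ - G x)
        (tendsto_of_tendsto_of_tendsto_of_le_of_le tendsto_const_nhds hlim (fun _ => zero_le) fun k =>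
          lintegral_mono fun x => le_add_self))
  obtain ⟨ns, hns, hae⟩ := t1.exists_seq_tendsto_ae
  have t2 := tendstoInMeasure_of_tendsto_eLpNorm (p := 2) (μ := me n d Γ y 1) (l := atTop) (by norm_num)
      (fun k => (hj (ns k)).1.inH.2.1.1.mono_ac me_ac) mV.aestronglyMeasurable (l2_zero (f := fun k x => vs (ns k) x - V x)
        (tendsto_of_tendsto_of_tendsto_of_le_of_le tendsto_const_nhds (hlim.comp hns.tendsto_atTop) (fun _ => zero_le) fun k =>
          lintegral_mono fun x => le_self_add))
  obtain ⟨ms, hms, hae2⟩ := t2.exists_seq_tendsto_ae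
  set ks := fun k => ns (ms k)
  have hks : Tendsto ks atTop atTop := hns.tendsto_atTop.comp hms.tendsto_atTop
  set g : Euc n → ℝ := fun x => infDist x Γ * G x
  set W : Euc n → Euc n := Γᶜ.indicator V
  have hgd : ∀ x, x ∉ Γ → g x / infDist x Γ = G x := fun x hx => by
    have := (h.dpos hx).ne'
    simp only [g]; field_simp
  have mg : Measurable g := measurable_infDist.mul mG.measurable
  have mW : StronglyMeasurable W := mV.indicator h.cl.measurableSet.compl
  have hW : ∀ x, x ∉ Γ → W x = V x := fun x hx => indicator_of_mem (show x ∈ Γᶜ from hx) V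
  have aeU : ∀ᵐ x ∂(measW n d Γ), Tendsto (fun k => us (ks k) x / infDist x Γ) atTop (𝓝 (g x / infDist x Γ)) := by
    filter_upwards [ac_me h.hn hae, h.m_notMem] with x hx hxΓ
    rw [hgd x hxΓ]
    exact hx.comp hms.tendsto_atTop
  have aeU' : ∀ᵐ x ∂(measW n d Γ), Tendsto (fun k => us (ks k) x) atTop (𝓝 (g x)) := by
    filter_upwards [aeU, h.m_notMem] with x hx hxΓ
    have hd := (h.dpos hxΓ).ne'
    have := hx.mul_const (infDist x Γ)
    simpa [div_mul_cancel₀ _ hd] using this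
  have aeV : ∀ᵐ x ∂(measW n d Γ), Tendsto (fun k => vs (ks k) x) atTop (𝓝 (W x)) := by
    filter_upwards [ac_me h.hn hae2, h.m_notMem] with x hx hxΓ
    rw [hW x hxΓ]
    exact hx
  have en : ∀ θ, Adm n θ → ∀ r, 0 < r → r ≤ 1 →
    ∫⁻ x in {x | r ≤ dist x y}, (‖W x‖ₑ ^ 2 + ‖g x / infDist x Γ‖ₑ ^ 2) ∂(measW n d Γ) ≤
      ENNReal.ofReal (N θ * r ^ (-((n : ℝ) - 2 + ex n θ))) := fun θ hθ r hr hr1 => by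
    calc _ = ∫⁻ x in {x | r ≤ dist x y}, liminf (fun k => ‖vs (ks k) x‖ₑ ^ 2 + ‖us (ks k) x / infDist x Γ‖ₑ ^ 2) atTop ∂(measW n d Γ) := by
          refine lintegral_congr_ae (ae_restrict_of_ae ?_)
          filter_upwards [aeU, aeV] with x h1 h2
          exact (Tendsto.liminf_eq ((ENNReal.Tendsto.pow h2.enorm).add (ENNReal.Tendsto.pow h1.enorm))).symm
      _ ≤ _ := lintegral_liminf_le' fun k =>
          (((hj (ks k)).1.inH.2.1.1.enorm.pow_const 2).add ((hj (ks k)).1.inH.1.1.enorm.pow_const 2)).restrict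
      _ ≤ liminf (fun _ : ℕ => ENNReal.ofReal (N θ * r ^ (-((n : ℝ) - 2 + ex n θ)))) atTop :=
          liminf_le_liminf (Eventually.of_forall fun k => (hj (ks k)).1.en θ hθ r hr hr1)
      _ = _ := liminf_const _
  have cv : Cv n d Γ y (fun k => us (ks k)) (fun k => vs (ks k)) g W := by
    refine ⟨fun k => (hj (ks k)).1.inH.meas h, fun k => (hj (ks k)).1.inH.2.1.1, mg.aestronglyMeasurable,
      mW.aestronglyMeasurable, fin_of_en h.hn hN one_pos en, (hlim.comp hks).congr fun k => ?_⟩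
    refine lintegral_congr_ae (me_ac.ae_le ?_)
    filter_upwards [h.m_notMem] with x hx
    rw [sub_div, hgd x hx, hW x hx]
  refine ⟨g, W, mg, mW, fun x hx => ?_, fun x hx => indicator_of_notMem (by simpa using hx) _, ?_, fun θ hθ r hr => ?_, en,
    fun φ hφ hφc => cv.wg h hφ hφc fun k => (hj (ks k)).1.inH.wg h hφ hφc, fun φ hφ => ?_,
    fun η L hη h1 h2 h0 => cv.inH h (fun k => (hj (ks k)).1.inH) hη h1 h2 h0⟩
  · simp only [g]; rw [infDist_zero_of_mem hx, zero_mul]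
  · filter_upwards [aeU', ae_all_iff.2 fun k => (hj (ks k)).1.nn] with x h1 h2
    exact ge_of_tendsto' h1 h2
  · obtain ⟨K, hK⟩ := eventually_atTop.1 ((bj_lim.comp hks).eventually (gt_mem_nhds hr))
    filter_upwards [aeU', ae_all_iff.2 fun k : {k // K ≤ k} => (hj (ks k)).1.ub θ hθ r (hK k k.2)] with x h1 h2 h3
    refine le_of_tendsto h1 ?_
    filter_upwards [eventually_ge_atTop K] with k hk using h2 ⟨k, hk⟩ h3
  · have tl := cv.eq h hT hφ
    refine tendsto_nhds_unique tl ?_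
    rw [Metric.tendsto_nhds]
    intro ε hε
    obtain ⟨s, hs, hb⟩ := Metric.continuousAt_iff.1 (hφ.cd.continuous.continuousAt (x := y)) (ε / 2) (by positivity)
    filter_upwards [(bj_lim.comp hks).eventually (gt_mem_nhds hs)] with k hk
    rw [Real.dist_eq]
    refine ((hj (ks k)).1.eq φ hφ (ε / 2) fun x hx => ?_).trans_lt (by linarith)
    have := hb ((mem_ball.1 hx).trans hk)
    rw [Real.dist_eq] at this
    exact this.le
end
end
noncomputable section
section
variable {n : ℕ} {d C₀ C₁ : ℝ} {Γ : Set (Euc n)} {y z : Euc n} {ρ b : ℝ} {u : Euc n → ℝ} {v : Euc n → Euc n}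
  {F : Euc n → ℝ≥0∞}
lemma sf_m : SFinite (measW n d Γ) := by unfold measW; infer_instance
lemma meas_ker (hF : Measurable F) (b : ℝ) :
    Measurable ({p : Euc n × Euc n | dist p.2 p.1 < b}.indicator fun p => F p.2) :=
  (hF.comp measurable_snd).indicator (measurableSet_lt (measurable_snd.dist measurable_fst) measurable_const)
lemma ker_eq (F : Euc n → ℝ≥0∞) (b : ℝ) (z : Euc n) : ∫⁻ x in ball z b, F x ∂(measW n d Γ) =
    ∫⁻ x, {p : Euc n × Euc n | dist p.2 p.1 < b}.indicator (fun p => F p.2) (z, x) ∂(measW n d Γ) := by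
  rw [← lintegral_indicator measurableSet_ball]
  rfl
lemma ton1 (h : Cx n d C₀ Γ) (hF : Measurable F) (hb : 0 < b) :
    ∫⁻ z, (∫⁻ x in ball z b, F x ∂(measW n d Γ)) ∂(μH[d].restrict Γ) ≤
      ENNReal.ofReal (C₀ * (2 * b) ^ d) * ∫⁻ x, F x ∂(measW n d Γ) := by
  have := h.locfin
  have := sf_m (n := n) (d := d) (Γ := Γ)
  simp only [ker_eq]
  rw [lintegral_lintegral_swap (f := fun z x => {p : Euc n × Euc n | dist p.2 p.1 < b}.indicator (fun p => F p.2) (z, x))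
    (meas_ker hF b).aemeasurable, ← lintegral_const_mul' _ _ ENNReal.ofReal_ne_top]
  refine lintegral_mono fun x => ?_
  calc _ = ∫⁻ z, (ball x b).indicator (fun _ => F x) z ∂(μH[d].restrict Γ) := by
        congr 1; funext z
        simp only [indicator, mem_ball', Set.mem_ofPred_eq]
    _ = F x * (μH[d].restrict Γ) (ball x b) := by rw [lintegral_indicator_const measurableSet_ball]
    _ ≤ _ := by rw [mul_comm]; gcongr; exact h.sig_ball x hb
lemma ton2 (h : Cx n d C₀ Γ) (hF : Measurable F) (hfin : ∫⁻ x, F x ∂(measW n d Γ) < ⊤) :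
    ∀ᵐ z ∂(μH[d].restrict Γ), Tendsto (fun j => ENNReal.ofReal (bj j ^ (1 - d)) * ∫⁻ x in ball z (bj j), F x ∂(measW n d Γ))
      atTop (𝓝 0) := by
  have := sf_m (n := n) (d := d) (Γ := Γ)
  have hC := h.hC₀
  have hm : ∀ j, Measurable fun z => ENNReal.ofReal (bj j ^ (1 - d)) * ∫⁻ x in ball z (bj j), F x ∂(measW n d Γ) := fun j => by
    simp only [ker_eq]
    exact (meas_ker hF _).lintegral_prod_right'.const_mul _
  have hs : ∫⁻ z, ∑' j, ENNReal.ofReal (bj j ^ (1 - d)) * ∫⁻ x in ball z (bj j), F x ∂(measW n d Γ) ∂(μH[d].restrict Γ) < ⊤ := by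
    rw [lintegral_tsum fun j => (hm j).aemeasurable]
    calc _ ≤ ∑' j, ENNReal.ofReal ((1 / 2) ^ j) * (ENNReal.ofReal (C₀ * 2 ^ d) * ∫⁻ x, F x ∂(measW n d Γ)) := by
          refine ENNReal.tsum_le_tsum fun j => ?_
          have hb := bj_pos j
          rw [lintegral_const_mul' _ _ ENNReal.ofReal_ne_top]
          refine (mul_le_mul_right (ton1 h hF hb) _).trans_eq ?_
          rw [← mul_assoc, ← mul_assoc, ← ENNReal.ofReal_mul (by positivity), ← ENNReal.ofReal_mul (by positivity)]
          congr 2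
          rw [Real.mul_rpow (by norm_num) hb.le]
          have e : bj j ^ (1 - d) * bj j ^ d = (1 / 2) ^ j := by
            rw [← Real.rpow_add hb, sub_add_cancel, Real.rpow_one, bj]
          rw [← e]; ring
      _ < ⊤ := by
          rw [ENNReal.tsum_mul_right, ← ENNReal.ofReal_tsum_of_nonneg (fun j => by positivity) summable_geometric_two]
          exact ENNReal.mul_lt_top ENNReal.ofReal_lt_top (ENNReal.mul_lt_top ENNReal.ofReal_lt_top hfin)
  filter_upwards [ae_lt_top (Measurable.tsum hm) hs.ne] with z hz
  exact ENNReal.tendsto_atTop_zero_of_tsum_ne_top hz.ne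
lemma avg_sq (h : Cx n d C₀ Γ) (hu : Measurable u) (hu0 : ∀ x ∈ Γ, u x = 0) (hz : z ∈ Γ) (hρ : 0 < ρ) :
    (∫⁻ x in ball z ρ, ‖u x‖ₑ) ^ 2 ≤ ENNReal.ofReal (volume.real (ball (0 : Euc n) 1) * ρ ^ n * (ρ ^ 2 * ρ ^ (n - d - 1))) *
      ∫⁻ x in ball z ρ, ‖u x / infDist x Γ‖ₑ ^ 2 ∂(measW n d Γ) := by
  have hΓ := h.cl.measurableSet
  have e1 : ∫⁻ x in ball z ρ, ‖u x‖ₑ = ∫⁻ x in ball z ρ ∩ Γᶜ, 1 * ‖u x‖ₑ := by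
    rw [inter_comm, ← setLIntegral_indicator hΓ.compl]
    congr 1; funext x
    by_cases hx : x ∈ Γ
    · rw [indicator_of_notMem (by simpa using hx), hu0 x hx]; simp
    · rw [indicator_of_mem (show x ∈ Γᶜ from hx), one_mul]
  have hid : infDist z Γ = 0 := infDist_zero_of_mem hz
  rw [e1]
  refine (cs_lint _ aemeasurable_const hu.enorm.aemeasurable).trans ?_
  have b1 : ∫⁻ x in ball z ρ ∩ Γᶜ, (1 : ℝ≥0∞) ^ 2 ≤ ENNReal.ofReal (volume.real (ball (0 : Euc n) 1) * ρ ^ n) := by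
    simp only [one_pow, lintegral_const, one_mul, Measure.restrict_apply_univ]
    refine (measure_mono inter_subset_left).trans_eq ?_
    rw [← vol_ball z hρ, ofReal_measureReal measure_ball_lt_top.ne]
  have b2 : ∫⁻ x in ball z ρ ∩ Γᶜ, ‖u x‖ₑ ^ 2 ≤ ENNReal.ofReal (ρ ^ 2) * ∫⁻ x in ball z ρ ∩ Γᶜ, ‖u x / infDist x Γ‖ₑ ^ 2 := by
    rw [← lintegral_const_mul' _ _ ENNReal.ofReal_ne_top]
    refine setLIntegral_mono_ae' (measurableSet_ball.inter hΓ.compl) (ae_of_all _ fun x hx => ?_)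
    have h3 := h.dpos hx.2
    have h1 := infDist_le_infDist_add_dist (s := Γ) (x := x) (y := z)
    have h2 := mem_ball.1 hx.1
    rw [enorm_sq_real, enorm_sq_real, ← ENNReal.ofReal_mul (by positivity)]
    refine ENNReal.ofReal_le_ofReal ?_
    rw [div_pow, mul_div_assoc', le_div_iff₀ (by positivity), mul_comm]
    gcongr
    linarith
  have b3 := h.vol_le hρ measurableSet_ball (y := z) subset_rfl fun x => ‖u x / infDist x Γ‖ₑ ^ 2
  rw [hid, zero_add] at b3
  calc _ ≤ ENNReal.ofReal (volume.real (ball (0 : Euc n) 1) * ρ ^ n) * (ENNReal.ofReal (ρ ^ 2) *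
      (ENNReal.ofReal (ρ ^ (n - d - 1)) * ∫⁻ x in ball z ρ, ‖u x / infDist x Γ‖ₑ ^ 2 ∂(measW n d Γ))) := by
        gcongr
        exact b2.trans (by gcongr)
    _ = _ := by
        rw [ENNReal.ofReal_mul (p := volume.real (ball (0 : Euc n) 1) * ρ ^ n) (by positivity), ENNReal.ofReal_mul (p := ρ ^ 2) (by positivity)]
        ring
lemma trace0 (h : Cx n d C₀ Γ) (hu : Measurable u) (hu0 : ∀ x ∈ Γ, u x = 0)
    (hfin : ∫⁻ x, ‖u x / infDist x Γ‖ₑ ^ 2 ∂(measW n d Γ) < ⊤) : ∀ᵐ z ∂(μH[d].restrict Γ), HasTraceAt u z 0 := by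
  have hmF : Measurable fun x => ‖u x / infDist x Γ‖ₑ ^ 2 := ((hu.div measurable_infDist).enorm).pow_const 2
  filter_upwards [ton2 h hmF hfin, ae_restrict_mem h.cl.measurableSet] with z hz hzΓ
  set vn := volume.real (ball (0 : Euc n) 1)
  have hvn : 0 < vn := vol_unit_pos n
  have t2 := ENNReal.Tendsto.const_mul (a := ENNReal.ofReal (vn⁻¹ * 4 ^ n)) hz (Or.inr ENNReal.ofReal_ne_top)
  rw [mul_zero] at t2
  rw [HasTraceAt, Metric.tendsto_nhds]
  intro ε hε
  obtain ⟨J, hJ⟩ := eventually_atTop.1 (t2.eventually (gt_mem_nhds (ENNReal.ofReal_pos.2 (show 0 < ε ^ 2 by positivity))))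
  filter_upwards [Ioo_mem_nhdsGT (bj_pos J)] with ρ hρ
  obtain ⟨j, hj1, hj2⟩ := exists_nat_pow_near_of_lt_one hρ.1 (hρ.2.le.trans (bj_one J)) (y := (1 / 2 : ℝ)) (by norm_num) (by norm_num)
  have hjJ : J ≤ j := by
    by_contra! hlt
    have : bj J ≤ (1 / 2) ^ (j + 1) := pow_le_pow_of_le_one (by norm_num) (by norm_num) (by omega)
    have := hρ.2
    linarith
  have hb := bj_pos j
  have hj2' : ρ ≤ bj j := hj2
  have hj1' : bj j / 2 < ρ := by rw [pow_succ] at hj1; rw [bj]; linarith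
  rw [dist_zero_right, Real.norm_eq_abs]
  refine abs_lt_of_sq_lt_sq ?_ hε.le
  rw [← ENNReal.ofReal_lt_ofReal_iff (by positivity), ← enorm_sq_real]
  refine lt_of_le_of_lt ?_ (hJ j hjJ)
  rw [setAverage_eq, enorm_smul, mul_pow, enorm_sq_real, vol_ball z hρ.1]
  calc _ ≤ ENNReal.ofReal ((vn * (bj j / 2) ^ n)⁻¹ ^ 2) * (∫⁻ x in ball z (bj j), ‖u x‖ₑ) ^ 2 := by
        have hρ0 := hρ.1
        gcongr
        exact (enorm_integral_le_lintegral_enorm _).trans (lintegral_mono_set (ball_subset_ball hj2'))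
    _ ≤ _ := (mul_le_mul_right (avg_sq h hu hu0 hzΓ hb) _)
    _ = _ := by
        change _ * (ENNReal.ofReal (vn * _ * _) * _) = _
        conv_lhs => rw [← mul_assoc, ← ENNReal.ofReal_mul (by positivity)]
        conv_rhs => rw [← mul_assoc, ← ENNReal.ofReal_mul (by positivity)]
        congr 2
        have e1 : bj j ^ ((n : ℝ) - d - 1) * bj j ^ 2 = bj j ^ n * bj j ^ (1 - d) := by
          rw [← Real.rpow_natCast, ← Real.rpow_natCast (bj j) n, ← Real.rpow_add hb, ← Real.rpow_add hb]
          congr 1; push_cast; ring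
        have e2 : (bj j / 2) ^ n = bj j ^ n / 2 ^ n := div_pow _ _ _
        have e3 : (4 : ℝ) ^ n = 2 ^ n * 2 ^ n := by rw [← mul_pow]; norm_num
        rw [mul_comm (bj j ^ 2), e1, e2, e3]
        field_simp
lemma InH.memW (h : Cx n d C₀ Γ) (hi : InH n d Γ u v) : MemW n d Γ u v := by
  have key : ∀ x : Euc n, ∫⁻ t in ball x 1 ∩ Γᶜ, ‖u t‖ₑ < ⊤ ∧ ∫⁻ t in ball x 1 ∩ Γᶜ, ‖v t‖ₑ < ⊤ := fun x => by
    obtain ⟨us, vs, -, hc⟩ := Cv.of_m (y := x) h hi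
    exact hc.fins h one_pos
  have hsub : ∀ x : Euc n, volume.restrict (ball x 1 ∩ Γᶜ) ≤ volume.restrict Γᶜ := fun x =>
    Measure.restrict_mono inter_subset_right le_rfl
  refine ⟨fun x hx => ⟨ball x 1 ∩ Γᶜ, inter_comm (ball x 1) Γᶜ ▸ inter_mem_nhdsWithin Γᶜ (ball_mem_nhds x one_pos), ?_, (key x).1⟩,
    fun x hx => ⟨ball x 1 ∩ Γᶜ, inter_comm (ball x 1) Γᶜ ▸ inter_mem_nhdsWithin Γᶜ (ball_mem_nhds x one_pos), ?_, (key x).2⟩, ?_, ?_⟩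
  · exact ((hi.meas h).mono_ac h.vol_ac).mono_measure (hsub x)
  · exact (hi.2.1.1.mono_ac h.vol_ac).mono_measure (hsub x)
  · exact fun φ hφ hφc _ => hi.wg h (hφ.of_le (by exact_mod_cast le_top)) hφc
  · refine (lintegral_mono' Measure.restrict_le_self fun x => le_of_eq ?_).trans_lt (MemLp.lint hi.2.1)
    rw [ENNReal.ofReal_pow (norm_nonneg _), ofReal_norm]
end
end
noncomputable section
section
variable {n : ℕ} {d C₀ C₁ : ℝ} {Γ : Set (Euc n)} {T : Euc n → Euc n →L[ℝ] Euc n} {y z : Euc n} {ρ b θ δ r t : ℝ}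
  {u g : Euc n → ℝ} {v V : Euc n → Euc n} {Cb N : ℝ → ℝ}
lemma exists_adm' (hn : 2 ≤ n) {ε : ℝ} (hε : 0 < ε) : ∃ θ, Adm n θ ∧ ex n θ ≤ ε ∧ (3 ≤ n → ex n θ = 0) := by
  rcases Nat.lt_or_ge 2 n with h | h
  · exact ⟨2 / n, Or.inl ⟨h, rfl⟩, by rw [ex_zero h]; exact hε.le, fun _ => ex_zero h⟩
  · obtain ⟨θ, h1, h2⟩ := exists_adm hn hε
    exact ⟨θ, h1, h2, fun h3 => absurd h3 (by omega)⟩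
lemma Mb_far (hn : 2 ≤ n) (hdn : d < (n : ℝ) - 1) (hθ : Adm n θ) (hδ : 0 < δ) (hr1 : t / 4 ≤ r) (hr2 : 2 * r ≤ t) (ht : 0 < t) (h4 : δ ≤ 4 * t) :
    Mb n d θ δ r ≤ (5 ^ ((n : ℝ) - d - 1) * 20 ^ ex n θ * (1 / 4) ^ (2 - (n : ℝ))) * t ^ (1 - d) := by
  have hn2 : (2 : ℝ) ≤ n := by exact_mod_cast hn
  have he := hθ.ex_nonneg
  have hr : 0 < r := by linarith
  have a1 : (δ + 2 * r) ^ ((n : ℝ) - d - 1) ≤ (5 * t) ^ ((n : ℝ) - d - 1) :=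
    Real.rpow_le_rpow (by linarith) (by linarith) (by linarith)
  have a2 : ((δ + 2 * r) / r) ^ ex n θ ≤ 20 ^ ex n θ :=
    Real.rpow_le_rpow (by positivity) (by rw [div_le_iff₀ hr]; linarith) he
  have a3 : r ^ (2 - (n : ℝ)) ≤ (1 / 4 * t) ^ (2 - (n : ℝ)) :=
    Real.rpow_le_rpow_of_nonpos (by positivity) (by linarith) (by linarith)
  rw [Mb]
  calc _ ≤ (5 * t) ^ ((n : ℝ) - d - 1) * 20 ^ ex n θ * (1 / 4 * t) ^ (2 - (n : ℝ)) := by gcongr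
    _ = _ := by
      rw [Real.mul_rpow (by norm_num) ht.le, Real.mul_rpow (by norm_num) ht.le]
      have : t ^ (1 - d) = t ^ ((n : ℝ) - d - 1) * t ^ (2 - (n : ℝ)) := by
        rw [← Real.rpow_add ht]; congr 1; ring
      rw [this]; ring
lemma Mb_near (hn : 2 ≤ n) (hdn : d < (n : ℝ) - 1) (hθ : Adm n θ) (hr1 : t / 4 ≤ r) (hr2 : 2 * r ≤ t) (ht : 0 < t) (h4 : 2 * t ≤ δ) :
    Mb n d θ δ r ≤ (2 ^ ((n : ℝ) - d - 1) * 8 ^ ex n θ * (1 / 4) ^ (2 - (n : ℝ))) *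
      (δ ^ ((n : ℝ) - d - 1) * (δ / t) ^ ex n θ * t ^ (2 - (n : ℝ))) := by
  have hn2 : (2 : ℝ) ≤ n := by exact_mod_cast hn
  have he := hθ.ex_nonneg
  have hr : 0 < r := by linarith
  have hδ : 0 < δ := by linarith
  have a1 : (δ + 2 * r) ^ ((n : ℝ) - d - 1) ≤ (2 * δ) ^ ((n : ℝ) - d - 1) :=
    Real.rpow_le_rpow (by linarith) (by linarith) (by linarith)
  have a2 : ((δ + 2 * r) / r) ^ ex n θ ≤ (8 * (δ / t)) ^ ex n θ := by
    refine Real.rpow_le_rpow (by positivity) ?_ he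
    rw [mul_div_assoc', div_le_div_iff₀ hr ht]
    nlinarith
  have a3 : r ^ (2 - (n : ℝ)) ≤ (1 / 4 * t) ^ (2 - (n : ℝ)) :=
    Real.rpow_le_rpow_of_nonpos (by positivity) (by linarith) (by linarith)
  rw [Mb]
  calc _ ≤ (2 * δ) ^ ((n : ℝ) - d - 1) * (8 * (δ / t)) ^ ex n θ * (1 / 4 * t) ^ (2 - (n : ℝ)) := by gcongr
    _ = _ := by
      rw [Real.mul_rpow (by norm_num) ht.le, Real.mul_rpow (by norm_num) hδ.le, Real.mul_rpow (by norm_num) (by positivity)]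
      ring
lemma lq_mem {E : Type*} [NormedAddCommGroup E] (h : Cx n d C₀ Γ) {f : Euc n → E} (hf : StronglyMeasurable f) (hf0 : ∀ x ∈ Γ, f x = 0)
    (hfin : ∀ e, 0 < e → ∫⁻ x, ‖f x‖ₑ ^ 2 ∂(me n d Γ y e) < ⊤) {q : ℝ} (hq : 1 ≤ q) (hqn : q < (n : ℝ) / ((n : ℝ) - 1)) (R : ℝ) :
    MemLp f (ENNReal.ofReal q) (volume.restrict (ball y R)) := by
  have hn2 : (2 : ℝ) ≤ n := by exact_mod_cast h.hn
  have hq0 : 0 < q := by linarith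
  rw [lt_div_iff₀ (by linarith)] at hqn
  have hq2 : q < 2 := by nlinarith
  set e := (n - q * (n - 1)) / q with he
  have he0 : 0 < e := div_pos (by linarith) hq0
  have hqe : q * e = n - q * (n - 1) := by rw [he]; field_simp
  obtain ⟨K, hK, hl⟩ := lq (e := e) h y hq hq2 (by nlinarith) R
  refine ⟨hf.aestronglyMeasurable, ?_⟩
  rw [eLpNorm_lt_top_iff_lintegral_rpow_enorm_lt_top (by simpa using hq0) ENNReal.ofReal_ne_top, ENNReal.toReal_ofReal hq0.le]
  have e1 : ∫⁻ x in ball y R, ‖f x‖ₑ ^ q = ∫⁻ x in ball y R ∩ Γᶜ, ‖f x‖ₑ ^ q := by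
    rw [inter_comm, ← setLIntegral_indicator h.cl.measurableSet.compl]
    congr 1; funext x
    by_cases hx : x ∈ Γ
    · rw [indicator_of_notMem (by simpa using hx), hf0 x hx]; simp [hq0]
    · rw [indicator_of_mem (show x ∈ Γᶜ from hx)]
  rw [e1]
  refine (hl _ hf.aestronglyMeasurable.enorm).trans_lt (ENNReal.mul_lt_top hK (ENNReal.rpow_lt_top_of_nonneg (by positivity) (hfin e he0).ne))
lemma Lm.lq (h : Cx n d C₀ Γ) (hN : ∀ θ, 0 ≤ N θ) (hl : Lm n d Γ T y Cb N g V) {q : ℝ} (hq : 1 ≤ q) (hqn : q < (n : ℝ) / ((n : ℝ) - 1)) (R : ℝ) :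
    MemLp g (ENNReal.ofReal q) (volume.restrict (ball y R)) ∧ MemLp V (ENNReal.ofReal q) (volume.restrict (ball y R)) := by
  have hfin := fun e (he : 0 < e) => fin_of_en (e := e) h.hn hN he hl.en
  constructor
  · have h1 := lq_mem (y := y) h (f := fun x => g x / infDist x Γ) (hl.mg.div measurable_infDist).stronglyMeasurable
      (fun x hx => by rw [hl.g0 x hx, zero_div]) (fun e he => (lintegral_mono fun x => le_add_self).trans_lt (hfin e he)) hq hqn R
    refine h1.of_le_mul (c := infDist y Γ + R) hl.mg.aestronglyMeasurable (ae_restrict_of_forall_mem measurableSet_ball fun x hx => ?_)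
    by_cases hxΓ : x ∈ Γ
    · rw [hl.g0 x hxΓ]; simp
    · have h3 := h.dpos hxΓ
      have h1 := infDist_le_infDist_add_dist (s := Γ) (x := x) (y := y)
      have h2 := mem_ball.1 hx
      rw [norm_div, Real.norm_of_nonneg h3.le, mul_div_assoc', le_div_iff₀ h3, mul_comm]
      gcongr
      linarith
  · exact lq_mem (y := y) h hl.mV hl.V0 (fun e he => (lintegral_mono fun x => le_self_add).trans_lt (hfin e he)) hq hqn R
lemma Lm.dg (hl : Lm n d Γ T y Cb N g V) : IsDistribGradOn g V univ := by
  intro φ hφ hφc _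
  have := hl.wg φ (hφ.of_le (by exact_mod_cast le_top)) hφc
  rw [setIntegral_eq_integral_of_forall_compl_eq_zero (fun x hx => by rw [hl.g0 x (by simpa using hx), zero_smul]),
    setIntegral_eq_integral_of_forall_compl_eq_zero (fun x hx => by rw [hl.V0 x (by simpa using hx), smul_zero])] at this
  simpa only [setIntegral_univ] using this
lemma Lm.tr (h : Cx n d C₀ Γ) (hl : Lm n d Γ T y Cb N g V) {α : Euc n → ℝ} (hα : ContDiff ℝ (⊤ : ℕ∞) α) (hαc : HasCompactSupport α)
    (hα1 : ∀ᶠ x in 𝓝 y, α x = 1) : ∃ vα, InH n d Γ (fun x => (1 - α x) * g x) vα ∧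
      ∀ᵐ z ∂(μH[d].restrict Γ), HasTraceAt (fun x => (1 - α x) * g x) z 0 := by
  have hα' : ContDiff ℝ 1 α := hα.of_le (by exact_mod_cast le_top)
  have hη : ContDiff ℝ 1 fun x => 1 - α x := contDiff_const.sub hα'
  obtain ⟨L1, hL1⟩ := hα'.continuous.bounded_above_of_compact_support hαc
  have hgc : HasCompactSupport fun x => infDist x Γ * ‖gradient α x‖ :=
    hαc.mono' (fun x hx => grad_tsupport α (subset_tsupport _ fun h0 => hx (by
      show _ * ‖gradient α x‖ = 0
      rw [h0, norm_zero, mul_zero])))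
  have hcc : Continuous fun x => infDist x Γ * ‖gradient α x‖ := (continuous_infDist_pt Γ).mul (grad_cont hα').norm
  obtain ⟨L2, hL2⟩ := hcc.bounded_above_of_compact_support hgc
  have hg : ∀ x, ‖gradient (fun x => 1 - α x) x‖ = ‖gradient α x‖ := fun x => by
    rw [norm_grad, norm_grad, fderiv_const_sub, norm_neg]
  have hi := hl.inH (fun x => 1 - α x) (1 + |L1| + |L2|) hη (fun x => by
      have h1 := hL1 x
      rw [Real.norm_eq_abs] at h1
      have := abs_sub (1 : ℝ) (α x)
      rw [abs_one] at this
      have := le_abs_self L1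
      have := abs_nonneg L2
      linarith) (fun x => by
      rw [hg]
      have h2 := hL2 x
      rw [Real.norm_of_nonneg (mul_nonneg infDist_nonneg (norm_nonneg _)), mul_comm] at h2
      have := le_abs_self L2
      have := abs_nonneg L1
      linarith) (by filter_upwards [hα1] with x hx; rw [hx, sub_self])
  have hm : Measurable fun x => (1 - α x) * g x := (measurable_const.sub hα'.continuous.measurable).mul hl.mg
  have hz : ∀ x ∈ Γ, (1 - α x) * g x = 0 := fun x hx => by rw [hl.g0 x hx, mul_zero]
  have hf : ∫⁻ x, ‖(1 - α x) * g x / infDist x Γ‖ₑ ^ 2 ∂(measW n d Γ) < ⊤ := MemLp.lint hi.1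
  have ht := trace0 (u := fun x => (1 - α x) * g x) h hm hz hf
  exact ⟨_, hi, ht⟩
lemma exists_ap (h : Cx n d C₀ Γ) (hT : El n d Γ T C₁) (hy : y ∉ Γ)
    (hCb : ∀ θ, Adm n θ → ∀ (Γ : Set (Euc n)) T y ρ u v, Cx n d C₀ Γ →
      El n d Γ T C₁ → Gr n d Γ T y ρ u v → Measurable u → 0 < ρ → ∀ r, ρ < r →
      ∀ᵐ x ∂(measW n d Γ), 2 * r ≤ dist x y → u x ≤ Cb θ * Mb n d θ (infDist y Γ) r) :
    ∃ N : ℝ → ℝ, (∀ θ, 0 ≤ N θ) ∧ ∃ g V, Lm n d Γ T y Cb N g V := by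
  have hN : ∀ θ, ∃ N : ℝ, 0 ≤ N ∧ (Adm n θ → ∀ ρ u v, Gr n d Γ T y ρ u v → Measurable u → 0 < ρ → ρ ≤ 1 → ρ < infDist y Γ → ∀ r, 0 < r → r ≤ 1 →
      ∫⁻ x in {x | r ≤ dist x y}, (‖v x‖ₑ ^ 2 + ‖u x / infDist x Γ‖ₑ ^ 2) ∂(measW n d Γ) ≤
      ENNReal.ofReal (N * r ^ (-((n : ℝ) - 2 + ex n θ)))) := fun θ => by
    by_cases hθ : Adm n θ
    · obtain ⟨N, hN, hh⟩ := unif h hT hθ y hy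
      exact ⟨N, hN.le, fun _ => hh⟩
    · exact ⟨0, le_rfl, fun hh => absurd hh hθ⟩
  choose N hN0 hN using hN
  refine ⟨N, hN0, exists_lm h hT hN0 fun s hs => ?_⟩
  have hδ := h.dpos hy
  set ρ := min s (min 1 (infDist y Γ / 2)) with hρd
  have hρ : 0 < ρ := by positivity
  have hρ1 : ρ ≤ 1 := (min_le_right _ _).trans (min_le_left _ _)
  have hρδ : ρ < infDist y Γ := ((min_le_right _ _).trans (min_le_right _ _)).trans_lt (by linarith)
  have hbΓ : closedBall y ρ ⊆ Γᶜ := fun x hx hxΓ => by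
    have := infDist_le_dist_of_mem (x := y) hxΓ
    rw [mem_closedBall, dist_comm] at hx; linarith
  obtain ⟨u, v, hg⟩ := Gr.exists h hT hbΓ
  have hm := hg.inH.meas h
  have hg' : Gr n d Γ T y ρ (hm.mk u) v := ⟨hg.inH.congr hm.ae_eq_mk (EventuallyEq.refl _ _), hg.eq⟩
  exact ⟨_, _, (hg'.ap h hT hm.stronglyMeasurable_mk.measurable hρ hρ1 hρδ hCb hN).mono (min_le_left _ _)⟩
end
end
noncomputable section
section
variable {n : ℕ} {d C₀ C₁ : ℝ} {Γ : Set (Euc n)} {T : Euc n → Euc n →L[ℝ] Euc n} {y z : Euc n} {ρ b θ δ r t : ℝ}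
  {u g : Euc n → ℝ} {v V : Euc n → Euc n} {Cb N : ℝ → ℝ}
lemma Lm.good (h : Cx n d C₀ Γ) (hl : Lm n d Γ T y Cb N g V) (Θ : ℕ → ℝ) (hΘ : ∀ k, Adm n (Θ k)) :
    ∃ g' : Euc n → ℝ, g =ᵐ[volume] g' ∧ ∀ x, 0 ≤ g' x ∧ (g' x = 0 ∨ ∀ (k : ℕ) (q : ℚ), 0 < (q : ℝ) → 2 * (q : ℝ) ≤ dist x y →
      g' x ≤ Cb (Θ k) * Mb n d (Θ k) (infDist y Γ) q) := by
  classical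
  let good : Euc n → Prop := fun x => 0 ≤ g x ∧ ∀ (k : ℕ) (q : ℚ), 0 < (q : ℝ) → 2 * (q : ℝ) ≤ dist x y →
      g x ≤ Cb (Θ k) * Mb n d (Θ k) (infDist y Γ) q
  have hg : ∀ᵐ x ∂(measW n d Γ), good x := by
    have h2 : ∀ᵐ x ∂(measW n d Γ), ∀ (k : ℕ) (q : ℚ), 0 < (q : ℝ) → 2 * (q : ℝ) ≤ dist x y →
      g x ≤ Cb (Θ k) * Mb n d (Θ k) (infDist y Γ) q := by
      rw [ae_all_iff]; intro k
      rw [ae_all_iff]; intro q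
      by_cases hq : 0 < (q : ℝ)
      · filter_upwards [hl.ub (Θ k) (hΘ k) q hq] with x hx _ using hx
      · exact ae_of_all _ fun x hq' => absurd hq' hq
    filter_upwards [hl.nn, h2] with x h1 h2 using ⟨h1, h2⟩
  refine ⟨fun x => if good x then g x else 0, ?_, fun x => ?_⟩
  · filter_upwards [h.ac_m hg] with x hx
    by_cases hxg : good x
    · simp only [hxg, if_true]
    · have : x ∈ Γ := by by_contra hc; exact hxg (hx hc)
      simp only [hxg, if_false, hl.g0 x this]
  · by_cases hxg : good x
    · simp only [hxg, if_true]
      exact ⟨hxg.1, Or.inr hxg.2⟩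
    · simp only [hxg, if_false]
      exact ⟨le_rfl, Or.inl trivial⟩
lemma trace_congr {u' : Euc n → ℝ} (hu : u =ᵐ[volume] u') (h : HasTraceAt u z t) : HasTraceAt u' z t := by
  unfold HasTraceAt at h ⊢
  refine h.congr fun ρ => ?_
  exact average_congr (ae_restrict_of_ae hu)
lemma grad_congr {u' : Euc n → ℝ} (hu : u =ᵐ[volume] u') (h : IsDistribGradOn u v univ) : IsDistribGradOn u' v univ := by
  intro φ h1 h2 h3
  rw [← h φ h1 h2 h3]
  refine integral_congr_ae (ae_restrict_of_ae ?_)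
  filter_upwards [hu] with x hx
  rw [hx]
lemma el_of {A : Euc n → Euc n →L[ℝ] Euc n} (h : Cx n d C₀ Γ) (h1 : 1 ≤ C₁) (hA : AEStronglyMeasurable A volume)
    (hE : EllipticOn n d Γ A C₁) : El n d Γ (fun x => (weightW n d Γ x)⁻¹ • A x) C₁ := by
  have hs : ∀ a b : Euc n, ∑ i, a i * b i = inner ℝ a b := fun a b => by
    rw [PiLp.inner_apply]
    exact Finset.sum_congr rfl fun i _ => by simp [mul_comm]
  refine ⟨h1, ?_, fun x => ?_, fun x hx ξ => ?_⟩
  · exact (Cx.meas_w.inv.aestronglyMeasurable).smul (hA.mono_ac m_ac)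
  · by_cases hx : x ∈ Γ
    · have : weightW n d Γ x = 0 := by
        rw [weightW, infDist_zero_of_mem hx, Real.zero_rpow]
        have := h.hdn
        linarith
      have h2 : (weightW n d Γ x)⁻¹ • A x = 0 := by rw [this, inv_zero]; exact zero_smul ℝ (A x)
      simp only [h2, norm_zero]; linarith
    · have hw := h.wpos hx
      rw [norm_smul, norm_inv, Real.norm_of_nonneg hw.le, inv_mul_le_iff₀ hw]
      refine ContinuousLinearMap.opNorm_le_bound _ (by positivity) fun ξ => ?_
      have h2 := (hE x hx).1 ξ (A x ξ)
      rw [hs, real_inner_self_eq_norm_sq, abs_of_nonneg (by positivity)] at h2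
      rcases (norm_nonneg (A x ξ)).eq_or_lt with h0 | h0
      · rw [← h0]; positivity
      · refine le_of_mul_le_mul_right ?_ h0
        nlinarith
  · have hw := h.wpos hx
    have h2 := (hE x hx).2 ξ
    rw [hs] at h2
    rw [smul_apply, inner_smul_left]
    simp only [conj_trivial]
    rw [le_inv_mul_iff₀ hw]
    linarith
lemma eq_of {A : Euc n → Euc n →L[ℝ] Euc n} (h : Cx n d C₀ Γ) (hl : Lm n d Γ (fun x => (weightW n d Γ x)⁻¹ • A x) y Cb N g V)
    {φ : Euc n → ℝ} (hφ : ContDiff ℝ (⊤ : ℕ∞) φ) (hc : HasCompactSupport φ) (hs : tsupport φ ⊆ Γᶜ) :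
    ∫ x in Γᶜ, ∑ i, A x (V x) i * gradient φ x i = φ y := by
  have ht : IsTest Γ φ := ⟨hφ.of_le (by exact_mod_cast le_top), hc, hs⟩
  have h0 : ∀ x ∈ Γ, gradient φ x = 0 := fun x hx => by
    by_contra hne
    exact hs (grad_tsupport φ (subset_tsupport _ hne)) hx
  rw [← hl.eq φ ht, Cx.int_m, setIntegral_eq_integral_of_forall_compl_eq_zero]
  · congr 1; funext x
    by_cases hx : x ∈ Γ
    · simp [h0 x hx]
    · have hw := (h.wpos hx).ne'
      rw [smul_apply, inner_smul_left]
      simp only [conj_trivial]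
      rw [mul_inv_cancel_left₀ hw, PiLp.inner_apply]
      exact Finset.sum_congr rfl fun i _ => by simp [mul_comm]
  · intro x hx
    simp [h0 x (by simpa using hx)]
def Kf (n : ℕ) (d θ : ℝ) : ℝ := 5 ^ ((n : ℝ) - d - 1) * 20 ^ ex n θ * (1 / 4) ^ (2 - (n : ℝ))
def Kn (n : ℕ) (d θ : ℝ) : ℝ := 2 ^ ((n : ℝ) - d - 1) * 8 ^ ex n θ * (1 / 4) ^ (2 - (n : ℝ))
lemma Kf_pos : 0 < Kf n d θ := by unfold Kf; positivity
lemma Kn_pos : 0 < Kn n d θ := by unfold Kn; positivity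
end
/-- existence of the Green function, with its basic properties and
pointwise bounds. -/
theorem statement18 (n : ℕ) (hn : 2 ≤ n) (d : ℝ) (hd0 : 0 < d) (hdn : d < (n : ℝ) - 1)
    (C₀ C₁ : ℝ) (hC₀ : 1 ≤ C₀) (hC₁ : 1 ≤ C₁) :
    ∃ C : ℝ, 0 < C ∧ ∃ Cε : ℝ → ℝ, (∀ ϵ : ℝ, 0 < ϵ → 0 < Cε ϵ) ∧
      ∀ Γ : Set (Euc n), Γ.Nonempty → IsClosed Γ → AhlforsRegular n d C₀ Γ →
      ∀ A : Euc n → Euc n →L[ℝ] Euc n, AEStronglyMeasurable A volume →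
        EllipticOn n d Γ A C₁ →
      ∃ g : Euc n → Euc n → ℝ, ∃ V : Euc n → Euc n → Euc n,
        ∀ y : Euc n, y ∉ Γ →
          (∀ x : Euc n, 0 ≤ g x y) ∧
          IsDistribGradOn (fun x => g x y) (V y) univ ∧
          (∀ R : ℝ, 0 < R → ∀ q : ℝ, 1 ≤ q → q < (n : ℝ) / ((n : ℝ) - 1) →
            MemLp (fun x => g x y) (ENNReal.ofReal q) (volume.restrict (ball y R)) ∧
              MemLp (V y) (ENNReal.ofReal q) (volume.restrict (ball y R))) ∧
          (∀ φ : Euc n → ℝ, ContDiff ℝ (⊤ : ℕ∞) φ → HasCompactSupport φ →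
            tsupport φ ⊆ Γᶜ →
            ∫ x in Γᶜ, ∑ i, A x (V y x) i * gradient φ x i = φ y) ∧
          (∀ α : Euc n → ℝ, ContDiff ℝ (⊤ : ℕ∞) α → HasCompactSupport α →
            (∀ᶠ x in 𝓝 y, α x = 1) →
            ∃ vα : Euc n → Euc n,
              MemW n d Γ (fun x => (1 - α x) * g x y) vα ∧
                ∀ᵐ z ∂(μH[d].restrict Γ),
                  HasTraceAt (fun x => (1 - α x) * g x y) z 0) ∧
          (∀ x : Euc n, x ∉ Γ → x ≠ y →
            (infDist y Γ ≤ 4 * dist x y → g x y ≤ C * dist x y ^ (1 - d)) ∧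
            (3 ≤ n → 2 * dist x y ≤ infDist y Γ →
              g x y ≤ C * dist x y ^ (2 - (n : ℝ)) * infDist y Γ ^ ((n : ℝ) - d - 1)) ∧
            (n = 2 → 2 * dist x y ≤ infDist y Γ → ∀ ϵ : ℝ, 0 < ϵ →
              g x y ≤ Cε ϵ * infDist y Γ ^ ((n : ℝ) - d - 1) *
                (infDist y Γ / dist x y) ^ ϵ)) := by
  have hC : ∀ θ, ∃ C : ℝ, 0 < C ∧ (Adm n θ → ∀ (Γ : Set (Euc n)) T y ρ u v, Cx n d C₀ Γ →
      El n d Γ T C₁ → Gr n d Γ T y ρ u v → Measurable u → 0 < ρ → ∀ r, ρ < r →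
      ∀ᵐ x ∂(measW n d Γ), 2 * r ≤ dist x y → u x ≤ C * Mb n d θ (infDist y Γ) r) := fun θ => by
    by_cases hθ : Adm n θ
    · obtain ⟨C, h1, h2⟩ := green_bd (C₁ := C₁) d C₀ hC₁ hθ
      exact ⟨C, h1, fun _ => h2⟩
    · exact ⟨1, one_pos, fun hh => absurd hh hθ⟩
  choose Cb hCb0 hCb using hC
  have hΘ : ∀ k : ℕ, ∃ θ, Adm n θ ∧ ex n θ ≤ 1 / ((k : ℝ) + 1) ∧ (3 ≤ n → ex n θ = 0) := fun k =>
    exists_adm' hn (by positivity)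
  choose Θ hΘ1 hΘ2 hΘ3 using hΘ
  refine ⟨Cb (Θ 0) * (Kf n d (Θ 0) + Kn n d (Θ 0)), mul_pos (hCb0 _) (add_pos Kf_pos Kn_pos),
    fun ϵ => Cb (Θ ⌈1 / ϵ⌉₊) * Kn n d (Θ ⌈1 / ϵ⌉₊), fun ϵ _ => mul_pos (hCb0 _) Kn_pos, ?_⟩
  intro Γ hne hcl har A hA hE
  have h : Cx n d C₀ Γ := ⟨hn, hd0, hdn, hC₀, hne, hcl, har⟩
  have hT := el_of h hC₁ hA hE
  have hex : ∀ y, ∃ (g V : _) (g' : Euc n → ℝ) (N : ℝ → ℝ), y ∉ Γ → (∀ θ, 0 ≤ N θ) ∧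
      Lm n d Γ (fun x => (weightW n d Γ x)⁻¹ • A x) y Cb N g V ∧ g =ᵐ[volume] g' ∧
      ∀ x, 0 ≤ g' x ∧ (g' x = 0 ∨ ∀ (k : ℕ) (q : ℚ), 0 < (q : ℝ) → 2 * (q : ℝ) ≤ dist x y →
        g' x ≤ Cb (Θ k) * Mb n d (Θ k) (infDist y Γ) q) := fun y => by
    by_cases hy : y ∈ Γ
    · exact ⟨0, 0, 0, 0, fun hh => absurd hy hh⟩
    · obtain ⟨N, hN, g, V, hl⟩ := exists_ap h hT hy hCb
      obtain ⟨g', h1, h2⟩ := hl.good h Θ hΘ1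
      exact ⟨g, V, g', N, fun _ => ⟨hN, hl, h1, h2⟩⟩
  choose g V g' N hg using hex
  refine ⟨fun x y => g' y x, V, fun y hy => ?_⟩
  obtain ⟨hN, hl, hae, hgd⟩ := hg y hy
  refine ⟨fun x => (hgd x).1, grad_congr hae hl.dg, fun R _ q hq hqn => ?_, fun φ h1 h2 h3 => eq_of h hl h1 h2 h3,
    fun α h1 h2 h3 => ?_, fun x _ hxy => ?_⟩
  · obtain ⟨h1, h2⟩ := hl.lq h hN hq hqn R
    exact ⟨h1.ae_eq (ae_restrict_of_ae hae), h2⟩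
  · obtain ⟨vα, hi, ht⟩ := hl.tr h h1 h2 h3
    have hae2 : (fun x => (1 - α x) * g y x) =ᵐ[volume] fun x => (1 - α x) * g' y x := by
      filter_upwards [hae] with x hx
      rw [hx]
    refine ⟨vα, (hi.congr (m_ac.ae_eq hae2) (EventuallyEq.refl _ _)).memW h, ?_⟩
    filter_upwards [ht] with z hz
    exact trace_congr hae2 hz
  · have ht : 0 < dist x y := dist_pos.2 hxy
    have hδ := h.dpos hy
    obtain ⟨q, hq1, hq2⟩ := exists_rat_btwn (show dist x y / 4 < dist x y / 2 by linarith)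
    have hq0 : 0 < (q : ℝ) := by linarith
    have hq2' : 2 * (q : ℝ) ≤ dist x y := by linarith
    have key : ∀ (k : ℕ) (B : ℝ), Mb n d (Θ k) (infDist y Γ) q ≤ B → 0 ≤ B → g' y x ≤ Cb (Θ k) * B := fun k B hB hB0 => by
      rcases (hgd x).2 with h0 | hb
      · rw [h0]; exact mul_nonneg (hCb0 _).le hB0
      · exact (hb k q hq0 hq2').trans (mul_le_mul_of_nonneg_left hB (hCb0 _).le)
    refine ⟨fun h4 => ?_, fun h3 h4 => ?_, fun h2 h4 ϵ hϵ => ?_⟩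
    · refine (key 0 (Kf n d (Θ 0) * dist x y ^ (1 - d)) (Mb_far hn hdn (hΘ1 0) hδ hq1.le hq2' ht h4)
        (mul_nonneg Kf_pos.le (by positivity))).trans ?_
      rw [← mul_assoc]
      have := (hCb0 (Θ 0)).le
      have := (Kn_pos (n := n) (d := d) (θ := Θ 0)).le
      gcongr
      linarith
    · refine (key 0 _ (Mb_near hn hdn (hΘ1 0) hq1.le hq2' ht h4) (by positivity)).trans ?_
      have e : Cb (Θ 0) * (Kn n d (Θ 0) * (infDist y Γ ^ ((n : ℝ) - d - 1) * (infDist y Γ / dist x y) ^ ex n (Θ 0) * dist x y ^ (2 - (n : ℝ)))) =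
          Cb (Θ 0) * (0 + Kn n d (Θ 0)) * dist x y ^ (2 - (n : ℝ)) * infDist y Γ ^ ((n : ℝ) - d - 1) := by
        rw [hΘ3 0 h3, Real.rpow_zero]; ring
      refine e.le.trans ?_
      have := (hCb0 (Θ 0)).le
      have := (Kf_pos (n := n) (d := d) (θ := Θ 0)).le
      gcongr
    · set k := ⌈1 / ϵ⌉₊
      refine (key k _ (Mb_near hn hdn (hΘ1 k) hq1.le hq2' ht h4) (by positivity)).trans ?_
      have e0 : dist x y ^ (2 - (n : ℝ)) = 1 := by
        have hc : 2 - (n : ℝ) = 0 := by rw [h2]; norm_num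
        rw [hc, Real.rpow_zero]
      have e : Cb (Θ k) * (Kn n d (Θ k) * (infDist y Γ ^ ((n : ℝ) - d - 1) * (infDist y Γ / dist x y) ^ ex n (Θ k) * dist x y ^ (2 - (n : ℝ)))) =
          Cb (Θ k) * Kn n d (Θ k) * infDist y Γ ^ ((n : ℝ) - d - 1) * (infDist y Γ / dist x y) ^ ex n (Θ k) := by
        rw [e0]; ring
      refine e.le.trans ?_
      have h1 := (hCb0 (Θ k)).le
      have h2 := (Kn_pos (n := n) (d := d) (θ := Θ k)).le
      have h5 : ex n (Θ k) ≤ ϵ := by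
        refine (hΘ2 k).trans ?_
        have := Nat.le_ceil (1 / ϵ)
        rw [div_le_comm₀ (by positivity) hϵ]
        linarith
      have h6 : 1 ≤ infDist y Γ / dist x y := by
        rw [one_le_div ht]; linarith
      exact mul_le_mul_of_nonneg_left (Real.rpow_le_rpow_of_exponent_le h6 h5) (by positivity)
end
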